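/- arXiv:2407.20374 — 2 statements merged into one kernel-verified Lean document; each statement's English description precedes it below -/
import Mathlib

section
/- Let p be an odd prime. Assume that n is not of the form 2p^k with k ≥ 1, and that it is not the case that p = 3 and n = 5·3^k for some k ≥ 0. Then for every integer d ≥ 1, the reduction map mod p^d O sends Δ onto all of SL₂(O/p^d O). -/
open Matrix
open scoped MatrixGroups

noncomputable section

/-- The ring `O = ℤ[ζ + ζ⁻¹]`, realized as a subalgebra of `ℂ`. -/
abbrev Oring (ζ : ℂ) : Subalgebra ℤ ℂ := Algebra.adjoin ℤ {ζ + ζ⁻¹}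

/-- The element `ζ + ζ⁻¹` of `O`. -/
def lamO (ζ : ℂ) : Oring ζ := ⟨ζ + ζ⁻¹, Algebra.subset_adjoin rfl⟩

/-- The matrix `T = [[1, 2 + ζ + ζ⁻¹], [0, 1]]` in `SL₂(O)`. -/
def Tmat (ζ : ℂ) : SL(2, Oring ζ) :=
  ⟨!![1, 2 + lamO ζ; 0, 1], by rw [Matrix.det_fin_two_of]; ring⟩

/-- The matrix `U = [[-1, 0], [1, -1]]` in `SL₂(O)`. -/
def Umat (ζ : ℂ) : SL(2, Oring ζ) :=
  ⟨!![-1, 0; 1, -1], by rw [Matrix.det_fin_two_of]; ring⟩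

/-- The matrix `R = U * T` in `SL₂(O)`. -/
def Rmat (ζ : ℂ) : SL(2, Oring ζ) := Umat ζ * Tmat ζ

/-- The triangle group `Δ = ⟨T, U⟩ ⊆ SL₂(O)`. -/
def Delta (ζ : ℂ) : Subgroup SL(2, Oring ζ) := Subgroup.closure {Tmat ζ, Umat ζ}

/-- Reduction mod the ideal `J`: the natural map `SL₂(O) → SL₂(O/J)`. -/
def SLred (ζ : ℂ) (J : Ideal (Oring ζ)) : SL(2, Oring ζ) →* SL(2, Oring ζ ⧸ J) :=
  Matrix.SpecialLinearGroup.map (Ideal.Quotient.mk J)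

section part_a
/-- upper elementary matrix -/
def eU {R : Type*} [CommRing R] (x : R) : SL(2, R) := ⟨!![1, x; 0, 1], by simp⟩
/-- lower elementary matrix -/
def eL {R : Type*} [CommRing R] (x : R) : SL(2, R) := ⟨!![1, 0; x, 1], by simp⟩

theorem sl2_ext {R : Type*} [CommRing R] {g h : SL(2, R)} (h00 : g 0 0 = h 0 0) (h01 : g 0 1 = h 0 1)
    (h10 : g 1 0 = h 1 0) (h11 : g 1 1 = h 1 1) : g = h := by
  ext i j
  fin_cases i <;> fin_cases j <;> assumption

section basics
variable {R : Type*} [CommRing R]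
@[simp] theorem eU00 (x : R) : eU x 0 0 = 1 := rfl
@[simp] theorem eU01 (x : R) : eU x 0 1 = x := rfl
@[simp] theorem eU10 (x : R) : eU x 1 0 = 0 := rfl
@[simp] theorem eU11 (x : R) : eU x 1 1 = 1 := rfl
@[simp] theorem eL00 (x : R) : eL x 0 0 = 1 := rfl
@[simp] theorem eL01 (x : R) : eL x 0 1 = 0 := rfl
@[simp] theorem eL10 (x : R) : eL x 1 0 = x := rfl
@[simp] theorem eL11 (x : R) : eL x 1 1 = 1 := rfl
@[simp] theorem slm00 (g h : SL(2, R)) : (g * h) 0 0 = g 0 0 * h 0 0 + g 0 1 * h 1 0 := by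
  simp [Matrix.mul_apply]
@[simp] theorem slm01 (g h : SL(2, R)) : (g * h) 0 1 = g 0 0 * h 0 1 + g 0 1 * h 1 1 := by
  simp [Matrix.mul_apply]
@[simp] theorem slm10 (g h : SL(2, R)) : (g * h) 1 0 = g 1 0 * h 0 0 + g 1 1 * h 1 0 := by
  simp [Matrix.mul_apply]
@[simp] theorem slm11 (g h : SL(2, R)) : (g * h) 1 1 = g 1 0 * h 0 1 + g 1 1 * h 1 1 := by
  simp [Matrix.mul_apply]
@[simp] theorem sli00 (g : SL(2, R)) : g⁻¹ 0 0 = g 1 1 := by rw [SpecialLinearGroup.SL2_inv_expl]; rfl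
@[simp] theorem sli01 (g : SL(2, R)) : g⁻¹ 0 1 = - g 0 1 := by rw [SpecialLinearGroup.SL2_inv_expl]; rfl
@[simp] theorem sli10 (g : SL(2, R)) : g⁻¹ 1 0 = - g 1 0 := by rw [SpecialLinearGroup.SL2_inv_expl]; rfl
@[simp] theorem sli11 (g : SL(2, R)) : g⁻¹ 1 1 = g 0 0 := by rw [SpecialLinearGroup.SL2_inv_expl]; rfl
@[simp] theorem slo00 : (1 : SL(2, R)) 0 0 = 1 := rfl
@[simp] theorem slo01 : (1 : SL(2, R)) 0 1 = 0 := rfl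
@[simp] theorem slo10 : (1 : SL(2, R)) 1 0 = 0 := rfl
@[simp] theorem slo11 : (1 : SL(2, R)) 1 1 = 1 := rfl
@[simp] theorem sln (g : SL(2, R)) (i j : Fin 2) : (-g) i j = - g i j := rfl
@[simp] theorem slmap {S : Type*} [CommRing S] (f : R →+* S) (g : SL(2, R)) (i j : Fin 2) :
    (SpecialLinearGroup.map f g) i j = f (g i j) := rfl
theorem sldet (g : SL(2, R)) : g 0 0 * g 1 1 - g 0 1 * g 1 0 = 1 := by
  have := g.det_coe; rwa [Matrix.det_fin_two] at this
theorem eU_add (x y : R) : eU (x + y) = eU x * eU y := by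
  apply sl2_ext <;> simp [add_comm]
theorem eL_add (x y : R) : eL (x + y) = eL x * eL y := by
  apply sl2_ext <;> simp
theorem eU_neg (x : R) : eU (-x) = (eU x)⁻¹ := by
  apply sl2_ext <;> simp
theorem eL_neg (x : R) : eL (-x) = (eL x)⁻¹ := by
  apply sl2_ext <;> simp
theorem eU_zero : eU (0 : R) = 1 := by apply sl2_ext <;> simp
theorem eL_zero : eL (0 : R) = 1 := by apply sl2_ext <;> simp
/-- upper unipotent part -/
def PU (H : Subgroup SL(2, R)) : AddSubgroup R where
  carrier := {x | eU x ∈ H}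
  zero_mem' := by simp [eU_zero, H.one_mem]
  add_mem' := by intro a b ha hb; simp only [Set.mem_ofPred_eq, eU_add] at *; exact H.mul_mem ha hb
  neg_mem' := by intro a ha; simp only [Set.mem_ofPred_eq, eU_neg] at *; exact H.inv_mem ha
/-- lower unipotent part -/
def PL (H : Subgroup SL(2, R)) : AddSubgroup R where
  carrier := {x | eL x ∈ H}
  zero_mem' := by simp [eL_zero, H.one_mem]
  add_mem' := by intro a b ha hb; simp only [Set.mem_ofPred_eq, eL_add] at *; exact H.mul_mem ha hb
  neg_mem' := by intro a ha; simp only [Set.mem_ofPred_eq, eL_neg] at *; exact H.inv_mem ha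
theorem mem_PU {H : Subgroup SL(2, R)} {x : R} : x ∈ PU H ↔ eU x ∈ H := Iff.rfl
theorem mem_PL {H : Subgroup SL(2, R)} {x : R} : x ∈ PL H ↔ eL x ∈ H := Iff.rfl
end basics

/-- action of SL2 on the projective line -/
instance slAct {L : Type*} [Field L] [DecidableEq L] : MulAction SL(2, L) (OnePoint L) :=
  MulAction.compHom _ (Matrix.SpecialLinearGroup.toGL (n := Fin 2) (R := L))

open OnePoint
section act
variable {L : Type*} [Field L] [DecidableEq L]
theorem act_infty (g : SL(2, L)) : g • (∞ : OnePoint L) = if g 1 0 = 0 then ∞ else ((g 0 0 / g 1 0 : L) : OnePoint L) :=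
  OnePoint.smul_infty_eq_ite _
theorem act_coe (g : SL(2, L)) (k : L) : g • (k : OnePoint L) =
      if g 1 0 * k + g 1 1 = 0 then ∞ else (((g 0 0 * k + g 0 1) / (g 1 0 * k + g 1 1) : L) : OnePoint L) :=
  OnePoint.smul_some_eq_ite
theorem act_infty_iff (g : SL(2, L)) : g • (∞ : OnePoint L) = ∞ ↔ g 1 0 = 0 := by
  rw [act_infty]; split_ifs <;> simp [*]
theorem act_coe_iff (g : SL(2, L)) (k : L) : g • (k : OnePoint L) = k ↔
    g 1 0 * k ^ 2 + (g 1 1 - g 0 0) * k - g 0 1 = 0 := by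
  rw [act_coe]
  have hd := sldet g
  split_ifs with h
  · simp only [OnePoint.infty_ne_coe, false_iff]
    intro h'
    have h2 : g 0 0 * k + g 0 1 = 0 := by linear_combination k * h - h'
    have : (1 : L) = 0 := by
      by_cases hc : g 1 0 = 0
      · rw [hc] at h hd; simp at h; rw [h] at hd; simp at hd
      · have : g 1 0 * 1 = 0 := by linear_combination (-(g 1 0)) * hd + (g 1 0) * (g 0 0) * h  - (g 1 0)^2 * h2
        simp [hc] at this
    exact one_ne_zero this
  · rw [OnePoint.coe_eq_coe, div_eq_iff h]
    constructor <;> intro h' <;> linear_combination -h'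
theorem act_neg (g : SL(2, L)) (x : OnePoint L) : (-g) • x = g • x := by
  cases x with
  | infty => simp [act_infty]
  | coe k =>
    rw [act_coe, act_coe]
    have h1 : (-g) 1 0 * k + (-g) 1 1 = -(g 1 0 * k + g 1 1) := by simp; ring
    have h2 : (-g) 0 0 * k + (-g) 0 1 = -(g 0 0 * k + g 0 1) := by simp; ring
    rw [h1, h2, neg_div_neg_eq]
    simp only [neg_eq_zero]

theorem fix_semi [IsAlgClosed L] (h2 : (2 : L) ≠ 0) (g : SL(2, L)) (ht : (g 0 0 + g 1 1) ^ 2 ≠ 4) :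
    ∃ x y : OnePoint L, x ≠ y ∧ ∀ z, g • z = z ↔ z = x ∨ z = y := by
  have hd := sldet g
  by_cases hc : g 1 0 = 0
  · have hne : g 1 1 - g 0 0 ≠ 0 := by
      intro h; apply ht; rw [hc] at hd; linear_combination 4 * hd + (g 1 1 - g 0 0) * h
    refine ⟨∞, ((g 0 1 / (g 1 1 - g 0 0) : L) : OnePoint L), by simp, ?_⟩
    intro z
    cases z with
    | infty => simp [act_infty_iff, hc]
    | coe k =>
      rw [act_coe_iff, hc, OnePoint.coe_eq_coe, eq_div_iff hne]
      simp only [OnePoint.coe_ne_infty, false_or]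
      constructor <;> intro h <;> linear_combination h
  · obtain ⟨r, hr⟩ := IsAlgClosed.exists_eq_mul_self ((g 0 0 + g 1 1) ^ 2 - 4)
    have hr0 : r ≠ 0 := by rintro rfl; apply ht; linear_combination hr
    have h2c : 2 * g 1 0 ≠ 0 := mul_ne_zero h2 hc
    refine ⟨(((g 0 0 - g 1 1 + r) / (2 * g 1 0) : L) : OnePoint L), (((g 0 0 - g 1 1 - r) / (2 * g 1 0) : L) : OnePoint L), ?_, ?_⟩
    · rw [Ne, OnePoint.coe_eq_coe, div_left_inj' h2c]
      intro h
      have : 2 * r = 0 := by linear_combination h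
      simp_all
    · intro z
      cases z with
      | infty => simp [act_infty_iff, hc]
      | coe k =>
        rw [act_coe_iff, OnePoint.coe_eq_coe, OnePoint.coe_eq_coe, eq_div_iff h2c, eq_div_iff h2c, ← sub_eq_zero (b := g 0 0 - g 1 1 + r), ← sub_eq_zero (b := g 0 0 - g 1 1 - r), ← mul_eq_zero]
        have key : (k * (2 * g 1 0) - (g 0 0 - g 1 1 + r)) * (k * (2 * g 1 0) - (g 0 0 - g 1 1 - r)) = 2 * 2 * g 1 0 * (g 1 0 * k ^ 2 + (g 1 1 - g 0 0) * k - g 0 1) := by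
          linear_combination hr - 4 * hd
        rw [key]
        simp [h2, hc]

theorem fix_par (h2 : (2 : L) ≠ 0) (g : SL(2, L)) (ht : (g 0 0 + g 1 1) ^ 2 = 4) (h1 : g ≠ 1) (h1' : g ≠ -1) :
    ∃ x : OnePoint L, ∀ z, g • z = z ↔ z = x := by
  have hd := sldet g
  by_cases hc : g 1 0 = 0
  · have hne : g 1 1 - g 0 0 = 0 := by
      rw [hc] at hd
      have : (g 1 1 - g 0 0) ^ 2 = 0 := by linear_combination ht - 4 * hd
      simpa using this
    have hb : g 0 1 ≠ 0 := by
      intro hb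
      have : (g 0 0 - 1) * (g 0 0 + 1) = 0 := by rw [hc] at hd; linear_combination hd - g 0 0 * hne
      rcases mul_eq_zero.1 this with h | h
      · apply h1; apply sl2_ext <;> simp [hb, hc]
        · linear_combination h
        · linear_combination h + hne
      · apply h1'; apply sl2_ext <;> simp [hb, hc]
        · linear_combination h
        · linear_combination h + hne
    refine ⟨∞, ?_⟩
    intro z
    cases z with
    | infty => simp [act_infty_iff, hc]
    | coe k =>
      rw [act_coe_iff, hc, hne]
      simp [hb]
  · have h2c : 2 * g 1 0 ≠ 0 := mul_ne_zero h2 hc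
    refine ⟨(((g 0 0 - g 1 1) / (2 * g 1 0) : L) : OnePoint L), ?_⟩
    · intro z
      cases z with
      | infty => simp [act_infty_iff, hc]
      | coe k =>
        rw [act_coe_iff, OnePoint.coe_eq_coe, eq_div_iff h2c, ← sub_eq_zero (b := g 0 0 - g 1 1)]
        have key : (k * (2 * g 1 0) - (g 0 0 - g 1 1)) ^ 2 = 2 * 2 * g 1 0 * (g 1 0 * k ^ 2 + (g 1 1 - g 0 0) * k - g 0 1) := by
          linear_combination  ht - 4 * hd
        rw [← pow_eq_zero_iff (two_ne_zero (α := ℕ)) (a := k * (2 * g 1 0) - (g 0 0 - g 1 1)), key]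
        simp [h2, hc]
end act
end part_a

section part_b
open OnePoint

theorem ncard_fib {α β : Type*} (S : Set α) (hS : S.Finite) (f : α → β) (n : ℕ)
    (h : ∀ a ∈ S, {b | b ∈ S ∧ f b = f a}.ncard = n) : S.ncard = n * (f '' S).ncard := by
  classical
  have h1 := Finset.card_eq_sum_card_image f hS.toFinset
  have h2 : ∀ b ∈ hS.toFinset.image f, (hS.toFinset.filter (fun a => f a = b)).card = n := by
    intro b hb
    simp only [Finset.mem_image, Set.Finite.mem_toFinset] at hb
    obtain ⟨a, ha, rfl⟩ := hb
    rw [← h a ha, ← Set.ncard_coe_finset]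
    congr 1
    ext x; simp
  rw [Finset.sum_congr rfl h2, Finset.sum_const, smul_eq_mul] at h1
  rw [Set.ncard_eq_toFinset_card S hS, h1, mul_comm, ← Set.ncard_coe_finset]
  congr 2
  ext x; simp

theorem trans_card {L : Type*} [AddCommGroup L] (B : Set L) (hB : B.Finite) (P : AddSubgroup L)
    (h : ∀ b ∈ B, ∀ x ∈ P, b + x ∈ B) : Nat.card P ∣ B.ncard := by
  rw [ncard_fib B hB (QuotientAddGroup.mk : L → L ⧸ P) (Nat.card P)]
  · exact dvd_mul_right _ _
  · intro a ha
    have : {b | b ∈ B ∧ (QuotientAddGroup.mk b : L ⧸ P) = QuotientAddGroup.mk a} = (fun x => a + x) '' (P : Set L) := by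
      ext b
      simp only [Set.mem_ofPred_eq, Set.mem_image, SetLike.mem_coe]
      constructor
      · rintro ⟨_, h2⟩
        exact ⟨-a + b, QuotientAddGroup.eq.1 h2.symm, by simp⟩
      · rintro ⟨x, hx, rfl⟩
        exact ⟨h a ha x hx, (QuotientAddGroup.eq.2 (by simpa using hx)).symm⟩
    rw [this, Set.ncard_image_of_injective _ (add_right_injective a)]
    rfl

section dick
variable {L : Type*} [Field L] [DecidableEq L]

/-- stabiliser -/
def st (Γ : Subgroup SL(2, L)) (x : OnePoint L) : Set SL(2, L) := {h | h ∈ Γ ∧ h • x = x}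
/-- parabolic part of the stabiliser -/
def par (Γ : Subgroup SL(2, L)) (x : OnePoint L) : Set SL(2, L) :=
  {h | h ∈ Γ ∧ h ≠ 1 ∧ h ≠ -1 ∧ (h 0 0 + h 1 1) ^ 2 = 4 ∧ h • x = x}

theorem fin_of_sub {Γ : Subgroup SL(2, L)} [Finite Γ] {S : Set SL(2, L)} (h : ∀ x ∈ S, x ∈ Γ) : S.Finite :=
  Set.Finite.subset (Set.toFinite (Γ : Set SL(2, L))) h

theorem orbst (Γ : Subgroup SL(2, L)) [Finite Γ] (x : OnePoint L) :
    (MulAction.orbit Γ x).ncard * (st Γ x).ncard = Nat.card Γ := by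
  have h1 := Subgroup.card_mul_index (MulAction.stabilizer Γ x)
  rw [MulAction.index_stabilizer, mul_comm] at h1
  rw [← h1]
  congr 1
  have : st Γ x = (Subtype.val : Γ → SL(2, L)) '' (MulAction.stabilizer Γ x : Set Γ) := by
    ext h
    simp only [st, Set.mem_ofPred_eq, Set.mem_image, SetLike.mem_coe, MulAction.mem_stabilizer_iff]
    constructor
    · rintro ⟨h1, h2⟩; exact ⟨⟨h, h1⟩, h2, rfl⟩
    · rintro ⟨⟨h, h1⟩, h2, rfl⟩; exact ⟨h1, h2⟩
  rw [this, Set.ncard_image_of_injective _ Subtype.val_injective]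
  rfl

theorem par_conj (Γ : Subgroup SL(2, L)) (x : OnePoint L) (g : SL(2, L)) (hg : g ∈ Γ) :
    (par Γ (g • x)).ncard = (par Γ x).ncard := by
  have : par Γ (g • x) = (fun h => g * h * g⁻¹) '' par Γ x := by
    ext h
    simp only [par, Set.mem_ofPred_eq, Set.mem_image]
    constructor
    · rintro ⟨h1, h2, h3, h4, h5⟩
      refine ⟨g⁻¹ * h * g, ⟨Γ.mul_mem (Γ.mul_mem (Γ.inv_mem hg) h1) hg, ?_, ?_, ?_, ?_⟩, by group⟩
      · intro h'; apply h2; have : h = g * (g⁻¹ * h * g) * g⁻¹ := by group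
        rw [this, h']; simp
      · intro h'; apply h3; have : h = g * (g⁻¹ * h * g) * g⁻¹ := by group
        rw [this, h']; simp
      · rw [← h4]; have hd := sldet g
        congr 1; simp; linear_combination (h 0 0 + h 1 1) * hd
      · rw [mul_smul, mul_smul, h5, ← mul_smul]; simp
    · rintro ⟨h, ⟨h1, h2, h3, h4, h5⟩, rfl⟩
      refine ⟨Γ.mul_mem (Γ.mul_mem hg h1) (Γ.inv_mem hg), ?_, ?_, ?_, ?_⟩
      · intro h'; apply h2; have : h = g⁻¹ * (g * h * g⁻¹) * g := by group
        rw [this, h']; simp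
      · intro h'; apply h3; have : h = g⁻¹ * (g * h * g⁻¹) * g := by group
        rw [this, h']; simp
      · rw [← h4]; have hd := sldet g
        congr 1; simp; linear_combination (h 0 0 + h 1 1) * hd
      · rw [← mul_smul]; simp [mul_smul, h5]
  rw [this, Set.ncard_image_of_injective]
  intro a b; simp

theorem one_ne_neg_one' (h2 : (2 : L) ≠ 0) : (1 : SL(2, L)) ≠ -1 := by
  intro h
  have := congrArg (fun g : SL(2, L) => g 0 0) h
  simp at this
  apply h2; linear_combination this

theorem eU_inj : Function.Injective (eU : L → SL(2, L)) := by
  intro a b h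
  have := congrArg (fun g : SL(2, L) => g 0 1) h
  simpa using this

theorem PU_card (Γ : Subgroup SL(2, L)) : Nat.card (PU Γ) = {x : L | eU x ∈ Γ}.ncard := rfl

theorem PU_finite (Γ : Subgroup SL(2, L)) [Finite Γ] : {x : L | eU x ∈ Γ}.Finite := by
  refine Set.Finite.of_finite_image (f := eU) ?_ eU_inj.injOn
  apply fin_of_sub (Γ := Γ)
  rintro _ ⟨x, hx, rfl⟩; exact hx

theorem par_infty (h2 : (2 : L) ≠ 0) (Γ : Subgroup SL(2, L)) [Finite Γ] (hneg : -1 ∈ Γ) :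
    (par Γ ∞).ncard = 2 * (Nat.card (PU Γ) - 1) := by
  have hnegm : ∀ g, g ∈ Γ → -g ∈ Γ := fun g hg => by simpa using Γ.mul_mem hneg hg
  set Z := {x : L | eU x ∈ Γ} \ {0}
  have hZ : Z.Finite := (PU_finite Γ).sdiff
  have hpar : par Γ ∞ = eU '' Z ∪ (fun x => - eU x) '' Z := by
    ext h
    simp only [par, Set.mem_ofPred_eq, Set.mem_union, Set.mem_image, act_infty_iff, Z, Set.mem_sdiff, Set.mem_singleton_iff]
    constructor
    · rintro ⟨h1, h3, h4, h5, h6⟩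
      have hd := sldet h
      rw [h6] at hd
      have hne : h 1 1 - h 0 0 = 0 := by
        have : (h 1 1 - h 0 0) ^ 2 = 0 := by linear_combination h5 - 4 * hd
        simpa using this
      have : (h 0 0 - 1) * (h 0 0 + 1) = 0 := by linear_combination hd - h 0 0 * hne
      rcases mul_eq_zero.1 this with h' | h'
      · left
        have e : eU (h 0 1) = h := by
          apply sl2_ext <;> simp [h6]
          · linear_combination -h'
          · linear_combination -h' - hne
        refine ⟨h 0 1, ⟨by rwa [e], ?_⟩, e⟩
        intro h0; apply h3; rw [← e, h0, eU_zero]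
      · right
        have e : eU (- h 0 1) = -h := by
          apply sl2_ext <;> simp [h6]
          · linear_combination h'
          · linear_combination h' + hne
        refine ⟨- h 0 1, ⟨by rw [e]; exact hnegm _ h1, ?_⟩, by rw [e]; simp⟩
        intro h0; apply h4; rw [h0, eU_zero] at e; rw [e]; simp
    · rintro (⟨x, ⟨hx, hx0⟩, rfl⟩ | ⟨x, ⟨hx, hx0⟩, rfl⟩)
      · refine ⟨hx, ?_, ?_, ?_, by simp⟩
        · intro h; apply hx0; simpa using congrArg (fun g : SL(2, L) => g 0 1) h
        · intro h; apply hx0; simpa using congrArg (fun g : SL(2, L) => g 0 1) h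
        · simp; norm_num
      · refine ⟨hnegm _ hx, ?_, ?_, ?_, by simp⟩
        · intro h; apply hx0; simpa using congrArg (fun g : SL(2, L) => g 0 1) h
        · intro h; apply hx0; simpa using congrArg (fun g : SL(2, L) => g 0 1) h
        · simp; norm_num
  rw [hpar, Set.ncard_union_eq _ (hZ.image _) (hZ.image _), Set.ncard_image_of_injective _ eU_inj,
    Set.ncard_image_of_injective, Set.ncard_sdiff_singleton_of_mem, PU_card]
  · ring
  · simp [eU_zero, Γ.one_mem]
  · intro a b h; exact eU_inj (neg_injective h)
  · rw [Set.disjoint_left]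
    rintro _ ⟨x, _, rfl⟩ ⟨y, _, h⟩
    have := congrArg (fun g : SL(2, L) => g 0 0) h
    simp at this
    apply h2; linear_combination -this

theorem st_infty (h2 : (2 : L) ≠ 0) (Γ : Subgroup SL(2, L)) [Finite Γ] (hneg : -1 ∈ Γ) (μ : L) (hμ0 : μ ≠ 0)
    (hμ : eU μ ∈ Γ) :
    ∃ k, 1 ≤ k ∧ k ≤ Nat.card (PU Γ) - 1 ∧ (st Γ ∞).ncard = 2 * Nat.card (PU Γ) * k := by
  have hnegm : ∀ g, g ∈ Γ → -g ∈ Γ := fun g hg => by simpa using Γ.mul_mem hneg hg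
  have hfin : (st Γ ∞).Finite := fin_of_sub (Γ := Γ) (fun x hx => hx.1)
  set A := (fun h : SL(2, L) => h 0 0) '' st Γ ∞ with hA
  have hAfin : A.Finite := hfin.image _
  have e1 := ncard_fib (st Γ ∞) hfin (fun h : SL(2, L) => h 0 0) (Nat.card (PU Γ)) (by
    intro a ha
    have : {b | b ∈ st Γ ∞ ∧ b 0 0 = a 0 0} = (fun x => a * eU x) '' {x : L | eU x ∈ Γ} := by
      ext b
      simp only [st, act_infty_iff, Set.mem_ofPred_eq, Set.mem_image] at ha ⊢
      constructor
      · rintro ⟨⟨hb, hb1⟩, hb2⟩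
        have ha' := sldet a
        have hb' := sldet b
        have ha2 := ha.2
        rw [ha2] at ha'
        rw [hb1] at hb'
        have e11 : b 1 1 = a 1 1 := by
          have h3 : b 0 0 * a 1 1 = 1 := by rw [hb2]; linear_combination ha'
          linear_combination (-(b 1 1)) * h3 + a 1 1 * hb'
        have e : eU (a 1 1 * b 0 1 - a 0 1 * b 1 1) = a⁻¹ * b := by
          apply sl2_ext <;> simp [ha2, hb1]
          · rw [hb2]; linear_combination -ha'
          · ring
          · rw [e11]; linear_combination -ha'
        refine ⟨_, by rw [e]; exact Γ.mul_mem (Γ.inv_mem ha.1) hb, by rw [e]; simp⟩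
      · rintro ⟨x, hx, rfl⟩
        refine ⟨⟨Γ.mul_mem ha.1 hx, by simp [ha.2]⟩, by simp⟩
    rw [this, Set.ncard_image_of_injective, PU_card]
    intro x y hxy
    exact eU_inj (mul_left_cancel hxy))
  have e2 := ncard_fib A hAfin (fun a => a ^ 2 * μ) 2 (by
    rintro _ ⟨h, hh, rfl⟩
    have h00 : h 0 0 ≠ 0 := by
      intro h0
      have hd := sldet h
      rw [h0, (act_infty_iff h).1 hh.2] at hd
      simp at hd
    have : {b | b ∈ A ∧ b ^ 2 * μ = (h 0 0) ^ 2 * μ} = {h 0 0, - h 0 0} := by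
      ext b
      simp only [Set.mem_ofPred_eq, Set.mem_insert_iff, Set.mem_singleton_iff, mul_left_inj' hμ0, sq_eq_sq_iff_eq_or_eq_neg]
      constructor
      · exact fun h => h.2
      · intro h'
        refine ⟨?_, h'⟩
        rcases h' with rfl | rfl
        · exact ⟨h, hh, rfl⟩
        · exact ⟨-h, ⟨hnegm _ hh.1, by rw [act_neg]; exact hh.2⟩, rfl⟩
    rw [this, Set.ncard_pair]
    intro h'
    have : 2 * h 0 0 = 0 := by linear_combination h'
    exact h00 ((mul_eq_zero.1 this).resolve_left h2))
  set B := (fun a => a ^ 2 * μ) '' A with hB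
  refine ⟨B.ncard, ?_, ?_, ?_⟩
  · refine (Set.ncard_pos (hAfin.image _)).2 ?_
    exact ⟨_, ⟨_, ⟨1, ⟨Γ.one_mem, by simp⟩, rfl⟩, rfl⟩⟩
  · rw [PU_card, ← Set.ncard_sdiff_singleton_of_mem (a := 0)]
    · apply Set.ncard_le_ncard _ ((PU_finite Γ).sdiff)
      rintro _ ⟨_, ⟨h, hh, rfl⟩, rfl⟩
      have hd := sldet h
      have hc := (act_infty_iff h).1 hh.2
      rw [hc] at hd
      refine ⟨?_, ?_⟩
      · have : eU ((h 0 0) ^ 2 * μ) = h * eU μ * h⁻¹ := by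
          apply sl2_ext <;> simp [hc]
          · linear_combination -hd
          · ring
          · linear_combination -hd
        simp only [Set.mem_ofPred_eq]
        rw [this]
        exact Γ.mul_mem (Γ.mul_mem hh.1 hμ) (Γ.inv_mem hh.1)
      · simp only [Set.mem_singleton_iff, mul_eq_zero, hμ0, or_false, pow_eq_zero_iff two_ne_zero]
        intro h0; rw [h0] at hd; simp at hd
    · simp [eU_zero, Γ.one_mem]
  · rw [e1, e2]; ring

theorem exists_to_infty (y : OnePoint L) : ∃ σ : SL(2, L), σ • (∞ : OnePoint L) = y := by
  cases y with
  | infty => exact ⟨1, by simp⟩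
  | coe k =>
    exact ⟨eU (k - 1) * eL 1, by rw [act_infty]; simp⟩

theorem coe_ncard (B : Set (OnePoint L)) (hB : B.Finite) : {k : L | (k : OnePoint L) ∈ B}.Finite ∧
    (∞ ∉ B → B.ncard = {k : L | (k : OnePoint L) ∈ B}.ncard) ∧
    (∞ ∈ B → B.ncard = {k : L | (k : OnePoint L) ∈ B}.ncard + 1) := by
  have hf : {k : L | (k : OnePoint L) ∈ B}.Finite :=
    Set.Finite.preimage (OnePoint.coe_injective.injOn) hB
  refine ⟨hf, ?_, ?_⟩
  · intro h
    rw [← Set.ncard_image_of_injective _ (OnePoint.coe_injective (X := L))]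
    congr 1
    ext x
    cases x with
    | infty => simp [h]
    | coe k => simp
  · intro h
    rw [← Set.ncard_image_of_injective _ (OnePoint.coe_injective (X := L)), ← Set.ncard_insert_of_notMem (a := ∞) (by simp) (hf.image _)]
    congr 1
    ext x
    cases x with
    | infty => simp [h]
    | coe k => simp

theorem card_zmult (p : ℕ) [Fact p.Prime] [CharP L p] (t : L) (ht : t ≠ 0) :
    Nat.card (AddSubgroup.zmultiples t) = p := by
  rw [Nat.card_zmultiples]
  apply addOrderOf_eq_prime
  · rw [nsmul_eq_mul, CharP.cast_eq_zero, zero_mul]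
  · exact ht

theorem par_fix (p : ℕ) [Fact p.Prime] [CharP L p] (B : Set (OnePoint L)) (hB : B.Finite)
    (hp : ¬ p ∣ B.ncard) (h : SL(2, L)) (hs : ∀ x ∈ B, h • x ∈ B) (h1 : h ≠ 1) (h1' : h ≠ -1)
    (h4 : (h 0 0 + h 1 1) ^ 2 = 4) (y : OnePoint L) (hy : h • y = y) : y ∈ B := by
  obtain ⟨σ, rfl⟩ := exists_to_infty y
  by_contra hcon
  apply hp
  set B' := (fun x => σ⁻¹ • x) '' B
  have hBf : B'.Finite := hB.image _
  have hc : B'.ncard = B.ncard := Set.ncard_image_of_injective _ (MulAction.injective _)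
  have hinf : ∞ ∉ B' := by
    rintro ⟨x, hx, hx2⟩
    apply hcon; simp only at hx2; rw [← hx2]; simpa using hx
  set g := σ⁻¹ * h * σ with hg
  have hgs : ∀ x ∈ B', g • x ∈ B' := by
    rintro _ ⟨x, hx, rfl⟩
    refine ⟨h • x, hs x hx, ?_⟩
    simp [hg, mul_smul]
  have hginf : g • (∞ : OnePoint L) = ∞ := by
    rw [hg, mul_smul, mul_smul, hy, ← mul_smul]; simp
  have hgt : (g 0 0 + g 1 1) ^ 2 = 4 := by
    rw [← h4]; have hd := sldet σ
    congr 1; simp [hg]; linear_combination (h 0 0 + h 1 1) * hd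
  have hσ : h = σ * g * σ⁻¹ := by rw [hg]; group
  have hg1 : g ≠ 1 := by rintro h'; rw [h'] at hσ; simp at hσ; exact h1 hσ
  have hg1' : g ≠ -1 := by rintro h'; rw [h'] at hσ; simp at hσ; exact h1' hσ
  have hc0 := (act_infty_iff g).1 hginf
  have hd := sldet g
  rw [hc0] at hd
  have hne : g 1 1 = g 0 0 := by
    have : (g 1 1 - g 0 0) ^ 2 = 0 := by linear_combination hgt - 4 * hd
    rw [← sub_eq_zero]; simpa using this
  have ha0 : g 0 0 ≠ 0 := by intro h0; rw [h0] at hd; simp at hd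
  have hb : g 0 1 ≠ 0 := by
    intro hb
    have : (g 0 0 - 1) * (g 0 0 + 1) = 0 := by rw [hne] at hd; linear_combination hd
    rcases mul_eq_zero.1 this with h | h
    · apply hg1; apply sl2_ext <;> simp [hb, hc0]
      · linear_combination h
      · rw [hne]; linear_combination h
    · apply hg1'; apply sl2_ext <;> simp [hb, hc0]
      · linear_combination h
      · rw [hne]; linear_combination h
  set t := g 0 1 / g 0 0
  have ht : t ≠ 0 := div_ne_zero hb ha0
  obtain ⟨f1, f2, -⟩ := coe_ncard B' hBf
  rw [← hc, f2 hinf, ← card_zmult p t ht]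
  have hstep : ∀ b ∈ {k : L | (k : OnePoint L) ∈ B'}, b + t ∈ {k : L | (k : OnePoint L) ∈ B'} := by
    intro b hb
    have := hgs _ hb
    rw [act_coe, if_neg (by simp [hc0, hne, ha0])] at this
    have e : (g 0 0 * b + g 0 1) / (g 1 0 * b + g 1 1) = b + t := by
      rw [hc0, hne, zero_mul, zero_add, div_eq_iff ha0, add_mul]
      simp only [t]; rw [div_mul_cancel₀ _ ha0]; ring
    rw [e] at this; exact this
  have hstepn : ∀ n : ℕ, ∀ b ∈ {k : L | (k : OnePoint L) ∈ B'}, b + n • t ∈ {k : L | (k : OnePoint L) ∈ B'} := by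
    intro n
    induction n with
    | zero => intro b hb; simpa using hb
    | succ n ih => intro b hb; rw [succ_nsmul, ← add_assoc]; exact hstep _ (ih _ hb)
  apply trans_card _ f1
  intro b hb x hx
  have hfo : IsOfFinAddOrder t := by
    rw [← addOrderOf_pos_iff, ← Nat.card_zmultiples, card_zmult p t ht]; exact (Fact.out : p.Prime).pos
  rw [← hfo.mem_multiples_iff_mem_zmultiples] at hx
  obtain ⟨n, rfl⟩ := hx
  exact hstepn n b hb

end dick
end part_b

section part_c
open OnePoint
section dick2
variable {L : Type*} [Field L] [DecidableEq L]

theorem orb_st_const (Γ : Subgroup SL(2, L)) [Finite Γ] (x y : OnePoint L)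
    (hx : x ∈ MulAction.orbit Γ y) : (st Γ x).ncard = (st Γ y).ncard := by
  have h1 := orbst Γ x
  have h2 := orbst Γ y
  have h3 : MulAction.orbit Γ x = MulAction.orbit Γ y := MulAction.orbit_eq_iff.2 hx
  rw [h3, ← h2] at h1
  have h4 : 0 < (MulAction.orbit Γ y).ncard := by
    rcases Nat.eq_zero_or_pos (MulAction.orbit Γ y).ncard with h | h
    · rw [h, zero_mul] at h2
      exact absurd h2.symm (Nat.card_pos (α := Γ)).ne'
    · exact h
  exact Nat.eq_of_mul_eq_mul_left h4 h1

theorem orb_sum (Γ : Subgroup SL(2, L)) [Finite Γ] (y : OnePoint L) (O : Finset (OnePoint L))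
    (hO : ∀ x, x ∈ O ↔ x ∈ MulAction.orbit Γ y) :
    (∑ x ∈ O, (((st Γ x).ncard : ℤ) - 2)) = Nat.card Γ - 2 * O.card := by
  rw [Finset.sum_congr rfl (g := fun _ => ((st Γ y).ncard : ℤ) - 2)]
  · rw [Finset.sum_const, nsmul_eq_mul, ← orbst Γ y]
    have : (MulAction.orbit Γ y) = (O : Set (OnePoint L)) := by ext x; simp [hO]
    rw [this, Set.ncard_coe_finset]
    push_cast; ring
  · intro x hx
    rw [orb_st_const Γ x y ((hO x).1 hx)]

theorem orb_card (Γ : Subgroup SL(2, L)) (y : OnePoint L) (O : Finset (OnePoint L))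
    (hO : ∀ x, x ∈ O ↔ x ∈ MulAction.orbit Γ y) : (MulAction.orbit Γ y).ncard = O.card := by
  have : (MulAction.orbit Γ y) = (O : Set (OnePoint L)) := by ext x; simp [hO]
  rw [this, Set.ncard_coe_finset]

set_option maxHeartbeats 2000000 in
theorem counting [IsAlgClosed L] (p : ℕ) [Fact p.Prime] [CharP L p] (h2 : (2 : L) ≠ 0)
    (Γ : Subgroup SL(2, L)) [Finite Γ] (hneg : -1 ∈ Γ) (μ : L) (hμ0 : μ ≠ 0)
    (hμ : eU μ ∈ Γ) (hL : eL 1 ∈ Γ) :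
    ∃ (s r k : ℕ) (y : OnePoint L), s = Nat.card (PU Γ) ∧ p ∣ s ∧ 3 ≤ s ∧ 1 ≤ r ∧ 1 ≤ k ∧ k ≤ s - 1 ∧
      (MulAction.orbit Γ (∞ : OnePoint L)).ncard = 1 + s * r ∧
      (st Γ ∞).ncard = 2 * s * k ∧
      ((1 + s * r) * (s - 2) + 2) * (st Γ y).ncard = (1 + s * r) * (2 * s * k) ∧
      ((0 : L) : OnePoint L) ∈ MulAction.orbit Γ (∞ : OnePoint L) ∧
      ∀ h ∈ Γ, h ≠ 1 → h ≠ -1 → ∀ x, h • x = x → x ∈ MulAction.orbit Γ (∞ : OnePoint L) ∨ x ∈ MulAction.orbit Γ y := by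
  classical
  have hpp : p.Prime := Fact.out
  have hp3 : 3 ≤ p := by
    rcases hpp.eq_two_or_odd with h | h
    · exfalso; apply h2; have := CharP.cast_eq_zero L p; rw [h] at this; exact_mod_cast this
    · have := hpp.two_le; omega
  have hnegm : ∀ g, g ∈ Γ → -g ∈ Γ := fun g hg => by simpa using Γ.mul_mem hneg hg
  obtain ⟨k, hk1, hk2, hk⟩ := st_infty h2 Γ hneg μ hμ0 hμ
  obtain ⟨s, hs⟩ : ∃ s, s = Nat.card (PU Γ) := ⟨_, rfl⟩
  have hPf : Finite (PU Γ) := (PU_finite Γ).to_subtype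
  have hps : p ∣ s := by
    rw [hs, ← card_zmult p μ hμ0]
    apply AddSubgroup.card_dvd_of_le
    rw [AddSubgroup.zmultiples_le]; exact hμ
  have hspos : 0 < s := by rw [hs]; exact Nat.card_pos
  have hs3 : 3 ≤ s := le_trans hp3 (Nat.le_of_dvd hspos hps)
  rw [← hs] at hk hk2
  set Ω := MulAction.orbit Γ (∞ : OnePoint L) with hΩ
  have hΩfin : Ω.Finite := Set.finite_range _
  have hstab : ∀ (y : OnePoint L), ∀ h ∈ Γ, ∀ x ∈ MulAction.orbit Γ y, h • x ∈ MulAction.orbit Γ y := by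
    intro y h hh x hx
    exact MulAction.mem_orbit_of_mem_orbit (⟨h, hh⟩ : Γ) hx
  have hinf : ∞ ∈ Ω := MulAction.mem_orbit_self _
  obtain ⟨cf1, -, cf2⟩ := coe_ncard Ω hΩfin
  have cf2 := cf2 hinf
  have hsdvd : s ∣ {k : L | (k : OnePoint L) ∈ Ω}.ncard := by
    rw [hs]
    apply trans_card _ cf1
    intro b hb x hx
    have := hstab _ _ (mem_PU.1 hx) _ hb
    rw [act_coe] at this
    simpa [add_comm] using this
  obtain ⟨r, hr⟩ := hsdvd
  rw [hr] at cf2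
  have hpω : ¬ p ∣ Ω.ncard := by
    rw [cf2]; intro h
    have := (Nat.dvd_add_right (Dvd.dvd.mul_right hps r)).1 h
    exact hpp.one_lt.ne' (Nat.dvd_one.1 this)
  have hparΩ : ∀ h ∈ Γ, h ≠ 1 → h ≠ -1 → (h 0 0 + h 1 1) ^ 2 = 4 → ∀ y : OnePoint L, h • y = y → y ∈ Ω := by
    intro h hh e1 e2 e3 y hy
    exact par_fix p Ω hΩfin hpω h (hstab _ h hh) e1 e2 e3 y hy
  have h0Ω : ((0 : L) : OnePoint L) ∈ Ω := by
    apply hparΩ _ hL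
    · intro h; simpa using congrArg (fun g : SL(2, L) => g 1 0) h
    · intro h; simpa using congrArg (fun g : SL(2, L) => g 1 0) h
    · simp; norm_num
    · rw [act_coe]; simp
  have hr1 : 1 ≤ r := by
    by_contra hcon
    have : r = 0 := by omega
    rw [this, mul_zero, Set.ncard_eq_zero cf1] at hr
    have : (0 : L) ∈ {k : L | (k : OnePoint L) ∈ Ω} := h0Ω
    rw [hr] at this; exact this
  have hΓfin : (Γ : Set SL(2, L)).Finite := Set.toFinite _
  set G := hΓfin.toFinset with hG
  have memG : ∀ g, g ∈ G ↔ g ∈ Γ := by intro g; simp [hG]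
  have cardG : G.card = Nat.card Γ := by
    rw [hG, ← Set.ncard_eq_toFinset_card _ hΓfin]; rfl
  have hpm : (1 : SL(2, L)) ≠ -1 := one_ne_neg_one' h2
  set Gs := (G.erase 1).erase (-1) with hGs
  have memGs : ∀ g, g ∈ Gs ↔ g ∈ Γ ∧ g ≠ 1 ∧ g ≠ -1 := by
    intro g; simp [hGs, memG]; tauto
  have cardGs : (Gs.card : ℤ) = Nat.card Γ - 2 := by
    have e1 := Finset.card_erase_add_one ((memG 1).2 Γ.one_mem)
    have e2 := Finset.card_erase_add_one (s := G.erase 1) (a := -1) (by simp [hpm.symm, memG, hneg])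
    rw [← hGs] at e2
    rw [← cardG]; push_cast [← e1, ← e2]; ring
  have hfixfin : ∀ h ∈ Gs, {z : OnePoint L | h • z = z}.Finite := by
    intro h hh
    rw [memGs] at hh
    by_cases ht : (h 0 0 + h 1 1) ^ 2 = 4
    · obtain ⟨x, hx⟩ := fix_par h2 h ht hh.2.1 hh.2.2
      have : {z : OnePoint L | h • z = z} = {x} := by ext z; simp [hx]
      rw [this]; simp
    · obtain ⟨x, y, -, hx⟩ := fix_semi h2 h ht
      have : {z : OnePoint L | h • z = z} = {x, y} := by ext z; simp [hx]
      rw [this]; simp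
  have hXfin : {z : OnePoint L | ∃ h ∈ Gs, h • z = z}.Finite := by
    have : {z : OnePoint L | ∃ h ∈ Gs, h • z = z} = ⋃ h ∈ Gs, {z : OnePoint L | h • z = z} := by
      ext z; simp
    rw [this]
    exact Set.Finite.biUnion (Finset.finite_toSet Gs) hfixfin
  set X := hXfin.toFinset with hX
  have memX : ∀ z, z ∈ X ↔ ∃ h ∈ Gs, h • z = z := by intro z; simp [hX]
  have hXstab : ∀ g ∈ Γ, ∀ z ∈ X, g • z ∈ X := by
    intro g hg z hz
    rw [memX] at hz ⊢
    obtain ⟨h, hh, hz⟩ := hz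
    rw [memGs] at hh
    refine ⟨g * h * g⁻¹, ?_, ?_⟩
    · rw [memGs]
      refine ⟨Γ.mul_mem (Γ.mul_mem hg hh.1) (Γ.inv_mem hg), ?_, ?_⟩
      · intro h'; apply hh.2.1; have : h = g⁻¹ * (g * h * g⁻¹) * g := by group
        rw [this, h']; simp
      · intro h'; apply hh.2.2; have : h = g⁻¹ * (g * h * g⁻¹) * g := by group
        rw [this, h']; simp
    · rw [← mul_smul]; simp [mul_smul, hz]
  have horbX : ∀ z ∈ X, ∀ x ∈ MulAction.orbit Γ z, x ∈ X := by
    rintro z hz _ ⟨g, rfl⟩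
    exact hXstab g.1 g.2 z hz
  have hΩX : ∀ z ∈ Ω, z ∈ X := by
    apply horbX
    rw [memX]
    refine ⟨eU μ, ?_, ?_⟩
    · rw [memGs]
      refine ⟨hμ, ?_, ?_⟩
      · intro h; apply hμ0; simpa using congrArg (fun g : SL(2, L) => g 0 1) h
      · intro h; apply hμ0; simpa using congrArg (fun g : SL(2, L) => g 0 1) h
    · rw [act_infty]; simp
  have hsig : ∀ x, (((Gs.filter (fun h => h • x = x)).card : ℕ) : ℤ) = ((st Γ x).ncard : ℤ) - 2 := by
    intro x
    have e0 : st Γ x = ((insert 1 (insert (-1) (Gs.filter (fun h => h • x = x))) : Finset _) : Set SL(2, L)) := by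
      ext h
      simp only [st, Set.mem_ofPred_eq, Finset.coe_insert, Finset.coe_filter, Set.mem_insert_iff, memGs]
      constructor
      · rintro ⟨a, b⟩; tauto
      · rintro (rfl | rfl | h)
        · exact ⟨Γ.one_mem, one_smul _ _⟩
        · exact ⟨hneg, by rw [act_neg, one_smul]⟩
        · exact ⟨h.1.1, h.2⟩
    rw [e0, Set.ncard_coe_finset, Finset.card_insert_of_notMem, Finset.card_insert_of_notMem]
    · push_cast; ring
    · simp [memGs]
    · simp [memGs, hpm]
  set Par := Gs.filter (fun h => (h 0 0 + h 1 1) ^ 2 = 4) with hPar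
  have dc1 := Finset.sum_card_bipartiteAbove_eq_sum_card_bipartiteBelow (s := Gs) (t := X) (fun h x => h • x = x)
  have dc2 := Finset.sum_card_bipartiteAbove_eq_sum_card_bipartiteBelow (s := Par) (t := X) (fun h x => h • x = x)
  simp only [Finset.bipartiteAbove, Finset.bipartiteBelow] at dc1 dc2
  have fp : ∀ h ∈ Gs, (X.filter (fun x => h • x = x)).card + (if (h 0 0 + h 1 1) ^ 2 = 4 then 1 else 0) = 2 := by
    intro h hh
    have hh' := (memGs h).1 hh
    split_ifs with ht
    · obtain ⟨x, hx⟩ := fix_par h2 h ht hh'.2.1 hh'.2.2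
      have : X.filter (fun x => h • x = x) = {x} := by
        ext z; simp only [Finset.mem_filter, Finset.mem_singleton, memX, hx]
        constructor
        · exact fun h => h.2
        · rintro rfl; exact ⟨⟨h, hh, (hx _).2 rfl⟩, rfl⟩
      rw [this]; simp
    · obtain ⟨x, y, hxy, hx⟩ := fix_semi h2 h ht
      have : X.filter (fun x => h • x = x) = {x, y} := by
        ext z; simp only [Finset.mem_filter, Finset.mem_insert, Finset.mem_singleton, memX, hx]
        constructor
        · exact fun h => h.2
        · intro hz; exact ⟨⟨h, hh, (hx _).2 hz⟩, hz⟩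
      rw [this, Finset.card_pair hxy]
  have cardPar : Par.card = ∑ h ∈ Gs, (if (h 0 0 + h 1 1) ^ 2 = 4 then 1 else 0) := by
    rw [hPar, Finset.card_filter]
  have E1 : (∑ h ∈ Gs, (X.filter (fun x => h • x = x)).card) + Par.card = 2 * Gs.card := by
    rw [cardPar, ← Finset.sum_add_distrib, Finset.sum_congr rfl fp]; simp [mul_comm]
  have E2 : (∑ h ∈ Par, (X.filter (fun x => h • x = x)).card) = Par.card := by
    rw [Finset.sum_congr rfl (g := fun _ => 1)]
    · simp
    · intro h hh
      rw [hPar, Finset.mem_filter] at hh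
      have := fp h hh.1
      rw [if_pos hh.2] at this; omega
  set OΩ := hΩfin.toFinset with hOΩ
  have memO : ∀ z, z ∈ OΩ ↔ z ∈ Ω := by intro z; simp [hOΩ]
  have OX : OΩ ⊆ X := by intro z hz; exact hΩX z ((memO z).1 hz)
  have cardO : OΩ.card = s * r + 1 := by rw [← cf2, hΩ, orb_card Γ _ OΩ memO]
  have E3 : (∑ x ∈ X, (Par.filter (fun h => h • x = x)).card) = OΩ.card * (2 * (s - 1)) := by
    rw [← Finset.sum_subset OX]
    · rw [Finset.sum_congr rfl (g := fun _ => 2 * (s - 1))]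
      · simp
      · intro x hx
        obtain ⟨g, rfl⟩ := (memO x).1 hx
        rw [hs, ← par_infty h2 Γ hneg, ← par_conj Γ ∞ g.1 g.2, ← Set.ncard_coe_finset]
        congr 1
        ext h
        simp only [hPar, Finset.coe_filter, Finset.mem_filter, memGs, par, Set.mem_ofPred_eq]
        change _ ∧ (h • (g.1 • (∞ : OnePoint L)) = g.1 • (∞ : OnePoint L)) ↔ _
        tauto
    · intro x hx hx2
      rw [Finset.card_eq_zero, Finset.filter_eq_empty_iff]
      intro h hh hfix
      apply hx2
      rw [memO]
      rw [hPar, Finset.mem_filter, memGs] at hh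
      exact hparΩ h hh.1.1 hh.1.2.1 hh.1.2.2 hh.2 x hfix
  have E4 : (∑ x ∈ X, (((st Γ x).ncard : ℤ) - 2)) + OΩ.card * (2 * (s - 1)) = 2 * (Nat.card Γ - 2) := by
    rw [← cardGs, Finset.sum_congr rfl (fun x _ => (hsig x).symm)]
    have e : (∑ x ∈ X, (Gs.filter (fun h => h • x = x)).card) + OΩ.card * (2 * (s - 1)) = 2 * Gs.card := by
      rw [← E3, ← dc2, E2, ← dc1, E1]
    have := congrArg (Nat.cast : ℕ → ℤ) e
    push_cast [Nat.cast_sub (show 1 ≤ s by omega)] at this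
    exact this
  have E5 := orb_sum Γ ∞ OΩ memO
  have E6 := Finset.sum_sdiff (f := fun x => ((st Γ x).ncard : ℤ) - 2) OX
  set Y := X \ OΩ with hY
  have M1 : (Nat.card Γ : ℤ) = (s * r + 1) * (2 * s * k) := by
    have := orbst Γ ∞
    rw [hk, ← hΩ, cf2] at this
    rw [← this]; push_cast; ring
  set M : ℤ := (Nat.card Γ : ℤ) with hM
  have cO : (OΩ.card : ℤ) = s * r + 1 := by rw [cardO]; push_cast; ring
  have E7 : (∑ x ∈ Y, (((st Γ x).ncard : ℤ) - 2)) + 2 * (s * r + 1) * (s - 2) + 4 = M := by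
    rw [cO] at E4 E5
    linear_combination E4 - E5 + E6
  have sz : (3 : ℤ) ≤ s := by exact_mod_cast hs3
  have rz : (1 : ℤ) ≤ r := by exact_mod_cast hr1
  have kz : (1 : ℤ) ≤ k := by exact_mod_cast hk1
  have hYne : Y.Nonempty := by
    by_contra hcon
    rw [Finset.not_nonempty_iff_eq_empty] at hcon
    rw [hcon, Finset.sum_empty, M1] at E7
    have : 0 ≤ (s * r + 1 : ℤ) * s * (k - 1) := by
      apply mul_nonneg (by positivity); linarith
    have h3 : (3 : ℤ) * 1 ≤ s * r := mul_le_mul sz rz (by norm_num) (by positivity)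
    linarith only [this, h3, E7]
  have horbY : ∀ y ∈ Y, ∃ O : Finset (OnePoint L), (∀ x, x ∈ O ↔ x ∈ MulAction.orbit Γ y) ∧ O ⊆ Y ∧ 4 * (O.card : ℤ) ≤ M := by
    intro y hy
    rw [hY, Finset.mem_sdiff] at hy
    have hf : (MulAction.orbit Γ y).Finite := Set.finite_range _
    have hmem : ∀ x, x ∈ hf.toFinset ↔ x ∈ MulAction.orbit Γ y := by intro x; simp
    refine ⟨hf.toFinset, hmem, ?_, ?_⟩
    · intro x hx
      rw [hmem] at hx
      rw [hY, Finset.mem_sdiff]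
      refine ⟨horbX y hy.1 x hx, ?_⟩
      intro hx2
      apply hy.2
      rw [memO] at hx2 ⊢
      have a1 : MulAction.orbit Γ x = MulAction.orbit Γ y := MulAction.orbit_eq_iff.2 hx
      have a2 : MulAction.orbit Γ x = Ω := MulAction.orbit_eq_iff.2 hx2
      rw [← a2, a1]; exact MulAction.mem_orbit_self _
    · have h4 : 4 ≤ (st Γ y).ncard := by
        obtain ⟨h, hh, hfix⟩ := (memX y).1 hy.1
        have hh' := (memGs h).1 hh
        have hne : h ≠ -h := by
          intro he
          have hz : ∀ i j, h i j = 0 := by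
            intro i j
            have := congrArg (fun g : SL(2, L) => g i j) he
            simp only [sln] at this
            have : 2 * h i j = 0 := by linear_combination this
            exact (mul_eq_zero.1 this).resolve_left h2
          have := sldet h
          simp [hz] at this
        have : (({1, -1, h, -h} : Finset SL(2, L)) : Set SL(2, L)) ⊆ st Γ y := by
          intro g hg
          simp only [Finset.coe_insert, Finset.coe_singleton, Set.mem_insert_iff, Set.mem_singleton_iff] at hg
          rcases hg with rfl | rfl | rfl | rfl
          · exact ⟨Γ.one_mem, one_smul _ _⟩
          · exact ⟨hneg, by rw [act_neg, one_smul]⟩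
          · exact ⟨hh'.1, hfix⟩
          · exact ⟨hnegm _ hh'.1, by rw [act_neg, hfix]⟩
        have := Set.ncard_le_ncard this (fin_of_sub (Γ := Γ) (fun x hx => hx.1))
        rw [Set.ncard_coe_finset] at this
        have hc : ({1, -1, h, -h} : Finset SL(2, L)).card = 4 := by
          rw [Finset.card_insert_of_notMem, Finset.card_insert_of_notMem, Finset.card_pair hne]
          · simp only [Finset.mem_insert, Finset.mem_singleton, not_or]
            exact ⟨fun e => hh'.2.2 e.symm, fun e => hh'.2.1 (neg_injective e.symm)⟩
          · simp only [Finset.mem_insert, Finset.mem_singleton, not_or]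
            refine ⟨hpm, fun e => hh'.2.1 e.symm, fun e => hh'.2.2 ?_⟩
            rw [e, neg_neg]
        omega
      rw [hM, ← orbst Γ y, orb_card Γ y _ hmem]
      push_cast
      have : (4 : ℤ) ≤ (st Γ y).ncard := by exact_mod_cast h4
      have hc : (0 : ℤ) ≤ hf.toFinset.card := by positivity
      rw [mul_comm]; exact mul_le_mul_of_nonneg_left this hc
  obtain ⟨y, hy⟩ := hYne
  obtain ⟨O, memOy, hOY, hO4⟩ := horbY y hy
  have nonneg_st : ∀ x, (0 : ℤ) ≤ ((st Γ x).ncard : ℤ) - 2 := by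
    intro x; rw [← hsig]; positivity
  have hpos : 0 < 2 * (s * r + 1 : ℤ) * (s - 2) := by
    exact mul_pos (by positivity) (by linarith only [sz])
  have hYO : Y = O := by
    by_contra hne
    obtain ⟨y', hy', hy'O⟩ : ∃ y' ∈ Y, y' ∉ O := by
      by_contra hcon; push Not at hcon
      exact hne (Finset.Subset.antisymm hcon hOY)
    obtain ⟨O', memOy', hOY', hO4'⟩ := horbY y' hy'
    have hdisj : Disjoint O O' := by
      rw [Finset.disjoint_left]
      intro x hx hx'
      apply hy'O
      rw [memOy] at hx ⊢
      rw [memOy'] at hx'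
      have a1 : MulAction.orbit Γ x = MulAction.orbit Γ y := MulAction.orbit_eq_iff.2 hx
      have a2 : MulAction.orbit Γ x = MulAction.orbit Γ y' := MulAction.orbit_eq_iff.2 hx'
      rw [← a1, a2]; exact MulAction.mem_orbit_self _
    have hsub : O ∪ O' ⊆ Y := Finset.union_subset hOY hOY'
    have := Finset.sum_le_sum_of_subset_of_nonneg hsub (f := fun x => ((st Γ x).ncard : ℤ) - 2) (fun x _ _ => nonneg_st x)
    rw [Finset.sum_union hdisj, orb_sum Γ y O memOy, orb_sum Γ y' O' memOy'] at this
    linarith only [this, hpos, hO4, hO4', E7]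
  have cardOy : (O.card : ℤ) = (1 + s * r) * (s - 2) + 2 := by
    rw [hYO, orb_sum Γ y O memOy] at E7
    linarith only [E7]
  refine ⟨s, r, k, y, hs, hps, hs3, hr1, hk1, hk2, by rw [cf2, add_comm], hk, ?_, h0Ω, ?_⟩
  · have := orbst Γ y
    rw [orb_card Γ y O memOy] at this
    zify [show 2 ≤ s by omega]
    rw [← cardOy]
    have h' : (O.card : ℤ) * (st Γ y).ncard = Nat.card Γ := by exact_mod_cast this
    rw [h', ← hM, M1]; ring
  · intro h hh e1 e2 x hfix
    have hxX : x ∈ X := (memX x).2 ⟨h, (memGs h).2 ⟨hh, e1, e2⟩, hfix⟩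
    by_cases hx : x ∈ OΩ
    · left; exact (memO x).1 hx
    · right
      rw [← memOy, ← hYO, hY, Finset.mem_sdiff]; exact ⟨hxX, hx⟩
end dick2
end part_c

section part_d
open OnePoint
section dick3
variable {L : Type*} [Field L] [DecidableEq L]

/-- the stabiliser as a subgroup -/
def stG (Γ : Subgroup SL(2, L)) (x : OnePoint L) : Subgroup SL(2, L) := Γ ⊓ MulAction.stabilizer SL(2, L) x

theorem stG_card (Γ : Subgroup SL(2, L)) (x : OnePoint L) : (st Γ x).ncard = Nat.card (stG Γ x) := rfl

theorem mem_stG (Γ : Subgroup SL(2, L)) (x : OnePoint L) (h : SL(2, L)) : h ∈ stG Γ x ↔ h ∈ Γ ∧ h • x = x := Iff.rfl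

theorem st_even (h2 : (2 : L) ≠ 0) (Γ : Subgroup SL(2, L)) (hneg : -1 ∈ Γ) (x : OnePoint L) :
    2 ∣ (st Γ x).ncard := by
  rw [stG_card]
  have hm : -1 ∈ stG Γ x := (mem_stG _ _ _).2 ⟨hneg, by rw [act_neg, one_smul]⟩
  have : orderOf (⟨-1, hm⟩ : stG Γ x) = 2 := by
    apply orderOf_eq_prime
    · ext1; simp
    · intro h
      exact one_ne_neg_one' h2 (congrArg Subtype.val h).symm
  have h4 := orderOf_dvd_natCard (⟨-1, hm⟩ : stG Γ x)
  rwa [this] at h4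

theorem st_pow (Γ : Subgroup SL(2, L)) (x : OnePoint L) (h : SL(2, L)) (hh : h ∈ Γ)
    (hx : h • x = x) : h ^ (st Γ x).ncard = 1 := by
  rw [stG_card]
  have := pow_card_eq_one' (x := (⟨h, hh, hx⟩ : stG Γ x))
  exact congrArg Subtype.val this

theorem arith (s r k σ : ℕ) (hs : 3 ≤ s) (hr : 1 ≤ r) (hk : 1 ≤ k) (hks : k ≤ s - 1) (hσ : 2 ∣ σ)
    (h : ((1 + s * r) * (s - 2) + 2) * σ = (1 + s * r) * (2 * s * k)) :
    r = 1 ∨ (s = 3 ∧ r = 3 ∧ k = 2 ∧ σ = 10) := by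
  obtain ⟨σ, rfl⟩ := hσ
  obtain ⟨t, rfl⟩ : ∃ t, s = t + 2 := ⟨s - 2, by omega⟩
  simp only [Nat.add_sub_cancel] at h
  have h' : (1 + r * t) * σ = (1 + (t + 2) * r) * k := by
    have : 2 * (t + 2) * ((1 + r * t) * σ) = 2 * (t + 2) * ((1 + (t + 2) * r) * k) := by linarith
    exact Nat.eq_of_mul_eq_mul_left (by positivity) this
  have hd : (1 + r * t) ∣ 2 * k := by
    have h1 : (1 + r * t) ∣ r * (2 * k) := by
      have : (1 + r * t) ∣ (1 + r * t) * k + r * (2 * k) := by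
        rw [show (1 + r * t) * k + r * (2 * k) = (1 + (t + 2) * r) * k by ring, ← h']
        exact dvd_mul_right _ _
      exact (Nat.dvd_add_right (dvd_mul_right _ _)).1 this
    refine Nat.Coprime.dvd_of_dvd_mul_left ?_ h1
    simp
  obtain ⟨j, hj⟩ := hd
  have hj1 : 1 ≤ j := by
    rcases Nat.eq_zero_or_pos j with h0 | h0
    · rw [h0] at hj; omega
    · exact h0
  have hks' : k ≤ t + 1 := by omega
  have ht : 1 ≤ t := by omega
  have hb : 1 + r * t ≤ 2 * k := by rw [hj]; exact Nat.le_mul_of_pos_right _ hj1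
  have hr3 : r ≤ 3 := by
    by_contra hc
    have : 4 * t ≤ r * t := Nat.mul_le_mul_right _ (by omega)
    omega
  interval_cases r
  · left; rfl
  · exfalso
    rcases Nat.lt_or_ge j 2 with hj2 | hj2
    · have : j = 1 := by omega
      rw [this] at hj; omega
    · have : (1 + 2 * t) * 2 ≤ (1 + 2 * t) * j := Nat.mul_le_mul_left _ hj2
      omega
  · right
    have : t = 1 := by omega
    subst this
    have : k = 2 := by omega
    subst this
    refine ⟨rfl, rfl, rfl, ?_⟩
    omega

theorem eig_pow (h : SL(2, L)) (α : L) (hα : α ^ 2 - (h 0 0 + h 1 1) * α + 1 = 0) (n : ℕ) :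
    (h ^ n) 0 0 * (α - h 1 1) + (h ^ n) 0 1 * h 1 0 = α ^ n * (α - h 1 1) ∧
    (h ^ n) 1 0 * (α - h 1 1) + (h ^ n) 1 1 * h 1 0 = α ^ n * h 1 0 := by
  have hd := sldet h
  induction n with
  | zero => simp
  | succ n ih =>
    obtain ⟨i1, i2⟩ := ih
    rw [pow_succ']
    simp only [slm00, slm01, slm10, slm11]
    constructor
    · rw [pow_succ]
      linear_combination h 0 0 * i1 + h 0 1 * i2 - α ^ n * hα + α ^ n * (-hd)
    · rw [pow_succ]
      linear_combination h 1 0 * i1 + h 1 1 * i2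

theorem eig_one (h : SL(2, L)) (hc : h 1 0 ≠ 0) (α : L) (hα : α ^ 2 - (h 0 0 + h 1 1) * α + 1 = 0) (n : ℕ)
    (hn : h ^ n = 1) : α ^ n = 1 := by
  have := (eig_pow h α hα n).2
  rw [hn] at this
  simp only [slo10, slo11, zero_mul, one_mul, zero_add] at this
  exact mul_right_cancel₀ hc (by rw [← this, one_mul])

theorem exc_trace [IsAlgClosed L] (h3 : (3 : L) = 0) (h : SL(2, L)) (hc : h 1 0 ≠ 0)
    (hn : h ^ 12 = 1 ∨ h ^ 10 = 1) (τ : L) (hτ : τ = h 0 0 + h 1 1) :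
    τ ^ 3 = τ ∨ τ ^ 2 + τ - 1 = 0 ∨ τ ^ 2 - τ - 1 = 0 := by
  obtain ⟨r, hr⟩ := IsAlgClosed.exists_eq_mul_self (τ ^ 2 - 4)
  have hα : (-(τ + r)) ^ 2 - τ * (-(τ + r)) + 1 = 0 := by
    linear_combination (τ ^ 2 + τ * r - 1) * h3 - hr
  generalize -(τ + r) = α at hα
  have hα0 : α ≠ 0 := by rintro rfl; simp at hα
  rcases hn with hn | hn
  · have e := eig_one h hc α (by rw [← hτ]; exact hα) 12 hn
    have e2 : (α ^ 4 - 1) ^ 3 = 0 := by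
      linear_combination e + (-α ^ 8 + α ^ 4) * h3
    have e3 : (α - 1) * (α + 1) * (α ^ 2 + 1) = 0 := by
      have := pow_eq_zero_iff (three_ne_zero) |>.1 e2
      linear_combination this
    left
    rcases mul_eq_zero.1 e3 with e3 | e3
    · rcases mul_eq_zero.1 e3 with e3 | e3
      · have : α = 1 := by linear_combination e3
        subst this
        have : τ = 2 := by linear_combination -hα
        rw [this]; linear_combination 2 * h3
      · have : α = -1 := by linear_combination e3
        subst this
        have : τ = -2 := by linear_combination hα
        rw [this]; linear_combination -2 * h3
    · have : τ * α = 0 := by linear_combination e3 - hα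
      rw [(mul_eq_zero.1 this).resolve_right hα0]; simp
  · have e := eig_one h hc α (by rw [← hτ]; exact hα) 10 hn
    have e3 : (α ^ 5 - 1) * (α ^ 5 + 1) = 0 := by linear_combination e
    have key : ∀ ε : L, ε ^ 2 = 1 → α ^ 5 - ε = 0 → τ = 2 * ε ∨ τ ^ 2 + ε * τ - 1 = 0 := by
      intro ε hε h5
      have : (α - ε) * (α ^ 4 + ε * α ^ 3 + α ^ 2 + ε * α + 1) = 0 := by
        linear_combination h5 - (α ^ 3 + α) * hε
      rcases mul_eq_zero.1 this with e4 | e4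
      · left
        have : α = ε := by linear_combination e4
        subst this
        linear_combination -α * hα + (α - τ) * hε
      · right
        have : α ^ 2 * (τ ^ 2 + ε * τ - 1) = 0 := by
          linear_combination e4 - (α ^ 2 + 1 + τ * α + ε * α) * hα
        exact (mul_eq_zero.1 this).resolve_left (pow_ne_zero _ hα0)
    rcases mul_eq_zero.1 e3 with e3 | e3
    · rcases key 1 (by ring) e3 with e4 | e4
      · left; rw [e4]; linear_combination 2 * h3
      · right; left; linear_combination e4
    · rcases key (-1) (by ring) (by linear_combination e3) with e4 | e4
      · left; rw [e4]; linear_combination -2 * h3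
      · right; right; linear_combination e4

set_option maxHeartbeats 1000000 in
theorem dickson [IsAlgClosed L] (p : ℕ) [Fact p.Prime] [CharP L p] (h2 : (2 : L) ≠ 0)
    (Γ : Subgroup SL(2, L)) [Finite Γ] (hneg : -1 ∈ Γ) (μ : L) (hμ0 : μ ≠ 0)
    (hμ : eU μ ∈ Γ) (hL : eL 1 ∈ Γ) (hex : ¬ ((3 : L) = 0 ∧ μ ^ 2 = -1)) :
    1 ∈ PU Γ ∧ ∀ x ∈ PU Γ, ∀ y ∈ PU Γ, x * y ∈ PU Γ := by
  obtain ⟨s, r, k, y, hs, hps, hs3, hr, hk1, hk2, hω, hst, heq, h0, hfix⟩ := counting p h2 Γ hneg μ hμ0 hμ hL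
  have hpp : p.Prime := Fact.out
  rcases arith s r k _ hs3 hr hk1 hk2 (st_even h2 Γ hneg y) heq with hr1 | ⟨rfl, rfl, rfl, hσ⟩
  · set Ω := MulAction.orbit Γ (∞ : OnePoint L) with hΩ
    have hΩfin : Ω.Finite := Set.finite_range _
    have hstab : ∀ h ∈ Γ, ∀ x ∈ Ω, h • x ∈ Ω := by
      intro h hh x hx
      exact MulAction.mem_orbit_of_mem_orbit (⟨h, hh⟩ : Γ) hx
    have hinf : ∞ ∈ Ω := MulAction.mem_orbit_self _
    obtain ⟨cf1, -, cf2⟩ := coe_ncard Ω hΩfin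
    have cf2 := cf2 hinf
    have hB : (PU Γ : Set L) = {k : L | (k : OnePoint L) ∈ Ω} := by
      apply Set.eq_of_subset_of_ncard_le _ _ cf1
      · intro x hx
        have := hstab _ (mem_PU.1 hx) _ h0
        rw [act_coe] at this
        simpa using this
      · have : (PU Γ : Set L).ncard = s := by rw [hs]; rfl
        rw [this]; rw [hω, hr1] at cf2; omega
    have memB : ∀ x : L, x ∈ PU Γ ↔ (x : OnePoint L) ∈ Ω := by
      intro x
      have : x ∈ (PU Γ : Set L) ↔ x ∈ {k : L | (k : OnePoint L) ∈ Ω} := by rw [hB]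
      exact this
    have one : (1 : L) ∈ PU Γ := by
      rw [memB]
      have := hstab _ hL _ hinf
      rw [act_infty] at this
      simpa using this
    have hinv : ∀ x ∈ PU Γ, x⁻¹ ∈ PU Γ := by
      intro x hx
      by_cases hx0 : x = 0
      · rw [hx0, _root_.inv_zero]; exact (PU Γ).zero_mem
      · have h1 : x - 1 ∈ PU Γ := (PU Γ).sub_mem hx one
        rw [memB] at h1
        have := hstab _ hL _ h1
        rw [act_coe] at this
        simp [hx0] at this
        rw [← memB] at this
        have h4 := (PU Γ).sub_mem one this
        have e : 1 - (x - 1) / x = x⁻¹ := by field_simp; ring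
        rwa [e] at h4
    have hsq : ∀ x ∈ PU Γ, x ^ 2 ∈ PU Γ := by
      intro x hx
      by_cases hx0 : x = 0
      · rw [hx0]; simp [(PU Γ).zero_mem]
      by_cases hx1 : x + 1 = 0
      · have : x = -1 := by linear_combination hx1
        rw [this]; simpa using one
      have h4 := hinv _ ((PU Γ).sub_mem (hinv x hx) (hinv _ ((PU Γ).add_mem hx one)))
      have e : (x⁻¹ - (x + 1)⁻¹)⁻¹ = x ^ 2 + x := by
        have : x⁻¹ - (x + 1)⁻¹ = (x ^ 2 + x)⁻¹ := by
          have : x ^ 2 + x ≠ 0 := by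
            rw [show x ^ 2 + x = x * (x + 1) by ring]; exact mul_ne_zero hx0 hx1
          field_simp; ring
        rw [this, inv_inv]
      rw [e] at h4
      have := (PU Γ).sub_mem h4 hx
      simpa using this
    refine ⟨one, ?_⟩
    intro x hx y hy
    have h4 : 2 * (x * y) ∈ PU Γ := by
      have := (PU Γ).sub_mem ((PU Γ).sub_mem (hsq _ ((PU Γ).add_mem hx hy)) (hsq x hx)) (hsq y hy)
      convert this using 1; ring
    have hodd : p % 2 = 1 := by
      rcases hpp.eq_two_or_odd with h | h
      · exfalso; apply h2; have := CharP.cast_eq_zero L p; rw [h] at this; exact_mod_cast this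
      · exact h
    have h5 := (PU Γ).nsmul_mem h4 ((p + 1) / 2)
    have e : ((p + 1) / 2) • (2 * (x * y)) = x * y := by
      rw [nsmul_eq_mul, ← mul_assoc]
      have : (((p + 1) / 2 : ℕ) : L) * 2 = 1 := by
        have h6 : ((p + 1) / 2) * 2 = p + 1 := by omega
        have := congrArg (Nat.cast : ℕ → L) h6
        push_cast at this
        rw [CharP.cast_eq_zero L p] at this
        rw [this]; ring
      rw [this, one_mul]
    rwa [e] at h5
  · have hp3 : p = 3 := (Nat.prime_dvd_prime_iff_eq hpp Nat.prime_three).1 hps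
    subst hp3
    have h3 : (3 : L) = 0 := by exact_mod_cast CharP.cast_eq_zero L 3
    have hpow : ∀ ν : L, eU ν ∈ Γ → (2 + ν) ^ 3 = 2 + ν ∨ (2 + ν) ^ 2 + (2 + ν) - 1 = 0 ∨ (2 + ν) ^ 2 - (2 + ν) - 1 = 0 := by
      intro ν hν
      set h := eL 1 * eU ν with hh
      have hhΓ : h ∈ Γ := Γ.mul_mem hL hν
      have hc : h 1 0 ≠ 0 := by simp [hh]
      have hne : h ≠ 1 := by intro e; rw [e] at hc; simp at hc
      have hne' : h ≠ -1 := by intro e; rw [e] at hc; simp at hc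
      obtain ⟨x, hx⟩ : ∃ x : OnePoint L, h • x = x := by
        by_cases ht : (h 0 0 + h 1 1) ^ 2 = 4
        · obtain ⟨x, hx⟩ := fix_par h2 h ht hne hne'
          exact ⟨x, (hx x).2 rfl⟩
        · obtain ⟨x, y, -, hx⟩ := fix_semi h2 h ht
          exact ⟨x, (hx x).2 (Or.inl rfl)⟩
      apply exc_trace h3 h hc _ _ (by simp [hh]; ring)
      have hp := st_pow Γ x h hhΓ hx
      rcases hfix h hhΓ hne hne' x hx with hx1 | hx1
      · left; rw [orb_st_const Γ _ _ hx1, hst] at hp; exact hp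
      · right; rw [orb_st_const Γ _ _ hx1, hσ] at hp; exact hp
    have hμ1 : μ = 1 ∨ μ = -1 := by
      have hcase : μ ^ 3 = μ → μ = 1 ∨ μ = -1 := by
        intro e
        have : μ * ((μ - 1) * (μ + 1)) = 0 := by linear_combination e
        rcases mul_eq_zero.1 ((mul_eq_zero.1 this).resolve_left hμ0) with e | e
        · left; linear_combination e
        · right; linear_combination e
      have hm : eU (-μ) ∈ Γ := (PU Γ).neg_mem hμ
      have hnot : μ ^ 2 ≠ -1 := fun h => hex ⟨h3, h⟩
      rcases hpow μ hμ with e | e | e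
      · apply hcase; linear_combination e - (2 * μ ^ 2 + 4 * μ + 2) * h3
      · rcases hpow (-μ) hm with e' | e' | e'
        · apply hcase; linear_combination -e' + (2 + 2 * μ ^ 2 - 4 * μ) * h3
        · exfalso
          have : 2 * (5 * μ) = 0 := by linear_combination e - e'
          have : 2 * μ = 0 := by linear_combination -this + 4 * μ * h3
          exact hμ0 ((mul_eq_zero.1 this).resolve_left h2)
        · exfalso; apply hnot
          linear_combination e' + μ * h3
      · exfalso; apply hnot; linear_combination e - μ * h3
    have hz : (PU Γ : Set L) = (AddSubgroup.zmultiples (1 : L) : Set L) := by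
      symm
      apply Set.eq_of_subset_of_ncard_le _ _ (PU_finite Γ)
      · have : AddSubgroup.zmultiples (1 : L) ≤ PU Γ := by
          rw [AddSubgroup.zmultiples_le]
          rcases hμ1 with e | e
          · rw [e] at hμ; exact hμ
          · rw [e] at hμ; have := (PU Γ).neg_mem hμ; simpa using this
        exact this
      · have e1 : (PU Γ : Set L).ncard = 3 := by rw [hs]; rfl
        have e2 : (AddSubgroup.zmultiples (1 : L) : Set L).ncard = 3 := card_zmult 3 1 one_ne_zero
        change (PU Γ : Set L).ncard ≤ _
        rw [e1, e2]
    have hz' : PU Γ = AddSubgroup.zmultiples (1 : L) := SetLike.coe_injective hz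
    rw [hz']
    refine ⟨AddSubgroup.mem_zmultiples _, ?_⟩
    rintro _ ⟨a, rfl⟩ _ ⟨b, rfl⟩
    exact ⟨a * b, by simp⟩
end dick3
end part_d

section part_e
universe u

theorem map_eU {R S : Type*} [CommRing R] [CommRing S] (f : R →+* S) (x : R) :
    SpecialLinearGroup.map f (eU x) = eU (f x) := by apply sl2_ext <;> simp
theorem map_eL {R S : Type*} [CommRing R] [CommRing S] (f : R →+* S) (x : R) :
    SpecialLinearGroup.map f (eL x) = eL (f x) := by apply sl2_ext <;> simp
theorem map_neg1 {R S : Type*} [CommRing R] [CommRing S] (f : R →+* S) :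
    SpecialLinearGroup.map f (-1 : SL(2, R)) = -1 := by apply sl2_ext <;> simp

theorem subring_top_of_adjoin {A : Type*} [CommRing A] (μ : A) (hgen : Algebra.adjoin ℤ {μ} = ⊤)
    (S : Subring A) (h : μ ∈ S) (x : A) : x ∈ S := by
  have : Algebra.adjoin ℤ {μ} ≤ subalgebraOfSubring S := by
    apply Algebra.adjoin_le
    simpa using h
  rw [hgen] at this
  exact this (Algebra.mem_top (x := x))

/-- weyl element -/
def wE {R : Type*} [CommRing R] : SL(2, R) := eU 1 * eL (-1) * eU 1

section wsec
variable {R : Type*} [CommRing R]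
@[simp] theorem wE00 : (wE : SL(2, R)) 0 0 = 0 := by simp [wE]
@[simp] theorem wE01 : (wE : SL(2, R)) 0 1 = 1 := by simp [wE]
@[simp] theorem wE10 : (wE : SL(2, R)) 1 0 = -1 := by simp [wE]
@[simp] theorem wE11 : (wE : SL(2, R)) 1 1 = 0 := by simp [wE]
theorem w_conj_U (x : R) : wE * eU x * wE⁻¹ = eL (-x) := by apply sl2_ext <;> simp
theorem w_conj_L (x : R) : wE * eL x * wE⁻¹ = eU (-x) := by apply sl2_ext <;> simp
end wsec

theorem field_case {k : Type*} [Field k] [Finite k] (h2 : (2 : k) ≠ 0) (μ : k) (hμ0 : μ ≠ 0)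
    (hgen : Algebra.adjoin ℤ {μ} = ⊤) (hex : ¬ ((3 : k) = 0 ∧ μ ^ 2 = -1))
    (H : Subgroup SL(2, k)) (hneg : -1 ∈ H) (hμ : eU μ ∈ H) (hL : eL 1 ∈ H) : H = ⊤ := by
  classical
  obtain ⟨p, hp⟩ := CharP.exists k
  have hpp : Fact p.Prime := ⟨CharP.char_is_prime k p⟩
  set L := AlgebraicClosure k
  set f : k →+* L := algebraMap k L with hf
  have finj : Function.Injective f := f.injective
  have : CharP L p := charP_of_injective_ringHom finj p
  set Γ := H.map (SpecialLinearGroup.map (n := Fin 2) f) with hΓ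
  have hfin : Finite SL(2, k) := inferInstance
  have : Finite Γ := by
    have : (Γ : Set SL(2, L)).Finite := by
      rw [hΓ, Subgroup.coe_map]; exact (Set.toFinite _).image _
    exact this.to_subtype
  have mapinj : Function.Injective (SpecialLinearGroup.map (n := Fin 2) f) := by
    intro a b hab
    apply sl2_ext <;> apply finj
    · exact congrArg (fun g : SL(2, L) => g 0 0) hab
    · exact congrArg (fun g : SL(2, L) => g 0 1) hab
    · exact congrArg (fun g : SL(2, L) => g 1 0) hab
    · exact congrArg (fun g : SL(2, L) => g 1 1) hab
  have memP : ∀ x, f x ∈ PU Γ ↔ x ∈ PU H := by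
    intro x
    rw [mem_PU, mem_PU, ← map_eU, hΓ, Subgroup.mem_map]
    constructor
    · rintro ⟨g, hg, e⟩; rw [← mapinj e]; exact hg
    · intro h; exact ⟨_, h, rfl⟩
  obtain ⟨d1, d2⟩ := dickson p (by rw [← map_ofNat f 2]; exact fun h => h2 (finj (by rw [h, map_zero])))
    Γ ⟨-1, hneg, map_neg1 f⟩ (f μ) (fun h => hμ0 (finj (by rw [h, map_zero])))
    ((memP μ).2 hμ) ⟨eL 1, hL, by rw [map_eL, map_one]⟩ (by
      rintro ⟨e1, e2⟩
      apply hex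
      refine ⟨finj (by rw [map_ofNat, e1, map_zero]), finj (by rw [map_pow, e2, map_neg, map_one])⟩)
  let S : Subring k :=
    { carrier := {x | x ∈ PU H}
      zero_mem' := (PU H).zero_mem
      add_mem' := fun a b => (PU H).add_mem a b
      neg_mem' := fun a => (PU H).neg_mem a
      one_mem' := by rw [Set.mem_ofPred_eq, ← memP, map_one]; exact d1
      mul_mem' := by
        intro a b ha hb
        rw [Set.mem_ofPred_eq, ← memP] at *
        rw [map_mul]; exact d2 _ ha _ hb }
  have hPU : ∀ x, eU x ∈ H := fun x => subring_top_of_adjoin μ hgen S hμ x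
  have hw : wE ∈ H := H.mul_mem (H.mul_mem (hPU 1) (by rw [eL_neg]; exact H.inv_mem hL)) (hPU 1)
  have hPL : ∀ x, eL x ∈ H := by
    intro x
    have := H.mul_mem (H.mul_mem hw (hPU (-x))) (H.inv_mem hw)
    rwa [w_conj_U, neg_neg] at this
  have key : ∀ g : SL(2, k), g 1 0 ≠ 0 → g ∈ H := by
    intro g hg
    have hd := sldet g
    have : g = eU ((g 0 0 - 1) / g 1 0) * eL (g 1 0) * eU ((g 1 1 - 1) / g 1 0) := by
      apply sl2_ext <;> simp
      · field_simp; ring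
      · field_simp; linear_combination -hd
      · field_simp; ring
    rw [this]
    exact H.mul_mem (H.mul_mem (hPU _) (hPL _)) (hPU _)
  rw [eq_top_iff]
  intro g _
  by_cases hg : g 1 0 = 0
  · have h1 : eL 1 * g ∈ H := by
      apply key
      simp [hg]
      intro h0
      have hd := sldet g
      rw [h0, hg] at hd; simp at hd
    have := H.mul_mem (H.inv_mem hL) h1
    simpa using this
  · exact key g hg

/-- squares of units generate the ring -/
def SqGen (A : Type*) [CommRing A] : Prop := ∀ S : Subring A, (∀ u : A, IsUnit u → u ^ 2 ∈ S) → ∀ x, x ∈ S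

theorem SqGen.quot {A B : Type*} [CommRing A] [CommRing B] (f : A →+* B) (hf : Function.Surjective f)
    (h : SqGen A) : SqGen B := by
  intro S hS x
  obtain ⟨a, rfl⟩ := hf x
  have := h (S.comap f) (fun u hu => by
    rw [Subring.mem_comap, map_pow]; exact hS _ (hu.map f)) a
  exact this

theorem sq_aux {A : Type*} [CommRing A] (h2 : IsUnit (2 : A)) (S : Subring A)
    (hS : ∀ u : A, IsUnit u → u ^ 2 ∈ S) (x : A) (hx : IsUnit x) (hx1 : IsUnit (x + 1)) : x ∈ S := by
  obtain ⟨v, hv⟩ := h2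
  have h3 := hS _ (v⁻¹).isUnit
  have e : x = ((x + 1) ^ 2 - x ^ 2 - 1) * (1 + 1) * ((v⁻¹ : Aˣ) : A) ^ 2 := by
    have : (v : A) * ((v⁻¹ : Aˣ) : A) = 1 := v.mul_inv
    rw [hv] at this
    linear_combination (-x) * (2 * ((v⁻¹ : Aˣ) : A) + 1) * this
  rw [e]
  exact S.mul_mem (S.mul_mem (S.sub_mem (S.sub_mem (hS _ hx1) (hS _ hx)) S.one_mem) (S.add_mem S.one_mem S.one_mem)) h3

/-- residue condition -/
def Good (A : Type u) [CommRing A] : Prop :=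
  (∀ (k : Type u) [Field k] (φ : A →+* k), Function.Surjective φ → Nat.card k ≠ 3) ∨ IsLocalRing A

theorem five_le (k : Type*) [Field k] [Finite k] (h2 : (2 : k) ≠ 0) (h3 : Nat.card k ≠ 3) : 5 ≤ Nat.card k := by
  classical
  have := Fintype.ofFinite k
  rw [Nat.card_eq_fintype_card] at *
  have hodd : Fintype.card k % 2 = 1 := FiniteField.odd_card_of_char_ne_two (by
    intro hc
    apply h2
    have := CharP.cast_eq_zero k (ringChar k)
    rw [hc] at this; exact_mod_cast this)
  have := Fintype.one_lt_card (α := k)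
  omega

theorem sqGen_of_good {A : Type u} [CommRing A] [Finite A] (h2 : IsUnit (2 : A)) (hg : Good A) : SqGen A := by
  classical
  intro S hS y
  rcases hg with hg | hg
  · obtain ⟨x, hx⟩ : ∃ x : A, ∀ m : MaximalSpectrum A, x ∉ m.asIdeal ∧ x + 1 ∉ m.asIdeal ∧ x - y ∉ m.asIdeal ∧ x - y + 1 ∉ m.asIdeal := by
      have ex : ∀ m : MaximalSpectrum A, ∃ z : A ⧸ m.asIdeal,
          z ∉ ({0, -1, Ideal.Quotient.mk m.asIdeal y, Ideal.Quotient.mk m.asIdeal y - 1} : Finset (A ⧸ m.asIdeal)) := by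
        intro m
        have := m.isMaximal
        have : Finite (A ⧸ m.asIdeal) := Finite.of_surjective _ Ideal.Quotient.mk_surjective
        let _ := Ideal.Quotient.field m.asIdeal
        have h5 := five_le (A ⧸ m.asIdeal) (by
          have := (h2.map (Ideal.Quotient.mk m.asIdeal)).ne_zero
          rwa [map_ofNat] at this) (hg (A ⧸ m.asIdeal) (Ideal.Quotient.mk _) Ideal.Quotient.mk_surjective)
        have := Fintype.ofFinite (A ⧸ m.asIdeal)
        rw [Nat.card_eq_fintype_card] at h5
        by_contra hcon
        push Not at hcon
        have hle : (Finset.univ : Finset (A ⧸ m.asIdeal)).card ≤ 4 := by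
          refine le_trans (Finset.card_le_card (fun z _ => hcon z)) ?_
          exact Finset.card_le_four
        rw [Finset.card_univ] at hle
        omega
      choose z hz using ex
      have hfin : Finite (MaximalSpectrum A) := by
        have : Finite (Ideal A) := Finite.of_injective (fun I : Ideal A => (I : Set A)) SetLike.coe_injective
        exact Finite.of_injective MaximalSpectrum.asIdeal (fun a b h => MaximalSpectrum.ext h)
      obtain ⟨x, hx⟩ := Ideal.pi_quotient_surjective (I := fun m : MaximalSpectrum A => m.asIdeal)
        (fun a b ne => by
          have := a.isMaximal
          have := b.isMaximal
          exact Ideal.isCoprime_of_isMaximal (MaximalSpectrum.ext_iff.ne.mp ne)) z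
      refine ⟨x, fun m => ?_⟩
      have h1 := hz m
      rw [← hx m] at h1
      simp only [Finset.mem_insert, Finset.mem_singleton, not_or] at h1
      obtain ⟨a1, a2, a3, a4⟩ := h1
      simp only [← Ideal.Quotient.eq_zero_iff_mem]
      refine ⟨a1, fun h => a2 ?_, fun h => a3 ?_, fun h => a4 ?_⟩
      · rw [map_add, map_one] at h; linear_combination h
      · rw [map_sub] at h; linear_combination h
      · rw [map_add, map_sub, map_one] at h; linear_combination h
    have hu : ∀ z : A, (∀ m : MaximalSpectrum A, z ∉ m.asIdeal) → IsUnit z := by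
      intro z hz
      by_contra hc
      obtain ⟨m, hm, hzm⟩ := exists_max_ideal_of_mem_nonunits hc
      exact hz ⟨m, hm⟩ hzm
    have e1 := sq_aux h2 S hS x (hu _ fun m => (hx m).1) (hu _ fun m => (hx m).2.1)
    have e2 := sq_aux h2 S hS (x - y) (hu _ fun m => (hx m).2.2.1) (hu _ fun m => (hx m).2.2.2)
    have := S.sub_mem e1 e2
    simpa using this
  · have hnon : ∀ x : A, ¬ IsUnit x → x ∈ S := by
      intro x hx
      have h1 : IsUnit (x + 1) := by
        have := IsLocalRing.isUnit_or_isUnit_of_isUnit_add (a := x + 1) (b := -x) (by simp)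
        rcases this with h | h
        · exact h
        · exact absurd ((IsUnit.neg_iff x).1 h) hx
      have h3 : IsUnit (x + 1 + 1) := by
        have := IsLocalRing.isUnit_or_isUnit_of_isUnit_add (a := x + 1 + 1) (b := -x) (by
          convert h2 using 1; ring)
        rcases this with h | h
        · exact h
        · exact absurd ((IsUnit.neg_iff x).1 h) hx
      have := S.sub_mem (sq_aux h2 S hS (x + 1) h1 h3) S.one_mem
      simpa using this
    by_cases hy : IsUnit y
    · by_cases hy1 : IsUnit (y + 1)
      · exact sq_aux h2 S hS y hy hy1
      · have := S.sub_mem (hnon _ hy1) S.one_mem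
        simpa using this
    · exact hnon y hy

theorem normal_SL2 {k : Type*} [Field k] [Finite k] (h5 : 5 ≤ Nat.card k) (N : Subgroup SL(2, k)) [N.Normal] :
    N = ⊤ ∨ N ≤ Subgroup.center SL(2, k) := by
  have hs := Matrix.ProjectiveSpecialLinearGroup.rank_two_simple (F := k) (by omega)
  set π : SL(2, k) →* Matrix.ProjectiveSpecialLinearGroup (Fin 2) k := QuotientGroup.mk' _ with hπ
  have hsurj : Function.Surjective π := QuotientGroup.mk'_surjective _
  have hker : π.ker = Subgroup.center SL(2, k) := QuotientGroup.ker_mk' _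
  have hn : (N.map π).Normal := Subgroup.Normal.map ‹_› π hsurj
  rcases hs.eq_bot_or_eq_top_of_normal _ hn with h | h
  · right
    rw [← hker]
    exact (Subgroup.map_eq_bot_iff _).1 h
  · left
    obtain ⟨a, ha⟩ : ∃ a : k, a ≠ 0 ∧ a ^ 2 ≠ 1 := by
      classical
      by_contra hc
      push Not at hc
      have := Fintype.ofFinite k
      rw [Nat.card_eq_fintype_card, ← Finset.card_univ] at h5
      have : (Finset.univ : Finset k) ⊆ {0, 1, -1} := by
        intro a _
        by_cases h0 : a = 0
        · simp [h0]
        · have h1 : (a - 1) * (a + 1) = 0 := by linear_combination hc a h0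
          rcases mul_eq_zero.1 h1 with h1 | h1
          · simp [sub_eq_zero.1 h1]
          · simp [eq_neg_of_add_eq_zero_left h1]
      have := (Finset.card_le_card this).trans Finset.card_le_three
      omega
    have hc := Matrix.SL2.commutator_eq_top ha.1 ha.2
    rw [eq_top_iff, ← hc, commutator_def, Subgroup.commutator_le]
    intro g _ h' _
    obtain ⟨n, hn, e⟩ : π g ∈ N.map π := by rw [h]; trivial
    have hz : n⁻¹ * g ∈ Subgroup.center SL(2, k) := by
      rw [← hker, MonoidHom.mem_ker, map_mul, map_inv, e]; simp
    rw [commutatorElement_def]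
    have : g * h' * g⁻¹ * h'⁻¹ = n * (h' * n⁻¹ * h'⁻¹) := by
      have hcomm := Subgroup.mem_center_iff.1 hz h'
      have e1 : g = n * (n⁻¹ * g) := by group
      have e2 : g * h' = n * h' * (n⁻¹ * g) := by rw [mul_assoc n h', hcomm]; group
      rw [e2]; group
    rw [this]
    exact N.mul_mem hn (Subgroup.Normal.conj_mem ‹_› _ (N.inv_mem hn) _)
end part_e

section part_f
section ringstep
variable {A : Type*} [CommRing A]

/-- reduction mod an ideal -/
abbrev red (J : Ideal A) : SL(2, A) →* SL(2, A ⧸ J) := SpecialLinearGroup.map (Ideal.Quotient.mk J)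

theorem red_eq_iff (J : Ideal A) (g h : SL(2, A)) : red J g = red J h ↔
    g 0 0 - h 0 0 ∈ J ∧ g 0 1 - h 0 1 ∈ J ∧ g 1 0 - h 1 0 ∈ J ∧ g 1 1 - h 1 1 ∈ J := by
  simp only [← Ideal.Quotient.eq]
  constructor
  · intro e
    exact ⟨congrArg (fun g : SL(2, A ⧸ J) => g 0 0) e, congrArg (fun g : SL(2, A ⧸ J) => g 0 1) e,
      congrArg (fun g : SL(2, A ⧸ J) => g 1 0) e, congrArg (fun g : SL(2, A ⧸ J) => g 1 1) e⟩
  · rintro ⟨h1, h2, h3, h4⟩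
    apply sl2_ext <;> assumption

theorem red_one_iff (J : Ideal A) (g : SL(2, A)) : red J g = 1 ↔
    g 0 0 - 1 ∈ J ∧ g 0 1 ∈ J ∧ g 1 0 ∈ J ∧ g 1 1 - 1 ∈ J := by
  rw [← map_one (red J), red_eq_iff]; simp

theorem conj_mem (H : Subgroup SL(2, A)) (I m : Ideal A) (hmI : ∀ a ∈ m, ∀ b ∈ I, a * b = 0)
    (hm : ∀ g, ∃ h ∈ H, red m h = red m g) (n : SL(2, A)) (hn : n ∈ H) (hn1 : red I n = 1) (g : SL(2, A)) :
    g * n * g⁻¹ ∈ H := by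
  obtain ⟨h, hh, e⟩ := hm g
  have hx : red m (g⁻¹ * h) = 1 := by rw [map_mul, map_inv, e]; simp
  set x := g⁻¹ * h with hxd
  rw [red_one_iff] at hx hn1
  obtain ⟨x1, x2, x3, x4⟩ := hx
  obtain ⟨n1, n2, n3, n4⟩ := hn1
  have hc : x * n = n * x := by
    apply sl2_ext <;> simp only [slm00, slm01, slm10, slm11]
    · linear_combination hmI _ x2 _ n3 - hmI _ x3 _ n2
    · linear_combination hmI _ x1 _ n2 - hmI _ x4 _ n2 + hmI _ x2 _ n4 - hmI _ x2 _ n1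
    · linear_combination hmI _ x3 _ n1 - hmI _ x3 _ n4 + hmI _ x4 _ n3 - hmI _ x1 _ n3
    · linear_combination hmI _ x3 _ n2 - hmI _ x2 _ n3
  have hh' : h = g * x := by rw [hxd]; group
  have : g * n * g⁻¹ = h * n * h⁻¹ := by
    rw [hh', mul_assoc g x n, hc]; group
  rw [this]
  exact H.mul_mem (H.mul_mem hh hn) (H.inv_mem hh)

theorem diag_ex (u v : A) (h : u * v = 1) : ∃ g : SL(2, A), g 0 0 = u ∧ g 0 1 = 0 ∧ g 1 0 = 0 ∧ g 1 1 = v :=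
  ⟨⟨!![u, 0; 0, v], by simp [h]⟩, rfl, rfl, rfl, rfl⟩

/-- multiplier ring of an additive subgroup -/
def multRing (P : AddSubgroup A) : Subring A where
  carrier := {a | ∀ x ∈ P, a * x ∈ P}
  zero_mem' := by intro x _; rw [zero_mul]; exact P.zero_mem
  one_mem' := by intro x hx; rwa [one_mul]
  add_mem' := by intro a b ha hb x hx; rw [add_mul]; exact P.add_mem (ha x hx) (hb x hx)
  neg_mem' := by intro a ha x hx; rw [neg_mul]; exact P.neg_mem (ha x hx)
  mul_mem' := by intro a b ha hb x hx; rw [mul_assoc]; exact ha _ (hb x hx)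

theorem mem_multRing {P : AddSubgroup A} {a : A} : a ∈ multRing P ↔ ∀ x ∈ P, a * x ∈ P := Iff.rfl

theorem sl2_ext_unit {g h : SL(2, A)} {b : A} (hb : g 0 0 * b = 1) (h00 : g 0 0 = h 0 0) (h01 : g 0 1 = h 0 1)
    (h10 : g 1 0 = h 1 0) : g = h := by
  apply sl2_ext h00 h01 h10
  have h1 := sldet g
  have h2 := sldet h
  rw [← h00, ← h01, ← h10] at h2
  linear_combination b * h1 - b * h2 - (g 1 1 - h 1 1) * hb

theorem case_one (hsq : SqGen A) (H : Subgroup SL(2, A)) (I m : Ideal A) (hmm : m.IsMaximal)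
    (hmI : ∀ a ∈ m, ∀ b ∈ I, a * b = 0)
    (hat : ∀ i ∈ I, i ≠ 0 → ∀ x ∈ I, ∃ a, x = a * i)
    (hI : ∀ g, ∃ h ∈ H, red I h = red I g)
    (hconj : ∀ n ∈ H, red I n = 1 → ∀ g, g * n * g⁻¹ ∈ H)
    (i : A) (hi : i ∈ I) (hi0 : i ≠ 0) (hiH : eU i ∈ H) : H = ⊤ := by
  have redU : ∀ x ∈ I, red I (eU x) = 1 := by
    intro x hx; rw [red_one_iff]; simp [hx]
  have hU : ∀ x ∈ I, eU x ∈ H := by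
    have := hsq (multRing (PU H ⊓ I.toAddSubgroup)) (by
      rintro u ⟨v, rfl⟩
      rw [mem_multRing]
      rintro x ⟨hx, hxI⟩
      obtain ⟨g, g1, g2, g3, g4⟩ := diag_ex (v : A) ((v⁻¹ : Aˣ) : A) v.mul_inv
      refine ⟨?_, I.mul_mem_left _ hxI⟩
      have := hconj _ hx (redU x hxI) g
      have e : g * eU x * g⁻¹ = eU ((v : A) ^ 2 * x) := by
        apply sl2_ext <;> simp [g1, g2, g3, g4]
        ring
      rw [e] at this
      exact this)
    intro x hx
    obtain ⟨a, rfl⟩ := hat i hi hi0 x hx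
    exact (this a i ⟨hiH, hi⟩).1
  have hLo : ∀ x ∈ I, eL x ∈ H := by
    intro x hx
    have := hconj _ (hU (-x) (I.neg_mem hx)) (redU _ (I.neg_mem hx)) wE
    rwa [w_conj_U, neg_neg] at this
  have key : ∀ g : SL(2, A), red I g = 1 → IsUnit (g 0 0) → g ∈ H := by
    intro g hg hu
    rw [red_one_iff] at hg
    obtain ⟨g1, g2, g3, g4⟩ := hg
    obtain ⟨v, hv⟩ := hu
    obtain ⟨b, hb⟩ : ∃ b, g 0 0 * b = 1 := ⟨(v⁻¹ : Aˣ), by rw [← hv]; exact v.mul_inv⟩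
    have hE := hconj _ (hU _ (I.neg_mem g1)) (redU _ (I.neg_mem g1)) (eL 1)
    have hd := sldet g
    have e : g = eL ((g 1 0 - (g 0 0 - 1)) * b) * (eL 1 * eU (-(g 0 0 - 1)) * (eL 1)⁻¹) * eU (((g 0 0 - 1) + g 0 1) * b) := by
      apply sl2_ext_unit hb <;> simp
      · linear_combination (1 - g 0 0 - g 0 1) * hb
      · linear_combination (g 0 0 - 1 - g 1 0) * hb
    rw [e]
    exact H.mul_mem (H.mul_mem (hLo _ (I.mul_mem_right _ (I.sub_mem g3 g1))) hE)
      (hU _ (I.mul_mem_right _ (I.add_mem g1 g2)))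
  have hmax : ∀ g : SL(2, A), red I g = 1 → ¬ IsUnit (g 0 0) → g 0 0 ∈ m ∧ ¬ I ≤ m := by
    intro g hg hu
    rw [red_one_iff] at hg
    obtain ⟨m', hm', hgm⟩ := exists_max_ideal_of_mem_nonunits hu
    have hIm : ¬ I ≤ m' := by
      intro hle
      apply hm'.ne_top
      rw [Ideal.eq_top_iff_one]
      have := m'.sub_mem hgm (hle hg.1)
      simpa using this
    obtain ⟨j, hj, hjm⟩ := Set.not_subset.1 hIm
    have hle : m ≤ m' := by
      intro a ha
      have : a * j ∈ m' := by rw [hmI a ha j hj]; exact m'.zero_mem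
      exact (hm'.isPrime.mem_or_mem this).resolve_right hjm
    have : m = m' := hmm.eq_of_le hm'.ne_top hle
    rw [this]; exact ⟨hgm, hIm⟩
  have hK : ∀ g : SL(2, A), red I g = 1 → g ∈ H := by
    intro g hg
    by_cases hu : IsUnit (g 0 0)
    · exact key g hg hu
    obtain ⟨hgm, hIm⟩ := hmax g hg hu
    have hsup : I ⊔ m = ⊤ := by
      exact hmm.out.2 _ (right_lt_sup.2 hIm)
    obtain ⟨x, hx, y, hy, hxy⟩ := Submodule.mem_sup.1 ((Ideal.eq_top_iff_one _).1 hsup)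
    have hg' : red I (eU x * g) = 1 := by rw [map_mul, hg, redU x hx, one_mul]
    have hu' : IsUnit ((eU x * g) 0 0) := by
      by_contra hu'
      have h1 := (hmax _ hg' hu').1
      apply hmm.ne_top
      rw [Ideal.eq_top_iff_one]
      have hd := sldet g
      simp at h1
      have h2 : x * g 1 0 ∈ m := by have := m.sub_mem h1 hgm; simpa using this
      have h3 : g 1 0 ∈ m := by
        have := m.add_mem h2 (m.mul_mem_right (g 1 0) hy)
        rwa [← add_mul, hxy, one_mul] at this
      rw [← hd]
      exact m.sub_mem (m.mul_mem_right _ hgm) (m.mul_mem_left _ h3)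
    have h1 := key _ hg' hu'
    have := H.mul_mem (H.inv_mem (hU x hx)) h1
    simpa using this
  rw [eq_top_iff]
  intro g _
  obtain ⟨h, hh, e⟩ := hI g
  have h1 : g * h⁻¹ ∈ H := by
    apply hK; rw [map_mul, map_inv, e]; simp
  have := H.mul_mem h1 hh
  simpa using this
end ringstep
end part_f

section part_g
section ringstep2
variable {A : Type*} [CommRing A]

theorem trace_eq (h2 : IsUnit (2 : A)) (H : Subgroup SL(2, A)) (I : Ideal A)
    (hN : ∀ n ∈ H, red I n = 1 → n 0 1 = 0 ∧ n 1 0 = 0 ∧ n 0 0 = n 1 1)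
    (X Y : SL(2, A)) (hX : X ∈ H) (hY : Y ∈ H) (hXY : red I X = red I Y)
    (tX : X 0 0 + X 1 1 = 2) (tY : Y 0 0 + Y 1 1 = 2) : X = Y := by
  obtain ⟨n1, n2, n3⟩ := hN (X * Y⁻¹) (H.mul_mem hX (H.inv_mem hY)) (by rw [map_mul, map_inv, hXY]; simp)
  have hX' : X = (X * Y⁻¹) * Y := by simp
  generalize X * Y⁻¹ = n at *
  subst hX'
  simp [n1, n2, ← n3] at tX
  have hz : n 0 0 = 1 := by
    apply h2.mul_left_cancel
    linear_combination tX - n 0 0 * tY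
  have : n = 1 := by apply sl2_ext <;> simp [n1, n2, ← n3, hz]
  rw [this, one_mul]

theorem case_two (h2 : IsUnit (2 : A)) (hsq : SqGen A) (H : Subgroup SL(2, A)) (I : Ideal A)
    (hI : ∀ g, ∃ h ∈ H, red I h = red I g)
    (μ : A) (hμ : IsUnit μ) (hgen : Algebra.adjoin ℤ {μ} = ⊤) (hμH : eU μ ∈ H) (hL : eL 1 ∈ H)
    (i : A) (hi : i ∈ I) (hi0 : i ≠ 0)
    (hPU : ∀ x ∈ I, eU x ∈ H → x = 0)
    (hN : ∀ n ∈ H, red I n = 1 → n 0 1 = 0 ∧ n 1 0 = 0 ∧ n 0 0 = n 1 1) : False := by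
  obtain ⟨t, ht⟩ := h2.exists_right_inv
  have tr := trace_eq h2 H I hN
  have densU : ∀ x, ∃ y ∈ PU H, y - x ∈ I := by
    intro x
    obtain ⟨h, hh, e⟩ := hI (eU (t * x))
    have e1 : h * eU μ * h⁻¹ = eU μ := by
      apply tr _ _ (H.mul_mem (H.mul_mem hh hμH) (H.inv_mem hh)) hμH
      · rw [map_mul, map_mul, map_inv, e, ← map_inv, ← map_mul, ← map_mul, ← eU_neg, ← eU_add, ← eU_add]
        congr 2; ring
      · have := sldet h
        simp; linear_combination 2 * this
      · simp; norm_num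
    have hd := sldet h
    have q1 := congrArg (fun g : SL(2, A) => g 0 0) e1
    have q2 := congrArg (fun g : SL(2, A) => g 0 1) e1
    simp at q1 q2
    have q3 : h 0 0 ^ 2 = 1 := by
      apply hμ.mul_left_cancel
      linear_combination q2
    have q4 : h 0 0 * h 1 0 = 0 := by
      apply hμ.mul_left_cancel
      linear_combination hd - q1
    have q5 : h 1 0 = 0 := by linear_combination h 0 0 * q4 - h 1 0 * q3
    have q6 : h 1 1 = h 0 0 := by linear_combination h 0 0 * hd - h 1 1 * q3 + h 0 0 * h 0 1 * q5
    rw [red_eq_iff] at e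
    obtain ⟨e1, e2, -, -⟩ := e
    simp at e1 e2
    refine ⟨2 * (h 0 0 * h 0 1), ?_, ?_⟩
    · rw [mem_PU]
      have : eU (2 * (h 0 0 * h 0 1)) = h * h := by
        apply sl2_ext <;> simp [q5, q6]
        · linear_combination -q3
        · ring
        · linear_combination -q3
      rw [this]; exact H.mul_mem hh hh
    · have : 2 * (h 0 0 * h 0 1) - x = 2 * h 0 1 * (h 0 0 - 1) + 2 * (h 0 1 - t * x) := by
        linear_combination x * ht
      rw [this]
      exact I.add_mem (I.mul_mem_left _ e1) (I.mul_mem_left _ e2)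
  have densL : ∀ x, ∃ y ∈ PL H, y - x ∈ I := by
    intro x
    obtain ⟨h, hh, e⟩ := hI (eL (t * x))
    have e1 : h * eL 1 * h⁻¹ = eL 1 := by
      apply tr _ _ (H.mul_mem (H.mul_mem hh hL) (H.inv_mem hh)) hL
      · rw [map_mul, map_mul, map_inv, e, ← map_inv, ← map_mul, ← map_mul, ← eL_neg, ← eL_add, ← eL_add]
        congr 2; ring
      · have := sldet h
        simp; linear_combination 2 * this
      · simp; norm_num
    have hd := sldet h
    have q1 := congrArg (fun g : SL(2, A) => g 0 0) e1
    have q2 := congrArg (fun g : SL(2, A) => g 1 0) e1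
    simp at q1 q2
    have q3 : h 1 1 ^ 2 = 1 := by linear_combination q2
    have q4 : h 1 1 * h 0 1 = 0 := by linear_combination q1 - hd
    have q5 : h 0 1 = 0 := by linear_combination h 1 1 * q4 - h 0 1 * q3
    have q6 : h 0 0 = h 1 1 := by linear_combination h 1 1 * hd - h 0 0 * q3 + h 1 1 * h 1 0 * q5
    rw [red_eq_iff] at e
    obtain ⟨-, -, e2, e1⟩ := e
    simp at e1 e2
    refine ⟨2 * (h 1 1 * h 1 0), ?_, ?_⟩
    · rw [mem_PL]
      have : eL (2 * (h 1 1 * h 1 0)) = h * h := by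
        apply sl2_ext <;> simp [q5, q6]
        · linear_combination -q3
        · ring
        · linear_combination -q3
      rw [this]; exact H.mul_mem hh hh
    · have : 2 * (h 1 1 * h 1 0) - x = 2 * h 1 0 * (h 1 1 - 1) + 2 * (h 1 0 - t * x) := by
        linear_combination x * ht
      rw [this]
      exact I.add_mem (I.mul_mem_left _ e1) (I.mul_mem_left _ e2)
  have uv : ∀ u ∈ PU H, ∀ v ∈ PL H, u * v - 1 ∈ I → u * v = 1 := by
    intro u hu v hv huv
    obtain ⟨y, hy, hyI⟩ := densL (-(v ^ 2 * μ))
    have hm : eU u * eL (-v) * eU u ∈ H := by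
      apply H.mul_mem (H.mul_mem hu _) hu
      rw [eL_neg]; exact H.inv_mem hv
    have e1 := tr (eU u * eL (-v) * eU u * eU μ * (eU u * eL (-v) * eU u)⁻¹) (eL y)
      (H.mul_mem (H.mul_mem hm hμH) (H.inv_mem hm)) hy (by
        rw [red_eq_iff]
        have ha : 1 - u * v ∈ I := by have := I.neg_mem huv; rwa [neg_sub] at this
        refine ⟨?_, ?_, ?_, ?_⟩
        · convert I.mul_mem_left (μ * v) ha using 1
          simp; ring
        · convert I.mul_mem_left (μ * (1 - u * v)) ha using 1
          simp; ring
        · convert I.neg_mem hyI using 1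
          simp; ring
        · convert I.mul_mem_left (-μ * v) ha using 1
          simp; ring) (by simp; ring) (by simp; norm_num)
    have q1 := congrArg (fun g : SL(2, A) => g 0 0) e1
    have q2 := congrArg (fun g : SL(2, A) => g 0 1) e1
    simp at q1 q2
    have q3 : (1 - u * v) ^ 2 = 0 := by
      apply hμ.mul_left_cancel; linear_combination q2
    have q4 : (1 - u * v) * v = 0 := by
      apply hμ.mul_left_cancel; linear_combination q1
    linear_combination -q3 - u * q4
  have hL1 : (1 : A) ∈ PL H := hL
  have hU1 : (1 : A) ∈ PU H := by
    obtain ⟨u, hu, huI⟩ := densU 1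
    have := uv u hu 1 hL1 (by simpa using huI)
    rw [mul_one] at this
    rwa [this] at hu
  have hw : (wE : SL(2, A)) ∈ H := by
    rw [wE]
    apply H.mul_mem (H.mul_mem hU1 _) hU1
    rw [eL_neg]; exact H.inv_mem hL1
  have sqM : ∀ u ∈ PU H, ∀ v ∈ PL H, u * v = 1 → u ^ 2 ∈ multRing (PU H) := by
    intro u hu v hv huv x hx
    have hm : eU u * eL (-v) * eU u * wE⁻¹ ∈ H := by
      apply H.mul_mem (H.mul_mem (H.mul_mem hu _) hu) (H.inv_mem hw)
      rw [eL_neg]; exact H.inv_mem hv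
    have := H.mul_mem (H.mul_mem hm hx) (H.inv_mem hm)
    rw [mem_PU]
    convert this using 1
    apply sl2_ext <;> simp
    · linear_combination (x * u * (u * v - 2)) * huv
    · linear_combination (-(u ^ 2 * x * (u * v - 3))) * huv
    · linear_combination (x * (u * v - 1)) * huv
    · linear_combination (-(u * x * (u * v - 2))) * huv
  have hMd : ∀ x, ∃ y ∈ multRing (PU H), y - x ∈ I := by
    intro x
    have := (SqGen.quot (Ideal.Quotient.mk I) Ideal.Quotient.mk_surjective hsq)
      ((multRing (PU H)).map (Ideal.Quotient.mk I)) (by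
        intro a ha
        obtain ⟨b, hab⟩ := ha.exists_right_inv
        obtain ⟨a, rfl⟩ := Ideal.Quotient.mk_surjective a
        obtain ⟨b, rfl⟩ := Ideal.Quotient.mk_surjective b
        obtain ⟨u, hu, hua⟩ := densU a
        obtain ⟨v, hv, hvb⟩ := densL b
        rw [← Ideal.Quotient.eq] at hua hvb
        rw [← hua, ← hvb, ← map_mul, ← map_one (Ideal.Quotient.mk I), Ideal.Quotient.eq] at hab
        exact ⟨u ^ 2, sqM u hu v hv (uv u hu v hv hab), by rw [map_pow, hua]⟩)
      (Ideal.Quotient.mk I x)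
    obtain ⟨y, hy, e⟩ := this
    exact ⟨y, hy, by rwa [← Ideal.Quotient.eq]⟩
  have hMP : ∀ y ∈ multRing (PU H), y ∈ PU H := by
    intro y hy
    have := hy 1 hU1
    rwa [mul_one] at this
  have hμM : μ ∈ multRing (PU H) := by
    obtain ⟨y, hy, hyI⟩ := hMd μ
    have := hPU _ hyI ((PU H).sub_mem (hMP y hy) hμH)
    rwa [sub_eq_zero.1 this] at hy
  exact hi0 (hPU i hi (hMP _ (subring_top_of_adjoin μ hgen _ hμM i)))
end ringstep2
end part_g

section part_h
universe u

section ringthm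
set_option linter.unusedSimpArgs false

theorem adjoin_map {A B : Type*} [CommRing A] [CommRing B] (f : A →+* B) (hf : Function.Surjective f) (μ : A)
    (h : Algebra.adjoin ℤ {μ} = ⊤) : Algebra.adjoin ℤ {f μ} = ⊤ := by
  have h1 := (f.toIntAlgHom).map_adjoin {μ}
  rw [h, Set.image_singleton, Algebra.map_top] at h1
  have h2 : f.toIntAlgHom μ = f μ := rfl
  rw [← h2, ← h1]
  exact (AlgHom.range_eq_top _).2 hf

theorem Good.map {A B : Type u} [CommRing A] [CommRing B] (f : A →+* B) (hf : Function.Surjective f)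
    (h : Good A) : Good B := by
  rcases subsingleton_or_nontrivial B with hs | hs
  · left
    intro k _ φ _
    exfalso
    apply one_ne_zero (α := k)
    rw [← map_one φ, ← map_zero φ, Subsingleton.elim (1 : B) 0]
  · rcases h with h | h
    · left
      intro k _ φ hφ
      exact h k (φ.comp f) (hφ.comp hf)
    · right
      exact IsLocalRing.of_surjective' f hf

theorem hN_coprime {A : Type u} [CommRing A] [Finite A] (h2 : IsUnit (2 : A)) (hg : Good A)
    (H : Subgroup SL(2, A)) (I m : Ideal A) (hmm : m.IsMaximal) (hIm : I ⊔ m = ⊤) (hI : I ≠ ⊤)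
    (hmI : ∀ a ∈ m, ∀ b ∈ I, a * b = 0)
    (hconj : ∀ n ∈ H, red I n = 1 → ∀ g, g * n * g⁻¹ ∈ H)
    (hPU : ∀ x ∈ I, eU x ∈ H → x = 0) :
    ∀ n ∈ H, red I n = 1 → n 0 1 = 0 ∧ n 1 0 = 0 ∧ n 0 0 = n 1 1 := by
  obtain ⟨e, he, f, hf, hef⟩ := Submodule.mem_sup.1 ((Ideal.eq_top_iff_one _).1 hIm)
  have hcap : ∀ x ∈ I, x ∈ m → x = 0 := by
    intro x hx hxm
    linear_combination (-x) * hef + hmI f hf x hx + hmI x hxm e he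
  let : Field (A ⧸ m) := Ideal.Quotient.field m
  have hcard : Nat.card (A ⧸ m) ≠ 3 := by
    rcases hg with h | h
    · exact h (A ⧸ m) (Ideal.Quotient.mk m) Ideal.Quotient.mk_surjective
    · exfalso
      have h1 := IsLocalRing.le_maximalIdeal hI
      have h2 := IsLocalRing.le_maximalIdeal hmm.ne_top
      have := sup_le h1 h2
      rw [hIm] at this
      exact (IsLocalRing.maximalIdeal.isMaximal A).ne_top (top_le_iff.1 this)
  have h2' : (2 : A ⧸ m) ≠ 0 := by
    have := (h2.map (Ideal.Quotient.mk m)).ne_zero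
    rwa [show Ideal.Quotient.mk m 2 = 2 from map_ofNat (Ideal.Quotient.mk m) 2] at this
  have hfin : Finite (A ⧸ m) := Finite.of_surjective _ (Ideal.Quotient.mk_surjective (I := m))
  have h5 := five_le _ h2' hcard
  let N0 : Subgroup SL(2, A) := H ⊓ (red I).ker
  have hsurj : ∀ g : SL(2, A ⧸ m), ∃ h : SL(2, A), red m h = g := by
    intro g
    obtain ⟨a, ha⟩ := Ideal.Quotient.mk_surjective (I := m) (g 0 0)
    obtain ⟨b, hb⟩ := Ideal.Quotient.mk_surjective (I := m) (g 0 1)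
    obtain ⟨c, hc⟩ := Ideal.Quotient.mk_surjective (I := m) (g 1 0)
    obtain ⟨d, hd⟩ := Ideal.Quotient.mk_surjective (I := m) (g 1 1)
    have hdet : a * d - b * c - 1 ∈ m := by
      rw [← Ideal.Quotient.eq]
      simp only [map_sub, map_mul, ha, hb, hc, hd, map_one]
      exact sldet g
    have hem : ∀ x, Ideal.Quotient.mk m (e * x) = Ideal.Quotient.mk m x := by
      intro x
      rw [Ideal.Quotient.eq]
      have : e * x - x = -x * f := by linear_combination x * hef
      rw [this]; exact m.mul_mem_left _ hf
    have hfe := hmI f hf e he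
    have hz := hmI _ hdet e he
    have hem' : ∀ x, Ideal.Quotient.mk m (e * x + f) = Ideal.Quotient.mk m x := by
      intro x
      rw [map_add, hem, Ideal.Quotient.eq_zero_iff_mem.2 hf, add_zero]
    refine ⟨⟨!![e * a + f, e * b; e * c, e * d + f], ?_⟩, ?_⟩
    · rw [Matrix.det_fin_two]
      simp
      linear_combination (e) * hz + (a + d - 2) * hfe + (e + f + 1) * hef
    · apply sl2_ext
      · exact (hem' a).trans ha
      · exact (hem b).trans hb
      · exact (hem c).trans hc
      · exact (hem' d).trans hd
  have hnorm : (N0.map (red m)).Normal := by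
    constructor
    rintro _ ⟨n, ⟨hn, hn1⟩, rfl⟩ g
    obtain ⟨h, rfl⟩ := hsurj g
    refine ⟨h * n * h⁻¹, ⟨hconj n hn hn1 h, ?_⟩, by simp⟩
    have hn1 : red I n = 1 := hn1
    show red I (h * n * h⁻¹) = 1
    simp only [map_mul, map_inv, hn1]; simp
  rcases normal_SL2 h5 (N0.map (red m)) with h | h
  · exfalso
    have : eU 1 ∈ N0.map (red m) := by rw [h]; trivial
    obtain ⟨n, ⟨hn, hn1⟩, hn2⟩ := this
    have hn1 : red I n = 1 := hn1
    have hn2 : red m n = red m (eU 1) := by rw [hn2]; apply sl2_ext <;> simp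
    rw [red_eq_iff] at hn2
    rw [red_one_iff] at hn1
    simp at hn1 hn2
    obtain ⟨a1, a2, a3, a4⟩ := hn1
    obtain ⟨b1, b2, b3, b4⟩ := hn2
    have : n = eU e := by
      apply sl2_ext
      · simpa [sub_eq_zero] using hcap _ a1 b1
      · have : n 0 1 - e ∈ m := by
          have := m.add_mem b2 hf
          convert this using 1
          linear_combination -hef
        simpa [sub_eq_zero] using hcap _ (I.sub_mem a2 he) this
      · simpa using hcap _ a3 b3
      · simpa [sub_eq_zero] using hcap _ a4 b4
    rw [this] at hn
    have := hPU e he hn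
    rw [this, zero_add] at hef
    rw [hef] at hf
    exact hmm.ne_top ((Ideal.eq_top_iff_one _).2 hf)
  · intro n hn hn1
    have hc := h ⟨n, ⟨hn, hn1⟩, rfl⟩
    rw [Subgroup.mem_center_iff] at hc
    have c1 := hc (red m (eU 1))
    have c2 := hc (red m (eL 1))
    rw [← map_mul, ← map_mul, red_eq_iff] at c1 c2
    rw [red_one_iff] at hn1
    obtain ⟨a1, a2, a3, a4⟩ := hn1
    simp at c1 c2
    refine ⟨hcap _ a2 ?_, hcap _ a3 ?_, ?_⟩
    · exact c2.1
    · exact c1.1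
    · have h1 := c1.2.1
      have h3 : n 0 0 - n 1 1 ∈ m := by
        convert m.neg_mem h1 using 1
        ring
      have h4 : n 0 0 - n 1 1 ∈ I := by
        convert I.sub_mem a1 a4 using 1
        ring
      exact sub_eq_zero.1 (hcap _ h4 h3)

theorem hN_nil {A : Type u} [CommRing A] (h2 : IsUnit (2 : A))
    (H : Subgroup SL(2, A)) (I : Ideal A) (hII : ∀ a ∈ I, ∀ b ∈ I, a * b = 0)
    (hconj : ∀ n ∈ H, red I n = 1 → ∀ g, g * n * g⁻¹ ∈ H)
    (hPU : ∀ x ∈ I, eU x ∈ H → x = 0) :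
    ∀ n ∈ H, red I n = 1 → n 0 1 = 0 ∧ n 1 0 = 0 ∧ n 0 0 = n 1 1 := by
  intro n hn hn1
  have c1 := hconj n hn hn1 (eU 1)
  have c2 := hconj n hn hn1 (eU (-1))
  rw [red_one_iff] at hn1
  obtain ⟨a1, a2, a3, a4⟩ := hn1
  obtain ⟨α, hα⟩ : ∃ α, α = n 0 0 - 1 := ⟨_, rfl⟩
  obtain ⟨β, hβ⟩ : ∃ β, β = n 0 1 := ⟨_, rfl⟩
  obtain ⟨γ, hγ⟩ : ∃ γ, γ = n 1 0 := ⟨_, rfl⟩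
  obtain ⟨δ, hδ⟩ : ∃ δ, δ = n 1 1 - 1 := ⟨_, rfl⟩
  rw [← hα] at a1
  rw [← hβ] at a2
  rw [← hγ] at a3
  rw [← hδ] at a4
  have n00 : n 0 0 = 1 + α := by rw [hα]; ring
  have n11 : n 1 1 = 1 + δ := by rw [hδ]; ring
  have hd := sldet n
  rw [n00, n11, ← hβ, ← hγ] at hd
  have had : δ = -α := by linear_combination hd - hII α a1 δ a4 + hII β a2 γ a3
  subst had
  have zaa := hII α a1 α a1
  have zab := hII α a1 β a2
  have zac := hII α a1 γ a3
  have zbb := hII β a2 β a2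
  have zbc := hII β a2 γ a3
  have zcc := hII γ a3 γ a3
  have hγ0 : γ = 0 := by
    have := H.mul_mem (H.mul_mem c1 c2) (H.mul_mem (H.inv_mem hn) (H.inv_mem hn))
    have e : eU 1 * n * (eU 1)⁻¹ * (eU (-1) * n * (eU (-1))⁻¹) * (n⁻¹ * n⁻¹ : SL(2, A)) = eU (-2 * γ) := by
      have p00 : (eU 1 * n * (eU 1)⁻¹ * (eU (-1) * n * (eU (-1))⁻¹) : SL(2, A)) 0 0 = 1 + 2 * α := by
        simp [n00, n11, ← hβ, ← hγ]; grind
      have p01 : (eU 1 * n * (eU 1)⁻¹ * (eU (-1) * n * (eU (-1))⁻¹) : SL(2, A)) 0 1 = 2 * β - 2 * γ := by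
        simp [n00, n11, ← hβ, ← hγ]; grind
      have p10 : (eU 1 * n * (eU 1)⁻¹ * (eU (-1) * n * (eU (-1))⁻¹) : SL(2, A)) 1 0 = 2 * γ := by
        simp [n00, n11, ← hβ, ← hγ]; grind
      have p11 : (eU 1 * n * (eU 1)⁻¹ * (eU (-1) * n * (eU (-1))⁻¹) : SL(2, A)) 1 1 = 1 - 2 * α := by
        simp [n00, n11, ← hβ, ← hγ]; grind
      have q00 : (n⁻¹ * n⁻¹ : SL(2, A)) 0 0 = 1 - 2 * α := by simp [n00, n11, ← hβ, ← hγ]; grind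
      have q01 : (n⁻¹ * n⁻¹ : SL(2, A)) 0 1 = - 2 * β := by simp [n00, n11, ← hβ, ← hγ]; grind
      have q10 : (n⁻¹ * n⁻¹ : SL(2, A)) 1 0 = - 2 * γ := by simp [n00, n11, ← hβ, ← hγ]; grind
      have q11 : (n⁻¹ * n⁻¹ : SL(2, A)) 1 1 = 1 + 2 * α := by simp [n00, n11, ← hβ, ← hγ]; grind
      generalize (eU 1 * n * (eU 1)⁻¹ * (eU (-1) * n * (eU (-1))⁻¹) : SL(2, A)) = P at *
      generalize n⁻¹ * n⁻¹ = Q at *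
      apply sl2_ext
      · rw [slm00, p00, p01, q00, q10, eU00]; grind
      · rw [slm01, p00, p01, q01, q11, eU01]; grind
      · rw [slm10, p10, p11, q00, q10, eU10]; grind
      · rw [slm11, p10, p11, q01, q11, eU11]; grind
    rw [e] at this
    have := hPU _ (I.mul_mem_left _ a3) this
    apply h2.mul_left_cancel
    linear_combination -this
  rw [hγ0] at hγ
  have hα0 : α = 0 := by
    have := H.mul_mem c1 (H.inv_mem hn)
    have e : eU 1 * n * (eU 1)⁻¹ * n⁻¹ = eU (-2 * α) := by
      apply sl2_ext
      · simp [n00, n11, ← hβ, ← hγ]; grind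
      · simp [n00, n11, ← hβ, ← hγ]; grind
      · simp [n00, n11, ← hβ, ← hγ]
      · simp [n00, n11, ← hβ, ← hγ]; grind
    rw [e] at this
    have := hPU _ (I.mul_mem_left _ a1) this
    apply h2.mul_left_cancel
    linear_combination -this
  rw [hα0] at n00 n11
  have e : n = eU β := by
    apply sl2_ext <;> simp [n00, n11, ← hβ, ← hγ]
  rw [e] at hn
  have := hPU β a2 hn
  exact ⟨by rw [← hβ, this], hγ.symm, by rw [n00, n11]; ring⟩

theorem ring_thm (N : ℕ) : ∀ (A : Type u) [CommRing A] [Finite A] (_ : Nat.card A ≤ N) (_ : IsUnit (2 : A)) (μ : A)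
    (_ : IsUnit μ) (_ : Algebra.adjoin ℤ {μ} = ⊤) (_ : Good A)
    (_ : ∀ (k : Type u) [Field k] (φ : A →+* k), Function.Surjective φ → ¬ ((3 : k) = 0 ∧ φ μ ^ 2 = -1))
    (H : Subgroup SL(2, A)) (_ : -1 ∈ H) (_ : eU μ ∈ H) (_ : eL 1 ∈ H), H = ⊤ := by
  induction N with
  | zero =>
    intro A _ _ hc
    have := Nat.card_pos (α := A)
    omega
  | succ N ih =>
    intro A _ _ hc h2 μ hμ hgen hg hex H hneg hμH hL
    rcases subsingleton_or_nontrivial A with hs | hs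
    · rw [eq_top_iff]
      intro g _
      have : g = 1 := by apply sl2_ext <;> exact Subsingleton.elim _ _
      rw [this]; exact H.one_mem
    by_cases hF : IsField A
    · let := hF.toField
      exact field_case h2.ne_zero μ hμ.ne_zero hgen
        (hex A (RingHom.id A) Function.surjective_id) H hneg hμH hL
    have step : ∀ J : Ideal A, J ≠ ⊥ → ∀ g, ∃ h ∈ H, red J h = red J g := by
      intro J hJ g
      have hsj : Function.Surjective (Ideal.Quotient.mk J) := Ideal.Quotient.mk_surjective
      have hfin : Finite (A ⧸ J) := Finite.of_surjective _ hsj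
      have hlt : Nat.card (A ⧸ J) < Nat.card A := by
        refine lt_of_le_of_ne (Nat.card_le_card_of_surjective _ hsj) ?_
        intro he
        apply hJ
        have : Function.Injective (Ideal.Quotient.mk J) := by
          exact ((Nat.bijective_iff_surjective_and_card _).2 ⟨hsj, he.symm⟩).1
        rw [← Ideal.mk_ker (I := J)]
        exact (RingHom.injective_iff_ker_eq_bot _).1 this
      have := ih (A ⧸ J) (by omega) (by rw [← map_ofNat (Ideal.Quotient.mk J) 2]; exact h2.map (Ideal.Quotient.mk J)) (Ideal.Quotient.mk J μ)
        (hμ.map _) (adjoin_map _ hsj μ hgen) (hg.map _ hsj)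
        (fun k _ φ hφ => hex k (φ.comp (Ideal.Quotient.mk J)) (hφ.comp hsj))
        (H.map (red J)) ⟨-1, hneg, map_neg1 _⟩ ⟨_, hμH, map_eU _ _⟩ ⟨_, hL, by rw [map_eL, map_one]⟩
      have hh : red J g ∈ H.map (red J) := by rw [this]; trivial
      exact hh
    obtain ⟨I, hI⟩ := IsAtomic.exists_atom (Ideal A)
    obtain ⟨i, hi, hi0⟩ := Submodule.exists_mem_ne_zero_of_ne_bot hI.1
    have hat : ∀ i ∈ I, i ≠ 0 → ∀ x ∈ I, ∃ a, x = a * i := by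
      intro i hi hi0 x hx
      have : Ideal.span {i} = I := by
        refine (hI.le_iff.1 ((Ideal.span_singleton_le_iff_mem _).2 hi)).resolve_left ?_
        rwa [Ideal.span_singleton_eq_bot]
      rw [← this, Ideal.mem_span_singleton'] at hx
      obtain ⟨a, ha⟩ := hx
      exact ⟨a, ha.symm⟩
    let m : Ideal A := Ideal.torsionOf A A i
    have memm : ∀ a, a ∈ m ↔ a * i = 0 := fun a => Iff.rfl
    have inv : ∀ a, a ∉ m → ∃ b, b * a - 1 ∈ m := by
      intro a ha
      rw [memm] at ha
      obtain ⟨b, hb⟩ := hat (a * i) (I.mul_mem_left _ hi) ha i hi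
      exact ⟨b, by rw [memm]; linear_combination -hb⟩
    have hmm : m.IsMaximal := by
      rw [Ideal.isMaximal_iff]
      refine ⟨by rw [memm, one_mul]; exact hi0, ?_⟩
      intro J x hmJ hxm hxJ
      obtain ⟨b, hb⟩ := inv x hxm
      have := J.sub_mem (J.mul_mem_left b hxJ) (hmJ hb)
      simpa using this
    have hmI : ∀ a ∈ m, ∀ b ∈ I, a * b = 0 := by
      intro a ha b hb
      obtain ⟨c, rfl⟩ := hat i hi hi0 b hb
      rw [memm] at ha
      linear_combination c * ha
    have hm0 : m ≠ ⊥ := by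
      intro hm0
      apply hF
      refine ⟨exists_pair_ne A, mul_comm, ?_⟩
      intro a ha
      obtain ⟨b, hb⟩ := inv a (by rw [hm0]; simpa using ha)
      rw [hm0] at hb
      exact ⟨b, by have : b * a - 1 = 0 := by simpa using hb
                   linear_combination this⟩
    have hIt : I ≠ ⊤ := by
      rintro rfl
      apply hm0
      rw [eq_bot_iff]
      intro a ha
      have := hmI a ha 1 trivial
      simpa using this
    have hIs := step I hI.1
    have hms := step m hm0
    have hconj : ∀ n ∈ H, red I n = 1 → ∀ g, g * n * g⁻¹ ∈ H :=
      fun n hn hn1 g => conj_mem H I m hmI hms n hn hn1 g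
    have hsq := sqGen_of_good h2 hg
    by_cases hPU : ∀ x ∈ I, eU x ∈ H → x = 0
    · exfalso
      refine case_two h2 hsq H I hIs μ hμ hgen hμH hL i hi hi0 hPU ?_
      by_cases hIm : I ≤ m
      · exact hN_nil h2 H I (fun a ha b hb => hmI a (hIm ha) b hb) hconj hPU
      · exact hN_coprime h2 hg H I m hmm (hmm.out.2 _ (right_lt_sup.2 hIm)) hIt hmI hconj hPU
    · push Not at hPU
      obtain ⟨x, hx, hxH, hx0⟩ := hPU
      exact case_one hsq H I m hmm hmI hat hIs hconj x hx hx0 hxH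
end ringthm
end part_h

open Polynomial in
theorem root_ex (n : ℕ) (hn : 3 ≤ n) (ζ : ℂ) (hζ : IsPrimitiveRoot ζ n) {k : Type*} [Field k]
    (φ : Oring ζ →+* k) (p : ℕ) [Fact p.Prime] [CharP k p] (a m : ℕ) (hnm : n = p ^ a * m) (hm : ¬ p ∣ m) :
    ∃ z : AlgebraicClosure k, IsPrimitiveRoot z m ∧
      z ^ 2 - algebraMap k (AlgebraicClosure k) (φ (lamO ζ)) * z + 1 = 0 := by
  have hζ0 : ζ ≠ 0 := hζ.ne_zero (by omega)
  set q : (Oring ζ)[X] := X ^ 2 - C (lamO ζ) * X + 1 with hq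
  have hqm : q.Monic := by rw [hq]; monicity!
  have hqd : q.natDegree = 2 := by rw [hq]; compute_degree!
  have hev : ∀ (w : ℂ), w ^ 2 - (ζ + ζ⁻¹) * w + 1 = 0 → aeval w q = 0 := by
    intro w hw
    rw [hq]
    simp only [map_add, map_sub, map_pow, map_mul, aeval_X, aeval_C, map_one]
    exact hw
  have hr : ∀ w : ℂ, IsPrimitiveRoot w n → aeval w (cyclotomic n (Oring ζ)) = 0 := by
    intro w hw
    have := hw.isRoot_cyclotomic (by omega)
    rw [aeval_def, ← eval_map, map_cyclotomic]
    exact this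
  have hdiv : q ∣ cyclotomic n (Oring ζ) := by
    rw [← modByMonic_eq_zero_iff_dvd hqm]
    set r := cyclotomic n (Oring ζ) %ₘ q with hrdef
    have hdec : r + q * (cyclotomic n (Oring ζ) /ₘ q) = cyclotomic n (Oring ζ) := modByMonic_add_div _ q
    have hrd : r.natDegree ≤ 1 := by
      have := natDegree_modByMonic_lt (cyclotomic n (Oring ζ)) hqm (by intro h; rw [h] at hqd; simp at hqd)
      rw [hqd] at this
      exact Nat.lt_succ_iff.1 this
    obtain ⟨b, c, hbc⟩ := exists_eq_X_add_C_of_natDegree_le_one hrd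
    have e1 : ∀ w : ℂ, IsPrimitiveRoot w n → w ^ 2 - (ζ + ζ⁻¹) * w + 1 = 0 → (b : ℂ) * w + c = 0 := by
      intro w hw hw2
      have h1 := congrArg (aeval w) hdec
      rw [map_add, map_mul, hev w hw2, hr w hw, hbc] at h1
      simpa using h1
    have k1 := e1 ζ hζ (by field_simp; ring)
    have k2 := e1 ζ⁻¹ hζ.inv (by field_simp; ring)
    have hne : ζ - ζ⁻¹ ≠ 0 := by
      intro h
      have : ζ ^ 2 = 1 := by
        have h3 : ζ * ζ⁻¹ = 1 := mul_inv_cancel₀ hζ0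
        linear_combination ζ * h + h3
      have := Nat.le_of_dvd (by norm_num) (hζ.dvd_of_pow_eq_one 2 this)
      omega
    have hb : (b : ℂ) = 0 := by
      have : (b : ℂ) * (ζ - ζ⁻¹) = 0 := by linear_combination k1 - k2
      exact (mul_eq_zero.1 this).resolve_right hne
    have hc : (c : ℂ) = 0 := by rw [hb] at k1; simpa using k1
    have hb' : b = 0 := Subtype.ext hb
    have hc' : c = 0 := Subtype.ext hc
    rw [hbc, hb', hc']; simp
  set F := AlgebraicClosure k
  set j : Oring ζ →+* F := (algebraMap k F).comp φ with hj
  have hsplit : ∃ z : F, z ^ 2 - j (lamO ζ) * z + 1 = 0 := by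
    have hm' : (q.map j).natDegree = 2 := by rw [hqm.natDegree_map, hqd]
    obtain ⟨z, hz⟩ := IsAlgClosed.exists_root (q.map j) (by
      intro h
      rw [natDegree_eq_zero_iff_degree_le_zero.2 h.le] at hm'
      exact absurd hm' (by norm_num))
    refine ⟨z, ?_⟩
    rw [hq] at hz
    simpa [IsRoot] using hz
  obtain ⟨z, hz⟩ := hsplit
  refine ⟨z, ?_, hz⟩
  have : CharP F p := charP_of_injective_algebraMap (algebraMap k F).injective p
  have hne : NeZero (m : F) := ⟨by rwa [Ne, CharP.cast_eq_zero_iff F p]⟩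
  rw [← isRoot_cyclotomic_prime_pow_mul_iff_of_charP (p := p) (k := a), ← hnm]
  have hd2 := Polynomial.map_dvd j hdiv
  rw [map_cyclotomic] at hd2
  refine IsRoot.dvd ?_ hd2
  rw [hq]; simpa [IsRoot] using hz

theorem local_of {A : Type*} [CommRing A] [Nontrivial A] (μ : A) (hgen : Algebra.adjoin ℤ {μ} = ⊤) (c : ℤ)
    (h : ∀ M : Ideal A, M.IsMaximal → μ - c ∈ M ∧ (3 : A) ∈ M) : IsLocalRing A := by
  have key : ∀ x : A, ∃ t : ℤ, x - t ∈ Ideal.span {μ - c} := by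
    intro x
    have := subring_top_of_adjoin μ hgen
      ((Int.castRingHom (A ⧸ Ideal.span {μ - c})).range.comap (Ideal.Quotient.mk (Ideal.span {μ - c}))) (by
        refine ⟨c, ?_⟩
        simp only [eq_intCast]
        rw [← map_intCast (Ideal.Quotient.mk (Ideal.span {μ - c})), eq_comm, Ideal.Quotient.eq]
        exact Ideal.mem_span_singleton_self _) x
    obtain ⟨t, ht⟩ := this
    refine ⟨t, ?_⟩
    rw [← Ideal.Quotient.eq, ← ht]
    simp
  have le : ∀ M M' : Ideal A, M.IsMaximal → M'.IsMaximal → M ≤ M' := by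
    intro M M' hM hM' x hx
    obtain ⟨t, ht⟩ := key x
    have hs : ∀ M : Ideal A, M.IsMaximal → x - t ∈ M := fun M hM =>
      (Ideal.span_singleton_le_iff_mem _).2 (h M hM).1 ht
    have htM : (t : A) ∈ M := by
      have := M.sub_mem hx (hs M hM); simpa using this
    have hd : (3 : ℤ) ∣ t := by
      by_contra hd
      have hc : IsCoprime (3 : ℤ) t := (Int.prime_three.coprime_iff_not_dvd).2 hd
      obtain ⟨a, b, hab⟩ := hc
      apply hM.ne_top
      rw [Ideal.eq_top_iff_one]
      have := M.add_mem (M.mul_mem_left (a : A) (h M hM).2) (M.mul_mem_left (b : A) htM)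
      have e : (a : A) * 3 + b * t = 1 := by exact_mod_cast congrArg (Int.cast (R := A)) hab
      rwa [e] at this
    obtain ⟨s, rfl⟩ := hd
    have h3 : ((3 * s : ℤ) : A) ∈ M' := by
      push_cast
      exact M'.mul_mem_right _ (h M' hM').2
    have := M'.add_mem (hs M' hM') h3
    simpa using this
  obtain ⟨M, hM⟩ := Ideal.exists_maximal A
  exact IsLocalRing.of_unique_max_ideal ⟨M, hM, fun M' hM' => le_antisymm (le _ _ hM' hM) (le _ _ hM hM')⟩

theorem eL_pow {R : Type*} [CommRing R] (x : R) (q : ℕ) : eL x ^ q = eL (q * x) := by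
  induction q with
  | zero => simp [eL_zero]
  | succ q ih => rw [pow_succ, ih, ← eL_add]; congr 1; push_cast; ring

theorem finite_quot (n : ℕ) (hn : 3 ≤ n) (ζ : ℂ) (hζ : IsPrimitiveRoot ζ n) (p : ℕ) (hp : p.Prime) (d : ℕ) :
    Finite (Oring ζ ⧸ Ideal.span {(p : Oring ζ) ^ d}) := by
  have hi : IsIntegral ℤ (ζ + ζ⁻¹) := (hζ.isIntegral (by omega)).add (hζ.inv.isIntegral (by omega))
  have hf : Module.Finite ℤ (Oring ζ) := Module.Finite.iff_fg.2 hi.fg_adjoin_singleton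
  have hf2 : Module.Finite ℤ (Oring ζ ⧸ Ideal.span {(p : Oring ζ) ^ d}) :=
    Module.Finite.of_surjective ((Ideal.Quotient.mk (Ideal.span {(p : Oring ζ) ^ d})).toAddMonoidHom.toIntLinearMap)
      Ideal.Quotient.mk_surjective
  apply Module.finite_of_fg_torsion
  intro x
  refine ⟨⟨(p : ℤ) ^ d, mem_nonZeroDivisors_of_ne_zero (by have := hp.ne_zero; positivity)⟩, ?_⟩
  show (p : ℤ) ^ d • x = 0
  rw [zsmul_eq_mul]
  have : (((p : ℤ) ^ d : ℤ) : Oring ζ ⧸ Ideal.span {(p : Oring ζ) ^ d}) = 0 := by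
    push_cast
    rw [← map_natCast (Ideal.Quotient.mk (Ideal.span {(p : Oring ζ) ^ d})), ← map_pow, Ideal.Quotient.eq_zero_iff_mem]
    exact Ideal.mem_span_singleton_self _
  rw [this, zero_mul]

theorem adjoin_lam (ζ : ℂ) : Algebra.adjoin ℤ {2 + lamO ζ} = ⊤ := by
  have h := Algebra.adjoin_adjoin_coe_preimage (R := ℤ) (s := ({ζ + ζ⁻¹} : Set ℂ))
  rw [eq_top_iff, ← h]
  apply Algebra.adjoin_le
  intro x hx
  have hx' : x = lamO ζ := Subtype.ext hx
  have h1 : 2 + lamO ζ ∈ Algebra.adjoin ℤ {2 + lamO ζ} := Algebra.subset_adjoin rfl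
  have h2 := Subalgebra.sub_mem _ h1 (ofNat_mem (Algebra.adjoin ℤ {2 + lamO ζ}) 2)
  rw [hx']
  simpa using h2

theorem char_aux {A : Type} [CommRing A] (p : ℕ) (hp : p.Prime) (d : ℕ) (hd : 1 ≤ d) (hpd : (p : A) ^ d = 0) :
    ∀ (k : Type) [Field k] (φ : A →+* k), CharP k p := by
  intro k _ φ
  have h0 : (p : k) = 0 := by
    have := congrArg φ hpd
    rw [map_pow, map_natCast, map_zero] at this
    exact (pow_eq_zero_iff (by omega)).1 this
  obtain ⟨q, hq⟩ := CharP.exists k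
  have hqp : q ∣ p := (CharP.cast_eq_zero_iff k q p).1 h0
  rcases (Nat.dvd_prime hp).1 hqp with h | h
  · exact absurd h (CharP.char_ne_one k q)
  · rwa [h] at hq

theorem final_aux {A : Type} [CommRing A] [Finite A] (l : A) (n : ℕ) (hn : 3 ≤ n)
    (p : ℕ) (hp : p.Prime) (hpodd : Odd p)
    (h1 : ∀ k : ℕ, 1 ≤ k → n ≠ 2 * p ^ k)
    (h2 : ¬(p = 3 ∧ ∃ k : ℕ, n = 5 * 3 ^ k))
    (d : ℕ) (hd : 1 ≤ d) (a m : ℕ) (hnm : n = p ^ a * m) (hpd : (p : A) ^ d = 0)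
    (hgen : Algebra.adjoin ℤ {2 + l} = ⊤)
    (key : ∀ (k : Type) [Field k] (φ : A →+* k), ∃ z : AlgebraicClosure k, IsPrimitiveRoot z m ∧
      z ^ 2 - algebraMap k (AlgebraicClosure k) (φ l) * z + 1 = 0)
    (H : Subgroup SL(2, A)) (hT : eU (2 + l) ∈ H) (hU : -(eL (-1)) ∈ H) : H = ⊤ := by
  have hp2 : p ≠ 2 := by rintro rfl; exact absurd hpodd (by decide)
  have hchar := char_aux p hp d hd hpd
  have hcF : ∀ (k : Type) [Field k] (φ : A →+* k), CharP (AlgebraicClosure k) p := by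
    intro k _ φ
    have := hchar k φ
    exact charP_of_injective_algebraMap (algebraMap k (AlgebraicClosure k)).injective p
  have h2F : ∀ (k : Type) [Field k] (φ : A →+* k), (2 : AlgebraicClosure k) ≠ 0 := by
    intro k _ φ h
    have := hcF k φ
    have h' : ((2 : ℕ) : AlgebraicClosure k) = 0 := by exact_mod_cast h
    rw [CharP.cast_eq_zero_iff _ p] at h'
    exact hp2 ((Nat.prime_dvd_prime_iff_eq hp Nat.prime_two).1 h')
  have hne : ∀ (k : Type) [Field k] (φ : A →+* k), φ l ≠ -2 := by
    intro k _ φ h0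
    obtain ⟨z, hz, hz2⟩ := key k φ
    have h2' := h2F k φ
    rw [h0] at hz2
    simp only [map_neg, map_ofNat] at hz2
    have hz1 : z = -1 := by
      have : (z + 1) ^ 2 = 0 := by linear_combination hz2
      linear_combination (pow_eq_zero_iff (by norm_num)).1 this
    have hdv : m ∣ 2 := hz.dvd_of_pow_eq_one 2 (by rw [hz1]; norm_num)
    rcases (Nat.dvd_prime Nat.prime_two).1 hdv with h | h
    · rw [h] at hz
      have := hz.pow_eq_one
      rw [pow_one, hz1] at this
      apply h2'
      linear_combination -this
    · subst h
      rcases Nat.eq_zero_or_pos a with ha | ha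
      · subst ha; rw [pow_zero] at hnm; omega
      · exact h1 a ha (by rw [hnm]; ring)
  have h2A : IsUnit (2 : A) := by
    by_contra h
    obtain ⟨M, hM, h2M⟩ := exists_max_ideal_of_mem_nonunits h
    let _ := Ideal.Quotient.field M
    apply h2F (A ⧸ M) (Ideal.Quotient.mk M)
    have : (2 : A ⧸ M) = 0 := by
      rw [← map_ofNat (Ideal.Quotient.mk M) 2]; exact Ideal.Quotient.eq_zero_iff_mem.2 h2M
    have := congrArg (algebraMap (A ⧸ M) (AlgebraicClosure (A ⧸ M))) this
    rwa [map_ofNat, map_zero] at this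
  have hμA : IsUnit (2 + l) := by
    by_contra h
    obtain ⟨M, hM, h2M⟩ := exists_max_ideal_of_mem_nonunits h
    let _ := Ideal.Quotient.field M
    apply hne (A ⧸ M) (Ideal.Quotient.mk M)
    have := Ideal.Quotient.eq_zero_iff_mem.2 h2M
    rw [map_add, map_ofNat] at this
    linear_combination this
  have hp3 : ∀ (k : Type) [Field k] (φ : A →+* k), (3 : k) = 0 → p = 3 := by
    intro k _ φ h
    have := hchar k φ
    have h' : ((3 : ℕ) : k) = 0 := by exact_mod_cast h
    rw [CharP.cast_eq_zero_iff _ p] at h'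
    exact (Nat.prime_dvd_prime_iff_eq hp Nat.prime_three).1 h'
  have h3F : ∀ (k : Type) [Field k], (3 : k) = 0 → (3 : AlgebraicClosure k) = 0 := by
    intro k _ h
    have := congrArg (algebraMap k (AlgebraicClosure k)) h
    rwa [map_ofNat, map_zero] at this
  have hex : ∀ (k : Type) [Field k] (φ : A →+* k), Function.Surjective φ →
      ¬ ((3 : k) = 0 ∧ φ (2 + l) ^ 2 = -1) := by
    rintro k _ φ - ⟨h3, he⟩
    have hp3' := hp3 k φ h3
    have h3' := h3F k h3
    have h2' := h2F k φ
    obtain ⟨z, hz, hz2⟩ := key k φ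
    have he' := congrArg (algebraMap k (AlgebraicClosure k)) he
    simp only [map_add, map_pow, map_neg, map_one, map_ofNat] at he'
    set L := algebraMap k (AlgebraicClosure k) (φ l)
    have hL : L ^ 2 + L - 1 = 0 := by linear_combination he' - (L + 2) * h3'
    have h5 : z ^ 4 + z ^ 3 + z ^ 2 + z + 1 = 0 := by
      linear_combination z ^ 2 * hL + (z ^ 2 + L * z + 1 + z) * hz2
    have hdv : m ∣ 5 := hz.dvd_of_pow_eq_one 5 (by linear_combination (z - 1) * h5)
    rcases (Nat.dvd_prime Nat.prime_five).1 hdv with h | h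
    · rw [h] at hz
      have := hz.pow_eq_one
      rw [pow_one] at this
      rw [this] at h5
      apply h2'
      linear_combination h5 - h3'
    · exact h2 ⟨hp3', a, by rw [hnm, h, hp3']; ring⟩
  have hlg : Algebra.adjoin ℤ {l} = ⊤ := by
    rw [eq_top_iff, ← hgen]
    apply Algebra.adjoin_le
    rintro _ rfl
    exact Subalgebra.add_mem _ (ofNat_mem _ 2) (Algebra.subset_adjoin rfl)
  have hgood : Good A := by
    by_cases hc : ∀ (k : Type) [Field k] (φ : A →+* k), Function.Surjective φ → Nat.card k ≠ 3
    · exact Or.inl hc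
    right
    push Not at hc
    obtain ⟨k, _, φ, hφ, hk⟩ := hc
    have hfk : Finite k := Nat.finite_of_card_ne_zero (by omega)
    have _ := Fintype.ofFinite k
    have hk' : Fintype.card k = 3 := by rw [← hk, Nat.card_eq_fintype_card]
    have h3 : (3 : k) = 0 := by
      have := Nat.cast_card_eq_zero k
      rw [hk'] at this
      exact_mod_cast this
    have hp3' := hp3 k φ h3
    have h3' := h3F k h3
    have h2' := h2F k φ
    have hnt : Nontrivial A := φ.domain_nontrivial
    obtain ⟨z, hz, hz2⟩ := key k φ
    have hcube : φ l ^ 3 = φ l := by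
      have := FiniteField.pow_card (φ l)
      rwa [hk'] at this
    have hne' := hne k φ
    have h3A : ∀ M : Ideal A, M.IsMaximal → (3 : A) ∈ M := by
      intro M hM
      have : (3 : A) ^ d = 0 := by rw [hp3'] at hpd; exact_mod_cast hpd
      exact hM.isPrime.mem_of_pow_mem d (by rw [this]; exact M.zero_mem)
    have hcases : φ l = 0 ∨ φ l = 2 := by
      have h : φ l * ((φ l - 2) * (φ l + 2)) = 0 := by linear_combination hcube - φ l * h3
      rcases mul_eq_zero.1 h with h | h
      · exact Or.inl h
      · rcases mul_eq_zero.1 h with h | h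
        · right; linear_combination h
        · exact absurd (by linear_combination h) hne'
    have hall : ∃ c : ℤ, ∀ (k' : Type) [Field k'] (ψ : A →+* k'), ψ l = c := by
      rcases hcases with h | h
      · refine ⟨0, ?_⟩
        rw [h] at hz2
        have hz4 : z ^ 2 = -1 := by
          rw [map_zero] at hz2; linear_combination hz2
        have hm4 : m ∣ 2 ^ 2 := hz.dvd_of_pow_eq_one _ (by norm_num; linear_combination (z ^ 2 - 1) * hz4)
        have hm2 : ¬ m ∣ 2 := by
          intro hd
          have := (hz.pow_eq_one_iff_dvd 2).2 hd
          rw [hz4] at this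
          apply h2'; linear_combination -this
        have hm4' : m = 4 := by
          have := Nat.le_of_dvd (by norm_num) hm4
          interval_cases m <;> revert hm4 hm2 <;> decide
        intro k' _ ψ
        obtain ⟨w, hw, hw2⟩ := key k' ψ
        rw [hm4'] at hw
        have hw4 := hw.pow_eq_one
        have hww : w ^ 2 ≠ 1 := by
          intro h
          have := Nat.le_of_dvd (by norm_num) (hw.dvd_of_pow_eq_one 2 h)
          omega
        have hw5 : w ^ 2 + 1 = 0 := by
          have : (w ^ 2 - 1) * (w ^ 2 + 1) = 0 := by linear_combination hw4
          exact (mul_eq_zero.1 this).resolve_left (sub_ne_zero.2 hww)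
        have hw0 : w ≠ 0 := hw.ne_zero (by norm_num)
        have : algebraMap k' (AlgebraicClosure k') (ψ l) * w = 0 := by linear_combination hw5 - hw2
        have := (mul_eq_zero.1 this).resolve_right hw0
        have := (map_eq_zero _).1 this
        simpa using this
      · refine ⟨2, ?_⟩
        rw [h] at hz2
        rw [map_ofNat] at hz2
        have hz1 : z = 1 := by
          have : (z - 1) ^ 2 = 0 := by linear_combination hz2
          linear_combination (pow_eq_zero_iff (by norm_num)).1 this
        have hm1 : m = 1 := Nat.dvd_one.1 (hz.dvd_of_pow_eq_one 1 (by rw [hz1]; norm_num))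
        intro k' _ ψ
        obtain ⟨w, hw, hw2⟩ := key k' ψ
        rw [hm1] at hw
        have hw1 := hw.pow_eq_one
        rw [pow_one] at hw1
        rw [hw1] at hw2
        apply (algebraMap k' (AlgebraicClosure k')).injective
        rw [map_intCast]
        push_cast
        linear_combination -hw2
    obtain ⟨c, hc⟩ := hall
    refine local_of l hlg c ?_
    intro M hM
    refine ⟨?_, h3A M hM⟩
    let _ := Ideal.Quotient.field M
    have := hc (A ⧸ M) (Ideal.Quotient.mk M)
    rw [← map_intCast (Ideal.Quotient.mk M)] at this
    exact Ideal.Quotient.eq.1 this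
  have hneg : -1 ∈ H := by
    have := H.pow_mem hU (p ^ d)
    rw [(hpodd.pow).neg_pow, eL_pow] at this
    push_cast at this
    rwa [hpd, zero_mul, eL_zero] at this
  have hL : eL 1 ∈ H := by
    have := H.inv_mem (H.mul_mem hneg hU)
    rwa [neg_mul_neg, one_mul, ← eL_neg, neg_neg] at this
  exact ring_thm (Nat.card A) A le_rfl h2A (2 + l) hμA hgen hgood hex H hneg hT hL

theorem surjective_mod_p_pow_d_generic
    (n : ℕ) (hn : 3 ≤ n) (ζ : ℂ) (hζ : IsPrimitiveRoot ζ n)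
    (p : ℕ) (hp : p.Prime) (hpodd : Odd p)
    (h1 : ∀ k : ℕ, 1 ≤ k → n ≠ 2 * p ^ k)
    (h2 : ¬(p = 3 ∧ ∃ k : ℕ, n = 5 * 3 ^ k))
    (d : ℕ) (hd : 1 ≤ d) :
    (Delta ζ).map (SLred ζ (Ideal.span {(p : Oring ζ) ^ d})) = ⊤ := by
  have hfact : Fact p.Prime := ⟨hp⟩
  obtain ⟨a, m, hm, hnm⟩ := Nat.exists_eq_pow_mul_and_not_dvd (n := n) (by omega) p hp.ne_one
  have hfin := finite_quot n hn ζ hζ p hp d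
  set J := Ideal.span {(p : Oring ζ) ^ d} with hJ
  set A := Oring ζ ⧸ J
  set π : Oring ζ →+* A := Ideal.Quotient.mk J with hπ
  have hπs : Function.Surjective π := Ideal.Quotient.mk_surjective
  have hpd : (p : A) ^ d = 0 := by
    rw [← map_natCast π, ← map_pow, Ideal.Quotient.eq_zero_iff_mem]
    exact Ideal.mem_span_singleton_self _
  set l : A := π (lamO ζ) with hl
  have hμe : π (2 + lamO ζ) = 2 + l := by rw [map_add, map_ofNat]
  have hgen : Algebra.adjoin ℤ {2 + l} = ⊤ := by
    rw [← hμe]; exact adjoin_map π hπs _ (adjoin_lam ζ)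
  have hchar := char_aux p hp d hd hpd
  have key : ∀ (k : Type) [Field k] (φ : A →+* k), ∃ z : AlgebraicClosure k, IsPrimitiveRoot z m ∧
      z ^ 2 - algebraMap k (AlgebraicClosure k) (φ l) * z + 1 = 0 := by
    intro k _ φ
    have := hchar k φ
    exact root_ex n hn ζ hζ (φ.comp π) p a m hnm hm
  have hT : eU (2 + l) ∈ (Delta ζ).map (SLred ζ J) := by
    refine ⟨Tmat ζ, Subgroup.subset_closure (by simp), ?_⟩
    rw [← hμe]
    apply sl2_ext
    · exact map_one π
    · rfl
    · exact map_zero π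
    · exact map_one π
  have hU : -(eL (-1)) ∈ (Delta ζ).map (SLred ζ J) := by
    refine ⟨Umat ζ, Subgroup.subset_closure (by simp), ?_⟩
    apply sl2_ext
    · exact (map_neg π 1).trans (by simp)
    · exact (map_zero π).trans (by simp)
    · exact (map_one π).trans (by simp)
    · exact (map_neg π 1).trans (by simp)
  exact final_aux l n hn p hp hpodd h1 h2 d hd a m hnm hpd hgen key _ hT hU

end
end

section
/- Suppose n = 5·3^k for some k ≥ 0. Then there is a unique maximal ideal 𝔭 of O lying over 3, with residue field O/𝔭 ≅ 𝔽₉; the image of Δ under reduction mod 𝔭 is a subgroup of SL₂(O/𝔭) of order 120 (hence of index 6), and for every integer d ≥ 1 the image of Δ under reduction mod 𝔭^d has index exactly 6 in SL₂(O/𝔭^d). -/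
open Matrix
open scoped MatrixGroups

set_option synthInstance.maxHeartbeats 1000000
set_option maxHeartbeats 1000000

noncomputable section

section Lift
variable {A F : Type*} [CommRing A] [Field F]

/-- The underlying matrix. -/
def cm {A : Type*} [CommRing A] (g : SL(2, A)) : Matrix (Fin 2) (Fin 2) A := g.1

lemma cm_mul (g h : SL(2, A)) : cm (g * h) = cm g * cm h := rfl

lemma cm_one : cm (1 : SL(2, A)) = 1 := rfl

lemma det_cm (g : SL(2, A)) : (cm g).det = 1 := g.2

/-- The set of leading terms of level `d` of elements of `Δ`. -/
def LevelSet (f : A →+* F) (w : A) (D : Subgroup SL(2, A)) (d : ℕ) :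
    Set (Matrix (Fin 2) (Fin 2) F) :=
  {x | ∃ δ ∈ D, ∃ Y : Matrix (Fin 2) (Fin 2) A,
    cm δ = 1 + w ^ d • Y ∧ f.mapMatrix Y = x}

variable {f : A →+* F} {w : A} {D : Subgroup SL(2, A)} {d : ℕ}

lemma map_smul_zero (hw : f w = 0) (hd : 1 ≤ d) (Y : Matrix (Fin 2) (Fin 2) A) :
    f.mapMatrix (w ^ d • Y) = 0 := by
  ext i j
  have : d ≠ 0 := by omega
  simp [hw, this]

lemma level_add (hw : f w = 0) (hd : 1 ≤ d) {x y : Matrix (Fin 2) (Fin 2) F}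
    (hx : x ∈ LevelSet f w D d) (hy : y ∈ LevelSet f w D d) : x + y ∈ LevelSet f w D d := by
  obtain ⟨δ, hδ, Y, h, rfl⟩ := hx
  obtain ⟨δ', hδ', Y', h', rfl⟩ := hy
  refine ⟨δ * δ', D.mul_mem hδ hδ', Y + Y' + w ^ d • (Y * Y'), ?_, ?_⟩
  · rw [cm_mul, h, h']
    simp only [add_mul, mul_add, one_mul, mul_one, smul_add, smul_mul_assoc, mul_smul_comm]
    abel
  · rw [map_add, map_add, map_smul_zero hw hd, add_zero]

lemma level_one (hw : f w = 0) (hd : 1 ≤ d) {δ : SL(2, A)} {Y : Matrix (Fin 2) (Fin 2) A}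
    (h : cm δ = 1 + w ^ d • Y) :
    f.mapMatrix (cm δ) = 1 := by
  rw [h, map_add, map_smul_zero hw hd, add_zero, map_one]

lemma coe_mul_inv (δ : SL(2, A)) :
    cm δ * cm (δ⁻¹) = 1 := by
  rw [← cm_mul, mul_inv_cancel, cm_one]

lemma level_one_inv {δ : SL(2, A)}
    (h : f.mapMatrix (cm δ) = 1) :
    f.mapMatrix (cm δ⁻¹) = 1 := by
  have := congrArg f.mapMatrix (coe_mul_inv δ)
  rwa [map_mul, h, one_mul, map_one] at this

lemma level_neg (hw : f w = 0) (hd : 1 ≤ d) {x : Matrix (Fin 2) (Fin 2) F}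
    (hx : x ∈ LevelSet f w D d) : -x ∈ LevelSet f w D d := by
  obtain ⟨δ, hδ, Y, h, rfl⟩ := hx
  refine ⟨δ⁻¹, D.inv_mem hδ, -(Y * cm (δ⁻¹)), ?_, ?_⟩
  · have := coe_mul_inv δ
    rw [h, add_mul, one_mul, smul_mul_assoc] at this
    rw [← this, smul_neg, add_neg_cancel_right]
  · rw [map_neg, map_mul, level_one_inv (level_one hw hd h), mul_one]

lemma level_zero : (0 : Matrix (Fin 2) (Fin 2) F) ∈ LevelSet f w D d :=
  ⟨1, D.one_mem, 0, by simp [cm_one], by simp⟩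

lemma level_conj {γ : SL(2, A)} (hγ : γ ∈ D) {x : Matrix (Fin 2) (Fin 2) F}
    (hx : x ∈ LevelSet f w D d) :
    f.mapMatrix (cm γ) * x *
      f.mapMatrix (cm (γ⁻¹)) ∈ LevelSet f w D d := by
  obtain ⟨δ, hδ, Y, h, rfl⟩ := hx
  refine ⟨γ * δ * γ⁻¹, D.mul_mem (D.mul_mem hγ hδ) (D.inv_mem hγ),
    cm γ * Y * cm (γ⁻¹), ?_, ?_⟩
  · rw [cm_mul, cm_mul, h, mul_add, add_mul, mul_one,
      coe_mul_inv]
    simp only [smul_mul_assoc, mul_smul_comm]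
  · rw [map_mul, map_mul]

lemma level_comm (hw : f w = 0) (hd : 1 ≤ d) {x y : Matrix (Fin 2) (Fin 2) F}
    (hx : x ∈ LevelSet f w D 1) (hy : y ∈ LevelSet f w D d) :
    x * y - y * x ∈ LevelSet f w D (d + 1) := by
  obtain ⟨δ, hδ, X, h, rfl⟩ := hx
  obtain ⟨δ', hδ', Y, h', rfl⟩ := hy
  refine ⟨δ * δ' * (δ' * δ)⁻¹, D.mul_mem (D.mul_mem hδ hδ') (D.inv_mem (D.mul_mem hδ' hδ)),
    (X * Y - Y * X) * cm ((δ' * δ)⁻¹), ?_, ?_⟩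
  · have e1 : cm (δ * δ') =
        cm (δ' * δ) + w ^ (d + 1) • (X * Y - Y * X) := by
      rw [cm_mul, cm_mul, h, h']
      simp only [add_mul, mul_add, one_mul, mul_one, smul_mul_assoc, mul_smul_comm, smul_sub,
        smul_add, smul_smul, pow_succ, pow_zero, mul_comm w]
      abel
    rw [cm_mul, e1, add_mul, coe_mul_inv, smul_mul_assoc]
  · have : f.mapMatrix (cm (δ' * δ)) = 1 := by
      rw [cm_mul, map_mul, level_one hw hd h', level_one hw le_rfl h, one_mul]
    rw [map_mul, level_one_inv this, mul_one, map_sub, map_mul, map_mul]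

/-- `D` has full leading terms at level `d`. -/
def FullLevel (f : A →+* F) (w : A) (D : Subgroup SL(2, A)) (d : ℕ) : Prop :=
  ∀ x : F, !![0, x; 0, 0] ∈ LevelSet f w D d ∧ !![0, 0; x, 0] ∈ LevelSet f w D d ∧
    !![x, 0; 0, -x] ∈ LevelSet f w D d

lemma full_all (hw : f w = 0) (h3 : (3 : F) = 0) (h1 : FullLevel f w D 1) (hd : 1 ≤ d) :
    FullLevel f w D d := by
  induction d, hd using Nat.le_induction with
  | base => exact h1
  | succ d hd ih =>
    intro x
    have h2 : (2 : F) = -1 := by linear_combination h3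
    refine ⟨?_, ?_, ?_⟩
    · have := level_neg hw (by omega) (level_comm hw hd (h1 1).2.2 (ih x).1)
      convert this using 1
      ext i j
      fin_cases i <;> fin_cases j <;> simp
      linear_combination x * h3
    · have := (level_comm hw hd (h1 1).2.2 (ih x).2.1)
      convert this using 1
      ext i j
      fin_cases i <;> fin_cases j <;> simp
      linear_combination x * h3
    · have := (level_comm hw hd (h1 1).1 (ih x).2.1)
      convert this using 1
      ext i j
      fin_cases i <;> fin_cases j <;> simp

lemma full_mem (hw : f w = 0) (hd : 1 ≤ d) (h : FullLevel f w D d)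
    (X : Matrix (Fin 2) (Fin 2) F) (hX : X 0 0 + X 1 1 = 0) : X ∈ LevelSet f w D d := by
  have := level_add hw hd (level_add hw hd (h (X 0 1)).1 (h (X 1 0)).2.1) (h (X 0 0)).2.2
  convert this using 1
  ext i j
  fin_cases i <;> fin_cases j <;> simp
  linear_combination hX

lemma approx [IsDomain A] (hw0 : w ≠ 0) (hker : ∀ a, f a = 0 ↔ w ∣ a) (h3 : (3 : F) = 0)
    (h1 : FullLevel f w D 1) (hd : 1 ≤ d) (M : Matrix (Fin 2) (Fin 2) A)
    (hM : f.mapMatrix M = 1) (hdet : w ^ d ∣ M.det - 1) :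
    ∃ δ ∈ D, ∃ Y : Matrix (Fin 2) (Fin 2) A, M = cm δ + w ^ d • Y := by
  have hw : f w = 0 := (hker w).2 dvd_rfl
  have mkY : ∀ N : Matrix (Fin 2) (Fin 2) A, f.mapMatrix N = 0 →
      ∃ Y : Matrix (Fin 2) (Fin 2) A, N = w • Y := by
    intro N hN
    have : ∀ i j, w ∣ N i j := fun i j => (hker _).1 (by simpa using congrFun (congrFun hN i) j)
    choose Y hY using this
    exact ⟨Matrix.of Y, by ext i j; simp [hY]⟩
  induction d, hd using Nat.le_induction with
  | base =>
    obtain ⟨Y, hY⟩ := mkY (M - 1) (by rw [map_sub, hM, map_one, sub_self])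
    exact ⟨1, D.one_mem, Y, by rw [pow_one, ← hY, cm_one]; simp⟩
  | succ d hd ih =>
    obtain ⟨δ, hδ, Y, hY⟩ := ih ((pow_dvd_pow w (Nat.le_succ d)).trans hdet)
    have hδ1 : f.mapMatrix (cm δ) = 1 := by
      rw [hY, map_add, map_smul_zero hw hd, add_zero] at hM
      exact hM
    set X := cm (δ⁻¹) * Y with hX
    have hMX : M = cm δ * (1 + w ^ d • X) := by
      rw [hX, mul_add, mul_one, mul_smul_comm, ← mul_assoc, coe_mul_inv, one_mul, hY]
    have htr : f (X 0 0 + X 1 1) = 0 := by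
      rw [hker]
      have e : M.det - 1 = w ^ d * (X 0 0 + X 1 1 + w ^ d * X.det) := by
        rw [hMX, det_mul, det_cm, one_mul, det_fin_two, det_fin_two]
        simp
        ring
      rw [e, pow_succ] at hdet
      have := (mul_dvd_mul_iff_left (pow_ne_zero d hw0)).1 hdet
      exact (dvd_add_left (Dvd.dvd.mul_right (dvd_pow_self w (by omega)) _)).1 this
    obtain ⟨ε, hε, Z, hZ, hZX⟩ := full_mem hw hd (full_all hw h3 h1 hd) (f.mapMatrix X)
      (by simpa using htr)
    obtain ⟨W, hW⟩ := mkY (X - Z) (by rw [map_sub, hZX, sub_self])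
    refine ⟨δ * ε, D.mul_mem hδ hε, cm δ * W, ?_⟩
    have hXZ : X = Z + w • W := by rw [← hW]; abel
    rw [hMX, cm_mul, hZ, hXZ]
    simp only [mul_add, mul_one, smul_add, smul_smul, mul_smul_comm, pow_succ]
    abel

end Lift
section Code

/-- Addition of codes of elements of `F₉ = F₃[l]`, `l² = 1 - l`; `x` codes `x % 3 + (x / 3) l`. -/
def cAdd (x y : ℕ) : ℕ := (x % 3 + y % 3) % 3 + 3 * ((x / 3 + y / 3) % 3)

/-- Multiplication by `t = 2 + l`. -/
def cMulT (x : ℕ) : ℕ := (2 * (x % 3) + x / 3) % 3 + 3 * ((x % 3 + x / 3) % 3)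

/-- Negation. -/
def cNeg (x : ℕ) : ℕ := (2 * (x % 3)) % 3 + 3 * ((2 * (x / 3)) % 3)

/-- Code of a matrix. -/
def cEnc (a b c d : ℕ) : ℕ := a + 9 * b + 81 * c + 729 * d

/-- Left multiplication by `T`. -/
def codeT (n : ℕ) : ℕ :=
  cEnc (cAdd (n % 9) (cMulT (n / 81 % 9))) (cAdd (n / 9 % 9) (cMulT (n / 729 % 9)))
    (n / 81 % 9) (n / 729 % 9)

/-- Left multiplication by `U`. -/
def codeU (n : ℕ) : ℕ :=
  cEnc (cNeg (n % 9)) (cNeg (n / 9 % 9)) (cAdd (n % 9) (cNeg (n / 81 % 9)))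
    (cAdd (n / 9 % 9) (cNeg (n / 729 % 9)))

/-- All codes of elements of the group, in order of discovery. -/
def codeList : List ℕ :=
  [730, 775, 1541, 793, 3062, 1606, 811, 4502, 3037, 2314, 1590, 6128, 858, 1460, 4468, 5977,
   3012, 323, 2325, 1523, 2901, 6147, 4846, 881, 3390, 892, 4515, 3185, 5925, 1505, 5043, 315,
   6277, 2285, 2625, 6040, 2859, 3534, 6097, 522, 4809, 944, 4990, 3365, 2559, 1622, 678, 3231,
   5521, 5957, 4074, 2413, 5091, 4227, 319, 6354, 6303, 6074, 5692, 2663, 381, 4601, 2862, 3508,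
   957, 530, 4802, 3469, 4955, 6389, 3337, 2565, 1689, 681, 2814, 3208, 3438, 5529, 2375, 6475,
   4067, 4710, 3125, 5049, 4219, 6015, 6251, 526, 5675, 3419, 2617, 378, 4569, 3563, 5117, 4749,
   3154, 3661, 2807, 4998, 6331, 1669, 2526, 6447, 675, 2770, 2379, 5513, 6422, 4057, 4752, 3102,
   4238, 5108, 3670, 5682, 4558, 384, 5126, 3652]

/-- Boolean membership. -/
def memB (x : ℕ) : List ℕ → Bool
  | [] => false
  | y :: l => (Nat.beq x y) || memB x l

/-- Every entry is obtained from an entry of `seen` or an earlier one. -/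
def genB (seen : List ℕ) : List ℕ → Bool
  | [] => true
  | x :: l => (memB x (seen.map codeT) || memB x (seen.map codeU)) && genB (x :: seen) l

/-- No duplicates, all entries in range. -/
def nodupB : List ℕ → Bool
  | [] => true
  | x :: l => !(memB x l) && Nat.blt x 6561 && nodupB l

/-- Closure of `l` under both operations. -/
def closedB (m : List ℕ) : List ℕ → Bool
  | [] => true
  | x :: l => memB (codeT x) m && memB (codeU x) m && closedB m l

lemma closed_spec : closedB codeList codeList = true := by
  decide +kernel

lemma nodup_spec : nodupB codeList = true := by
  decide +kernel

lemma gen_spec : genB [730] codeList.tail = true := by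
  decide +kernel

lemma memB_iff (x : ℕ) (l : List ℕ) : memB x l = true ↔ x ∈ l := by
  induction l with
  | nil => simp [memB]
  | cons y l ih => simp [memB, ih]

lemma closedB_iff (m l : List ℕ) :
    closedB m l = true ↔ ∀ x ∈ l, codeT x ∈ m ∧ codeU x ∈ m := by
  induction l with
  | nil => simp [closedB]
  | cons y l ih => simp [closedB, ih, memB_iff]

lemma nodupB_iff (l : List ℕ) : nodupB l = true ↔ l.Nodup ∧ ∀ x ∈ l, x < 6561 := by
  induction l with
  | nil => simp [nodupB]
  | cons y l ih =>
    rw [nodupB, Bool.and_eq_true, Bool.and_eq_true, ih, List.nodup_cons, ← memB_iff]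
    have : Nat.blt y 6561 = true ↔ y < 6561 := by
      rw [Nat.blt_eq]
    rw [this]
    simp
    tauto

lemma genB_ind (P : ℕ → Prop) (hT : ∀ x, P x → P (codeT x)) (hU : ∀ x, P x → P (codeU x))
    (l : List ℕ) : ∀ seen : List ℕ, (∀ x ∈ seen, P x) → genB seen l = true → ∀ x ∈ l, P x := by
  induction l with
  | nil => simp
  | cons y l ih =>
    intro seen hs h
    rw [genB, Bool.and_eq_true, Bool.or_eq_true, memB_iff, memB_iff, List.mem_map,
      List.mem_map] at h
    have hy : P y := by
      rcases h.1 with ⟨z, hz, rfl⟩ | ⟨z, hz, rfl⟩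
      · exact hT _ (hs z hz)
      · exact hU _ (hs z hz)
    have := ih (y :: seen) (by simpa using ⟨hy, hs⟩) h.2
    simpa using ⟨hy, this⟩

lemma code_ind (P : ℕ → Prop) (h1 : P 730) (hT : ∀ x, P x → P (codeT x))
    (hU : ∀ x, P x → P (codeU x)) : ∀ x ∈ codeList, P x := by
  have h := genB_ind P hT hU codeList.tail [730] (by simpa using h1) gen_spec
  intro x hx
  have e : codeList = 730 :: codeList.tail := rfl
  rw [e, List.mem_cons] at hx
  rcases hx with rfl | hx
  · exact h1
  · exact h x hx

end Code
section FieldPart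
variable {F : Type*} [Field F]

/-- The value of a code. -/
def cVal (l : F) (x : ℕ) : F := ((x % 3 : ℕ) : F) + ((x / 3 : ℕ) : F) * l

lemma cast_mod3 (h3 : (3 : F) = 0) (x : ℕ) : ((x % 3 : ℕ) : F) = (x : F) := by
  conv_rhs => rw [← Nat.mod_add_div x 3]
  push_cast
  rw [h3]; ring

lemma cVal_mk (h3 : (3 : F) = 0) (l : F) (a b : ℕ) :
    cVal l (a % 3 + 3 * (b % 3)) = a + b * l := by
  have e1 : (a % 3 + 3 * (b % 3)) % 3 = a % 3 := by omega
  have e2 : (a % 3 + 3 * (b % 3)) / 3 = b % 3 := by omega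
  rw [cVal, e1, e2, cast_mod3 h3, cast_mod3 h3]

lemma cVal_add (h3 : (3 : F) = 0) (l : F) (x y : ℕ) :
    cVal l (cAdd x y) = cVal l x + cVal l y := by
  rw [cAdd, cVal_mk h3, cVal, cVal]
  push_cast
  ring

lemma cVal_mulT (h3 : (3 : F) = 0) {l : F} (hl : l ^ 2 + l - 1 = 0) (x : ℕ) :
    cVal l (cMulT x) = (2 + l) * cVal l x := by
  rw [cMulT, cVal_mk h3, cVal]
  push_cast [Nat.cast_add, Nat.cast_mul]
  linear_combination (-((x / 3 : ℕ) : F)) * hl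

lemma cVal_neg (h3 : (3 : F) = 0) (l : F) (x : ℕ) :
    cVal l (cNeg x) = - cVal l x := by
  rw [cNeg, cVal_mk h3, cVal]
  push_cast [Nat.cast_mul]
  linear_combination (((x % 3 : ℕ) : F) + ((x / 3 : ℕ) : F) * l) * h3

lemma cAdd_lt (x y : ℕ) : cAdd x y < 9 := by unfold cAdd; omega

lemma cNeg_lt (x : ℕ) : cNeg x < 9 := by unfold cNeg; omega

/-- The matrix of a code. -/
def cMat (l : F) (n : ℕ) : Matrix (Fin 2) (Fin 2) F :=
  !![cVal l (n % 9), cVal l (n / 9 % 9); cVal l (n / 81 % 9), cVal l (n / 729 % 9)]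

lemma cMat_enc (l : F) {a b c d : ℕ} (ha : a < 9) (hb : b < 9) (hc : c < 9) (hd : d < 9) :
    cMat l (cEnc a b c d) = !![cVal l a, cVal l b; cVal l c, cVal l d] := by
  have e1 : cEnc a b c d % 9 = a := by unfold cEnc; omega
  have e2 : cEnc a b c d / 9 % 9 = b := by unfold cEnc; omega
  have e3 : cEnc a b c d / 81 % 9 = c := by unfold cEnc; omega
  have e4 : cEnc a b c d / 729 % 9 = d := by unfold cEnc; omega
  rw [cMat, e1, e2, e3, e4]

/-- `T` over `F`. -/
def FT (l : F) : SL(2, F) := ⟨!![1, 2 + l; 0, 1], by rw [Matrix.det_fin_two_of]; ring⟩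

/-- `U` over `F`. -/
def FU (F : Type*) [Field F] : SL(2, F) :=
  ⟨!![-1, 0; 1, -1], by rw [Matrix.det_fin_two_of]; ring⟩

lemma cMat_T (h3 : (3 : F) = 0) {l : F} (hl : l ^ 2 + l - 1 = 0) (n : ℕ) :
    cMat l (codeT n) = cm (FT l) * cMat l n := by
  have ec : n / 81 % 9 < 9 := Nat.mod_lt _ (by norm_num)
  have ed : n / 729 % 9 < 9 := Nat.mod_lt _ (by norm_num)
  rw [codeT, cMat_enc l (cAdd_lt _ _) (cAdd_lt _ _) ec ed, cVal_add h3, cVal_add h3,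
    cVal_mulT h3 hl, cVal_mulT h3 hl, cMat, cm, FT, Matrix.mul_fin_two]
  simp

lemma cMat_U (h3 : (3 : F) = 0) (l : F) (n : ℕ) :
    cMat l (codeU n) = cm (FU F) * cMat l n := by
  rw [codeU, cMat_enc l (cNeg_lt _) (cNeg_lt _) (cAdd_lt _ _) (cAdd_lt _ _), cVal_add h3,
    cVal_add h3, cVal_neg h3, cVal_neg h3, cVal_neg h3, cVal_neg h3, cMat, cm, FU,
    Matrix.mul_fin_two]
  simp

lemma indep (h3 : (3 : F) = 0) {l : F} (hl : l ^ 2 + l - 1 = 0) {a b : ℤ}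
    (h : (a : F) + b * l = 0) : (3 : ℤ) ∣ a ∧ (3 : ℤ) ∣ b := by
  have : CharP F 3 := (CharP.charP_iff_prime_eq_zero Nat.prime_three).2 (by exact_mod_cast h3)
  have h0 : ((a ^ 2 - a * b - b ^ 2 : ℤ) : F) = 0 := by
    push_cast
    linear_combination (a - b - b * l : F) * h + (b : F) ^ 2 * hl
  have hd : (3 : ℤ) ∣ a ^ 2 - a * b - b ^ 2 := by
    exact_mod_cast (CharP.intCast_eq_zero_iff F 3 _).1 h0
  have ha : a % 3 = 0 ∨ a % 3 = 1 ∨ a % 3 = 2 := by omega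
  have hb : b % 3 = 0 ∨ b % 3 = 1 ∨ b % 3 = 2 := by omega
  have hd' := Int.emod_eq_zero_of_dvd hd
  rcases ha with ha | ha | ha <;> rcases hb with hb | hb | hb <;>
    simp [pow_two, Int.sub_emod, Int.mul_emod, ha, hb] at hd' <;> omega

lemma cVal_inj (h3 : (3 : F) = 0) {l : F} (hl : l ^ 2 + l - 1 = 0) {x y : ℕ} (hx : x < 9)
    (hy : y < 9) (h : cVal l x = cVal l y) : x = y := by
  have := indep h3 hl (a := ((x % 3 : ℕ) : ℤ) - ((y % 3 : ℕ) : ℤ))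
    (b := ((x / 3 : ℕ) : ℤ) - ((y / 3 : ℕ) : ℤ)) (by
      rw [cVal, cVal] at h
      rw [Int.cast_sub, Int.cast_sub, Int.cast_natCast, Int.cast_natCast, Int.cast_natCast,
        Int.cast_natCast]
      linear_combination h)
  omega

lemma cMat_inj (h3 : (3 : F) = 0) {l : F} (hl : l ^ 2 + l - 1 = 0) {n m : ℕ} (hn : n < 6561)
    (hm : m < 6561) (h : cMat l n = cMat l m) : n = m := by
  have lt9 : ∀ k, k % 9 < 9 := fun k => Nat.mod_lt _ (by norm_num)
  have e1 := cVal_inj h3 hl (lt9 _) (lt9 _) (congrFun (congrFun h 0) 0)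
  have e2 := cVal_inj h3 hl (lt9 _) (lt9 _) (congrFun (congrFun h 0) 1)
  have e3 := cVal_inj h3 hl (lt9 _) (lt9 _) (congrFun (congrFun h 1) 0)
  have e4 := cVal_inj h3 hl (lt9 _) (lt9 _) (congrFun (congrFun h 1) 1)
  omega

lemma cm_inj {A : Type*} [CommRing A] {g h : SL(2, A)} (e : cm g = cm h) : g = h :=
  Subtype.ext e

lemma FT_inv (h3 : (3 : F) = 0) (l : F) : (FT l)⁻¹ = FT l * FT l := by
  rw [inv_eq_iff_mul_eq_one]
  apply cm_inj
  rw [cm_mul, cm_mul, cm_one, cm, FT, Matrix.mul_fin_two, Matrix.mul_fin_two, Matrix.one_fin_two]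
  ext i j
  fin_cases i <;> fin_cases j <;> simp
  linear_combination (2 + l) * h3

lemma FU_inv (h3 : (3 : F) = 0) : (FU F)⁻¹ = FU F * (FU F * (FU F * (FU F * FU F))) := by
  rw [inv_eq_iff_mul_eq_one]
  apply cm_inj
  rw [cm_mul, cm_mul, cm_mul, cm_mul, cm_mul, cm_one, cm, FU]
  simp only [Matrix.mul_fin_two, Matrix.one_fin_two]
  ext i j
  fin_cases i <;> fin_cases j <;> simp
  linear_combination (-2) * h3

lemma cMat_one (l : F) : cMat l 730 = 1 := by
  rw [cMat, Matrix.one_fin_two]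
  norm_num [cVal]

lemma mem_closure_iff_code (h3 : (3 : F) = 0) {l : F} (hl : l ^ 2 + l - 1 = 0) (g : SL(2, F)) :
    g ∈ Subgroup.closure {FT l, FU F} ↔ ∃ n ∈ codeList, cm g = cMat l n := by
  have hcl := (closedB_iff _ _).1 closed_spec
  have hT : FT l ∈ Subgroup.closure {FT l, FU F} := Subgroup.subset_closure (by simp)
  have hU : FU F ∈ Subgroup.closure {FT l, FU F} := Subgroup.subset_closure (by simp)
  constructor
  · intro hg
    have sT : ∀ y : SL(2, F), (∃ n ∈ codeList, cm y = cMat l n) →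
        ∃ n ∈ codeList, cm (FT l * y) = cMat l n := by
      rintro y ⟨n, hn, h⟩
      exact ⟨codeT n, (hcl n hn).1, by rw [cMat_T h3 hl, cm_mul, h]⟩
    have sU : ∀ y : SL(2, F), (∃ n ∈ codeList, cm y = cMat l n) →
        ∃ n ∈ codeList, cm (FU F * y) = cMat l n := by
      rintro y ⟨n, hn, h⟩
      exact ⟨codeU n, (hcl n hn).2, by rw [cMat_U h3, cm_mul, h]⟩
    induction hg using Subgroup.closure_induction_left with
    | one => exact ⟨730, by decide, by rw [cMat_one, cm_one]⟩
    | mul_left x hx y hy ih =>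
      rcases hx with rfl | rfl
      · exact sT _ ih
      · exact sU _ ih
    | inv_mul_cancel x hx y hy ih =>
      rcases hx with rfl | rfl
      · rw [FT_inv h3, mul_assoc]
        exact sT _ (sT _ ih)
      · rw [FU_inv h3]
        simp only [mul_assoc]
        exact sU _ (sU _ (sU _ (sU _ (sU _ ih))))
  · rintro ⟨n, hn, h⟩
    have := code_ind (fun n => ∃ g ∈ Subgroup.closure {FT l, FU F}, cm g = cMat l n)
      ⟨1, Subgroup.one_mem _, by rw [cMat_one, cm_one]⟩
      (by
        rintro x ⟨g, hg, e⟩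
        exact ⟨FT l * g, Subgroup.mul_mem _ hT hg, by rw [cm_mul, e, cMat_T h3 hl]⟩)
      (by
        rintro x ⟨g, hg, e⟩
        exact ⟨FU F * g, Subgroup.mul_mem _ hU hg, by rw [cm_mul, e, cMat_U h3]⟩) n hn
    obtain ⟨g', hg', e⟩ := this
    rwa [cm_inj (h.trans e.symm)]

lemma card_closure (h3 : (3 : F) = 0) {l : F} (hl : l ^ 2 + l - 1 = 0) :
    Nat.card (Subgroup.closure {FT l, FU F}) = 120 := by
  have hnd := (nodupB_iff _).1 nodup_spec
  have h1 : ∀ g : Subgroup.closure {FT l, FU F}, ∃ n : codeList.toFinset, cm g.1 = cMat l n.1 := by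
    intro g
    obtain ⟨n, hn, h⟩ := (mem_closure_iff_code h3 hl g.1).1 g.2
    exact ⟨⟨n, by simpa using hn⟩, h⟩
  choose φ hφ using h1
  have hb : Function.Bijective φ := by
    constructor
    · intro g g' e
      apply Subtype.ext
      apply cm_inj
      rw [hφ, hφ, e]
    · intro n
      have hn : n.1 ∈ codeList := List.mem_toFinset.1 n.2
      obtain ⟨g, hg, e⟩ : ∃ g ∈ Subgroup.closure {FT l, FU F}, cm g = cMat l n.1 :=
        code_ind (fun n => ∃ g ∈ Subgroup.closure {FT l, FU F}, cm g = cMat l n)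
          ⟨1, Subgroup.one_mem _, by rw [cMat_one, cm_one]⟩
          (by
            rintro x ⟨g, hg, e⟩
            exact ⟨FT l * g, Subgroup.mul_mem _ (Subgroup.subset_closure (by simp)) hg,
              by rw [cm_mul, e, cMat_T h3 hl]⟩)
          (by
            rintro x ⟨g, hg, e⟩
            exact ⟨FU F * g, Subgroup.mul_mem _ (Subgroup.subset_closure (by simp)) hg,
              by rw [cm_mul, e, cMat_U h3]⟩) n.1 hn
      refine ⟨⟨g, hg⟩, ?_⟩
      apply Subtype.ext
      refine cMat_inj h3 hl (hnd.2 _ (List.mem_toFinset.1 (φ ⟨g, hg⟩).2)) (hnd.2 _ hn) ?_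
      rw [← hφ, e]
  rw [Nat.card_congr (Equiv.ofBijective φ hb), Nat.card_eq_fintype_card, Fintype.card_coe,
    List.toFinset_card_of_nodup hnd.1]
  rfl

lemma card_SL2 (hF : Nat.card F = 9) : Nat.card SL(2, F) = 720 := by
  have : Finite F := Nat.finite_of_card_ne_zero (by omega)
  have := Fintype.ofFinite F
  have hF' : Fintype.card F = 9 := by rw [← Nat.card_eq_fintype_card, hF]
  have h1 : Nat.card (GL (Fin 2) F) = 5760 := by
    rw [Matrix.card_GL_field]
    simp [Fin.prod_univ_two, hF']
  have hs := Matrix.GeneralLinearGroup.det_surjective (n := Fin 2) (R := F)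
  have hu : Nat.card Fˣ = 8 := by
    rw [Nat.card_units, hF]
  have h2 := (Matrix.GeneralLinearGroup.det : GL (Fin 2) F →* Fˣ).ker.card_mul_index
  rw [Subgroup.index_ker, MonoidHom.range_eq_top.2 hs, Subgroup.card_top, hu, h1] at h2
  have h3 : Nat.card SL(2, F) = Nat.card (Matrix.GeneralLinearGroup.det :
      GL (Fin 2) F →* Fˣ).ker := by
    refine Nat.card_eq_of_bijective (fun g => ⟨Matrix.SpecialLinearGroup.toGL g, ?_⟩) ⟨?_, ?_⟩
    · rw [MonoidHom.mem_ker]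
      ext
      exact g.2
    · intro g h e
      apply Subtype.ext
      exact congrArg (fun x => (x.1 : GL (Fin 2) F).1) e
    · rintro ⟨g, hg⟩
      rw [MonoidHom.mem_ker] at hg
      refine ⟨⟨g.1, congrArg Units.val hg⟩, ?_⟩
      apply Subtype.ext
      apply Units.ext
      rfl
  omega

lemma full_one {A : Type*} [CommRing A] {f : A →+* F} {w : A} {D : Subgroup SL(2, A)}
    (hw : f w = 0) (h3 : (3 : F) = 0) {l : F}
    (hgen : ∀ x : F, ∃ a b : ℕ, x = a + b * l)
    {T U : SL(2, A)} (hT : T ∈ D) (hU : U ∈ D)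
    (hfT : f.mapMatrix (cm T) = !![1, 2 + l; 0, 1])
    (hfT' : f.mapMatrix (cm T⁻¹) = !![1, -(2 + l); 0, 1])
    (hfU : f.mapMatrix (cm U) = !![-1, 0; 1, -1])
    (hfU' : f.mapMatrix (cm U⁻¹) = !![-1, 0; -1, -1])
    {x : F} (hx : x ≠ 0) (hE : !![0, x; 0, 0] ∈ LevelSet f w D 1) : FullLevel f w D 1 := by
  -- closure properties
  have cT : ∀ {a b c d a' b' c' d' : F}, !![a, b; c, d] ∈ LevelSet f w D 1 →
      a' = a + (2 + l) * c → b' = (b + (2 + l) * d) - (2 + l) * (a + (2 + l) * c) → c' = c →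
      d' = d - (2 + l) * c → !![a', b'; c', d'] ∈ LevelSet f w D 1 := by
    intro a b c d a' b' c' d' h e1 e2 e3 e4
    have := level_conj hT h
    rw [hfT, hfT', Matrix.mul_fin_two, Matrix.mul_fin_two] at this
    convert this using 1
    subst e1 e2 e3 e4
    ext i j
    fin_cases i <;> fin_cases j <;> simp <;> ring
  have cU : ∀ {a b c d a' b' c' d' : F}, !![a, b; c, d] ∈ LevelSet f w D 1 →
      a' = a + b → b' = b → c' = -a + c - b + d →
      d' = -b + d → !![a', b'; c', d'] ∈ LevelSet f w D 1 := by
    intro a b c d a' b' c' d' h e1 e2 e3 e4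
    have := level_conj hU h
    rw [hfU, hfU', Matrix.mul_fin_two, Matrix.mul_fin_two] at this
    convert this using 1
    subst e1 e2 e3 e4
    ext i j
    fin_cases i <;> fin_cases j <;> simp <;> ring
  have cadd : ∀ {a b c d a' b' c' d' a'' b'' c'' d'' : F}, !![a, b; c, d] ∈ LevelSet f w D 1 →
      !![a', b'; c', d'] ∈ LevelSet f w D 1 → a'' = a + a' → b'' = b + b' → c'' = c + c' →
      d'' = d + d' → !![a'', b''; c'', d''] ∈ LevelSet f w D 1 := by
    intro a b c d a' b' c' d' a'' b'' c'' d'' h h' e1 e2 e3 e4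
    have := level_add hw le_rfl h h'
    subst e1 e2 e3 e4
    convert this using 1
    ext i j
    fin_cases i <;> fin_cases j <;> simp
  have cneg : ∀ {a b c d a' b' c' d' : F}, !![a, b; c, d] ∈ LevelSet f w D 1 →
      a' = -a → b' = -b → c' = -c → d' = -d → !![a', b'; c', d'] ∈ LevelSet f w D 1 := by
    intro a b c d a' b' c' d' h e1 e2 e3 e4
    have := level_neg hw le_rfl h
    subst e1 e2 e3 e4
    convert this using 1
    ext i j
    fin_cases i <;> fin_cases j <;> simp
  -- from `x E` to the other two
  have step1 : ∀ y : F, !![0, y; 0, 0] ∈ LevelSet f w D 1 →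
      !![0, 0; y, 0] ∈ LevelSet f w D 1 ∧ !![y, 0; 0, -y] ∈ LevelSet f w D 1 := by
    intro y hy
    have h1 : !![y, y; -y, -y] ∈ LevelSet f w D 1 := cU hy (by ring) rfl (by ring) (by ring)
    have h2 : !![y, 0; -y, -y] ∈ LevelSet f w D 1 :=
      cadd h1 (cneg hy rfl rfl rfl rfl) (by ring) (by ring) (by ring) (by ring)
    have h3' : !![y, 0; 0, -y] ∈ LevelSet f w D 1 :=
      cU h2 (by ring) rfl (by linear_combination y * h3) (by ring)
    refine ⟨?_, h3'⟩
    exact cadd h3' (cneg h2 rfl rfl rfl rfl) (by ring) (by ring) (by ring) (by ring)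
  have step2 : ∀ y : F, !![0, y; 0, 0] ∈ LevelSet f w D 1 →
      !![0, (2 + l) * y; 0, 0] ∈ LevelSet f w D 1 := by
    intro y hy
    have hH := (step1 y hy).2
    have h1 : !![y, (2 + l) * y; 0, -y] ∈ LevelSet f w D 1 :=
      cT hH (by ring) (by linear_combination ((2 + l) * y) * h3) rfl (by ring)
    exact cadd h1 (cneg hH rfl rfl rfl rfl) (by ring) (by ring) (by ring) (by ring)
  have stepl : ∀ y : F, !![0, y; 0, 0] ∈ LevelSet f w D 1 →
      !![0, l * y; 0, 0] ∈ LevelSet f w D 1 := by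
    intro y hy
    exact cadd (step2 y hy) hy (by ring) (by linear_combination (-y) * h3) (by ring) (by ring)
  have stepn : ∀ (n : ℕ) (y : F), !![0, y; 0, 0] ∈ LevelSet f w D 1 →
      !![0, n * y; 0, 0] ∈ LevelSet f w D 1 := by
    intro n y hy
    induction n with
    | zero =>
      convert (level_zero : (0 : Matrix (Fin 2) (Fin 2) F) ∈ LevelSet f w D 1) using 1
      ext i j
      fin_cases i <;> fin_cases j <;> simp
    | succ n ih =>
      exact cadd ih hy (by ring) (by push_cast; ring) (by ring) (by ring)
  have all : ∀ y : F, !![0, y; 0, 0] ∈ LevelSet f w D 1 := by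
    intro y
    obtain ⟨a, b, hab⟩ := hgen (y / x)
    have e : y = a * x + b * (l * x) := by
      field_simp at hab
      linear_combination hab
    exact cadd (stepn a x hE) (stepn b _ (stepl x hE)) (by ring) e (by ring) (by ring)
  intro y
  exact ⟨all y, step1 y (all y)⟩

lemma full_one_of_lower {A : Type*} [CommRing A] {f : A →+* F} {w : A} {D : Subgroup SL(2, A)}
    (hw : f w = 0) (h3 : (3 : F) = 0) {l : F} (hl : l ^ 2 + l - 1 = 0)
    (hgen : ∀ x : F, ∃ a b : ℕ, x = a + b * l)
    {T U : SL(2, A)} (hT : T ∈ D) (hU : U ∈ D)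
    (hfT : f.mapMatrix (cm T) = !![1, 2 + l; 0, 1])
    (hfT' : f.mapMatrix (cm T⁻¹) = !![1, -(2 + l); 0, 1])
    (hfU : f.mapMatrix (cm U) = !![-1, 0; 1, -1])
    (hfU' : f.mapMatrix (cm U⁻¹) = !![-1, 0; -1, -1])
    {a b c d : F} (hc : c ≠ 0) (hX : !![a, b; c, d] ∈ LevelSet f w D 1) :
    FullLevel f w D 1 := by
  have key : ∀ {X : Matrix (Fin 2) (Fin 2) F}, X ∈ LevelSet f w D 1 →
      !![1, 2 + l; 0, 1] * X * !![1, -(2 + l); 0, 1] + -X ∈ LevelSet f w D 1 := by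
    intro X h
    have := level_conj hT h
    rw [hfT, hfT'] at this
    exact level_add hw le_rfl this (level_neg hw le_rfl h)
  refine full_one hw h3 hgen hT hU hfT hfT' hfU hfU' (x := -c) (neg_ne_zero.2 hc) ?_
  convert key (key hX) using 1
  ext i j
  fin_cases i <;> fin_cases j <;> simp
  · linear_combination (2 * c) * hl + (3 * c + 2 * c * l) * h3

end FieldPart
section IndexPart

lemma index_lift {A : Type*} [CommRing A] [IsDomain A] (p : Ideal A) {F : Type*} [Field F]
    (f : A →+* F) (hf : RingHom.ker f = p) (w : A) (hp : p = Ideal.span {w})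
    (hw0 : w ≠ 0) (h3 : (3 : F) = 0) (D : Subgroup SL(2, A)) (h1 : FullLevel f w D 1)
    {d : ℕ} (hd : 1 ≤ d) :
    (D.map (Matrix.SpecialLinearGroup.map (Ideal.Quotient.mk (p ^ d)))).index =
      (D.map (Matrix.SpecialLinearGroup.map (Ideal.Quotient.mk p))).index := by
  have hle : p ^ d ≤ p := Ideal.pow_le_self (by omega)
  have hkf : ∀ a, f a = 0 ↔ w ∣ a := fun a => by
    rw [← RingHom.mem_ker, hf, hp, Ideal.mem_span_singleton]
  have hpd : p ^ d = Ideal.span {w ^ d} := by rw [hp, Ideal.span_singleton_pow]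
  let q : A ⧸ p ^ d →+* A ⧸ p := Ideal.Quotient.factor hle
  let r : SL(2, A ⧸ p ^ d) →* SL(2, A ⧸ p) := Matrix.SpecialLinearGroup.map q
  have hq : ∀ a, q (Ideal.Quotient.mk (p ^ d) a) = Ideal.Quotient.mk p a :=
    fun a => Ideal.Quotient.factor_mk hle a
  have hr : r.comp (Matrix.SpecialLinearGroup.map (Ideal.Quotient.mk (p ^ d))) =
      Matrix.SpecialLinearGroup.map (Ideal.Quotient.mk p) := by
    ext g i j
    exact hq _
  have hqs : Function.Surjective q := Ideal.Quotient.factor_surjective hle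
  have hunit : ∀ u, q u = 1 → IsUnit u := by
    intro u hu
    obtain ⟨a, rfl⟩ := Ideal.Quotient.mk_surjective u
    rw [hq] at hu
    have ha : a - 1 ∈ p := by rw [← Ideal.Quotient.eq, hu, map_one]
    have hn : IsNilpotent (Ideal.Quotient.mk (p ^ d) (a - 1)) :=
      ⟨d, by rw [← map_pow]; exact Ideal.Quotient.eq_zero_iff_mem.2 (Ideal.pow_mem_pow ha d)⟩
    have := hn.isUnit_one_add
    rw [map_sub, map_one] at this
    simpa using this
  have hrs : Function.Surjective r := by
    intro g
    obtain ⟨a, ha⟩ := hqs (g.1 0 0)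
    obtain ⟨b, hb⟩ := hqs (g.1 0 1)
    obtain ⟨c, hc⟩ := hqs (g.1 1 0)
    obtain ⟨e, he⟩ := hqs (g.1 1 1)
    have hg : g.1 0 0 * g.1 1 1 - g.1 0 1 * g.1 1 0 = 1 := by
      rw [← Matrix.det_fin_two]; exact g.2
    have hu1 : q (a * e - b * c) = 1 := by
      rw [map_sub, map_mul, map_mul, ha, hb, hc, he, hg]
    obtain ⟨v, hv⟩ := (hunit _ hu1).exists_left_inv
    have hqv : q v = 1 := by
      have := congrArg q hv
      rwa [map_mul, hu1, mul_one, map_one] at this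
    refine ⟨⟨!![a * v, b; c * v, e], ?_⟩, ?_⟩
    · rw [Matrix.det_fin_two_of]
      linear_combination hv
    · apply cm_inj
      ext i j
      fin_cases i <;> fin_cases j
      · show q (a * v) = g.1 0 0
        rw [map_mul, hqv, ha, mul_one]
      · exact hb
      · show q (c * v) = g.1 1 0
        rw [map_mul, hqv, hc, mul_one]
      · exact he
  have hker : r.ker ≤ D.map (Matrix.SpecialLinearGroup.map (Ideal.Quotient.mk (p ^ d))) := by
    intro g hg
    rw [MonoidHom.mem_ker] at hg
    have : ∀ i j, ∃ a : A, Ideal.Quotient.mk (p ^ d) a = cm g i j :=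
      fun i j => Ideal.Quotient.mk_surjective _
    choose m hm using this
    let M : Matrix (Fin 2) (Fin 2) A := Matrix.of m
    have hM1 : f.mapMatrix M = 1 := by
      have key : ∀ i j, f (m i j - (1 : Matrix (Fin 2) (Fin 2) A) i j) = 0 := by
        intro i j
        rw [← RingHom.mem_ker, hf, ← Ideal.Quotient.eq, ← hq, hm]
        have h2 : q (cm g i j) = (1 : Matrix (Fin 2) (Fin 2) (A ⧸ p)) i j :=
          congrFun (congrFun (congrArg cm hg) i) j
        rw [h2, Matrix.one_apply, Matrix.one_apply]
        split_ifs <;> simp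
      ext i j
      have := key i j
      rw [map_sub, sub_eq_zero] at this
      change f (m i j) = _
      rw [this, Matrix.one_apply, Matrix.one_apply]
      split_ifs <;> simp
    have hMg : (Ideal.Quotient.mk (p ^ d)).mapMatrix M = cm g := by
      ext i j
      exact hm i j
    have hdet : w ^ d ∣ M.det - 1 := by
      rw [← Ideal.mem_span_singleton, ← hpd, ← Ideal.Quotient.eq, RingHom.map_det, hMg, map_one,
        det_cm]
    obtain ⟨δ, hδ, Y, hY⟩ := approx hw0 hkf h3 h1 hd M hM1 hdet
    refine ⟨δ, hδ, ?_⟩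
    apply cm_inj
    rw [← hMg, hY]
    ext i j
    change Ideal.Quotient.mk (p ^ d) (cm δ i j) =
      Ideal.Quotient.mk (p ^ d) (cm δ i j + w ^ d * Y i j)
    rw [Ideal.Quotient.eq, hpd, Ideal.mem_span_singleton]
    exact ⟨-Y i j, by ring⟩
  rw [← hr, ← Subgroup.map_map, ← Subgroup.index_comap_of_surjective _ hrs,
    Subgroup.comap_map_eq_self hker]

end IndexPart
section NumberPart

/-- `ζ^(3^j) + ζ^(-3^j)` as an element of `O`. -/
def eSeq (ζ : ℂ) : ℕ → Oring ζ
  | 0 => lamO ζ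
  | j + 1 => eSeq ζ j ^ 3 - 3 * eSeq ζ j

lemma eSeq_coe (ζ : ℂ) (h0 : ζ ≠ 0) (j : ℕ) :
    ((eSeq ζ j : Oring ζ) : ℂ) = ζ ^ (3 ^ j) + (ζ ^ (3 ^ j))⁻¹ := by
  induction j with
  | zero => simp [eSeq, lamO]
  | succ j ih =>
    have hz : ζ ^ (3 ^ j) ≠ 0 := pow_ne_zero _ h0
    have e : ((eSeq ζ (j + 1) : Oring ζ) : ℂ) =
        ((eSeq ζ j : Oring ζ) : ℂ) ^ 3 - 3 * ((eSeq ζ j : Oring ζ) : ℂ) := by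
      rw [eSeq]; push_cast; rfl
    rw [e, ih, pow_succ 3 j, pow_mul]
    generalize ζ ^ (3 ^ j) = y at hz
    field_simp
    ring

lemma fifth_eq {y : ℂ} (hy : y ≠ 0) :
    (y + y⁻¹) ^ 2 + (y + y⁻¹) - 1 = 0 ↔ 1 + y + y ^ 2 + y ^ 3 + y ^ 4 = 0 := by
  have : (y + y⁻¹) ^ 2 + (y + y⁻¹) - 1 = (1 + y + y ^ 2 + y ^ 3 + y ^ 4) * (y⁻¹) ^ 2 := by
    field_simp
    ring
  rw [this, mul_eq_zero]
  simp [hy]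

lemma eSeq_quad_iff (ζ : ℂ) (h0 : ζ ≠ 0) (j : ℕ) :
    eSeq ζ j ^ 2 + eSeq ζ j - 1 = 0 ↔
      1 + ζ ^ 3 ^ j + (ζ ^ 3 ^ j) ^ 2 + (ζ ^ 3 ^ j) ^ 3 + (ζ ^ 3 ^ j) ^ 4 = 0 := by
  rw [← fifth_eq (pow_ne_zero _ h0), ← eSeq_coe ζ h0, Subtype.ext_iff]
  push_cast
  rfl

lemma eSeq_quad {n k : ℕ} (hn : n = 5 * 3 ^ k) {ζ : ℂ} (hζ : IsPrimitiveRoot ζ n) :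
    eSeq ζ k ^ 2 + eSeq ζ k - 1 = 0 := by
  have hn0 : 0 < n := by rw [hn]; positivity
  rw [eSeq_quad_iff ζ (hζ.ne_zero hn0.ne')]
  have h5 : IsPrimitiveRoot (ζ ^ 3 ^ k) 5 := hζ.pow hn0 (by rw [hn]; ring)
  have := h5.geom_sum_eq_zero (by norm_num)
  simpa [Finset.sum_range_succ] using this

lemma eSeq_quad_ne {n k : ℕ} (hn : n = 5 * 3 ^ (k + 1)) {ζ : ℂ} (hζ : IsPrimitiveRoot ζ n) :
    eSeq ζ k ^ 2 + eSeq ζ k - 1 ≠ 0 := by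
  have hn0 : 0 < n := by rw [hn]; positivity
  rw [Ne, eSeq_quad_iff ζ (hζ.ne_zero hn0.ne')]
  intro h
  have h1 : ζ ^ (5 * 3 ^ k) = 1 := by
    rw [mul_comm, pow_mul]
    linear_combination (ζ ^ 3 ^ k - 1) * h
  have h2 := Nat.le_of_dvd (Nat.mul_pos (by norm_num) (pow_pos (by norm_num) k)) (hζ.dvd_of_pow_eq_one _ h1)
  rw [hn, pow_succ] at h2
  have : 0 < 3 ^ k := by positivity
  omega

lemma eSeq_dvd (ζ : ℂ) (j : ℕ) :
    lamO ζ ^ 2 + lamO ζ - 1 ∣ eSeq ζ j ^ 2 + eSeq ζ j - 1 := by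
  induction j with
  | zero => exact dvd_rfl
  | succ j ih =>
    refine ih.trans ⟨eSeq ζ j ^ 4 - eSeq ζ j ^ 3 - 4 * eSeq ζ j ^ 2 + 4 * eSeq ζ j + 1, ?_⟩
    rw [eSeq]
    ring

lemma pi_dvd_three {n k : ℕ} (hn : n = 5 * 3 ^ (k + 1)) {ζ : ℂ} (hζ : IsPrimitiveRoot ζ n) :
    lamO ζ ^ 2 + lamO ζ - 1 ∣ 3 := by
  have h1 := eSeq_quad hn hζ
  have h2 := eSeq_quad_ne hn hζ
  obtain ⟨c, hc⟩ := eSeq_dvd ζ k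
  rw [eSeq] at h1
  generalize eSeq ζ k = v at *
  have h3 : v ^ 4 - v ^ 3 - 4 * v ^ 2 + 4 * v + 1 = 0 := by
    refine (mul_eq_zero.1 (?_ : (v ^ 2 + v - 1) * _ = 0)).resolve_left h2
    linear_combination h1
  refine ⟨c * (v ^ 2 - 2 * v - 1) * (v ^ 3 - v ^ 2 - 4 * v + 4), ?_⟩
  linear_combination (3 - (v ^ 3 - v ^ 2 - 4 * v + 4)) * h3 +
    (v ^ 2 - 2 * v - 1) * (v ^ 3 - v ^ 2 - 4 * v + 4) * hc

lemma quad_mem {n k : ℕ} (hn : n = 5 * 3 ^ k) {ζ : ℂ} (hζ : IsPrimitiveRoot ζ n)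
    {F : Type*} [Field F] (f : Oring ζ →+* F) (h3 : (3 : F) = 0) :
    f (lamO ζ) ^ 2 + f (lamO ζ) - 1 = 0 := by
  have key : ∀ j, f (eSeq ζ j) ^ 2 + f (eSeq ζ j) - 1 = 0 →
      f (lamO ζ) ^ 2 + f (lamO ζ) - 1 = 0 := by
    intro j
    induction j with
    | zero => exact id
    | succ j ih =>
      intro h
      apply ih
      rw [eSeq, map_sub, map_pow, map_mul, map_ofNat] at h
      generalize f (eSeq ζ j) = x at *
      rw [h3, zero_mul, sub_zero] at h
      have : (x ^ 2 + x - 1) ^ 3 = 0 := by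
        linear_combination h + (x ^ 5 - 2 * x ^ 3 + x) * h3
      exact pow_eq_zero_iff (by norm_num) |>.1 this
  apply key k
  have := congrArg f (eSeq_quad hn hζ)
  simpa using this

lemma gen_hom (ζ : ℂ) {Q : Type*} [CommRing Q] (g : Oring ζ →+* Q)
    (hq : g (lamO ζ) ^ 2 + g (lamO ζ) - 1 = 0) (x : Oring ζ) :
    ∃ a b : ℤ, g x = a + b * g (lamO ζ) := by
  obtain ⟨x, hx⟩ := x
  induction hx using Algebra.adjoin_induction with
  | mem y hy =>
    refine ⟨0, 1, ?_⟩
    have : (⟨y, Algebra.subset_adjoin hy⟩ : Oring ζ) = lamO ζ := Subtype.ext hy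
    rw [this]; simp
  | algebraMap r =>
    refine ⟨r, 0, ?_⟩
    have : (⟨algebraMap ℤ ℂ r, Subalgebra.algebraMap_mem _ r⟩ : Oring ζ) = (r : Oring ζ) :=
      Subtype.ext (by simp)
    rw [this]; simp
  | add y z hy hz h1 h2 =>
    obtain ⟨a, b, h1⟩ := h1
    obtain ⟨c, d, h2⟩ := h2
    refine ⟨a + c, b + d, ?_⟩
    have : (⟨y + z, add_mem hy hz⟩ : Oring ζ) = ⟨y, hy⟩ + ⟨z, hz⟩ := rfl
    rw [this, map_add, h1, h2]
    push_cast
    ring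
  | mul y z hy hz h1 h2 =>
    obtain ⟨a, b, h1⟩ := h1
    obtain ⟨c, d, h2⟩ := h2
    refine ⟨a * c + b * d, a * d + b * c - b * d, ?_⟩
    have : (⟨y * z, mul_mem hy hz⟩ : Oring ζ) = ⟨y, hy⟩ * ⟨z, hz⟩ := rfl
    rw [this, map_mul, h1, h2]
    push_cast
    linear_combination ((b : Q) * d) * hq

lemma three_not_unit {n : ℕ} (hn : 0 < n) {ζ : ℂ} (hζ : IsPrimitiveRoot ζ n) :
    ¬ IsUnit (3 : Oring ζ) := by
  intro h
  obtain ⟨y, hy⟩ := h.exists_left_inv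
  have hint : Oring ζ ≤ integralClosure ℤ ℂ := by
    apply Algebra.adjoin_le
    rintro _ rfl
    exact (hζ.isIntegral hn).add (hζ.inv.isIntegral hn)
  have h1 : IsIntegral ℤ (y : ℂ) := hint y.2
  have h2 : (y : ℂ) = algebraMap ℚ ℂ (1 / 3) := by
    have := congrArg (Subtype.val) hy
    push_cast at this
    have h' : (y : ℂ) * 3 = 1 := this
    rw [map_div₀, map_one, map_ofNat]
    linear_combination h' / 3
  rw [h2, isIntegral_algebraMap_iff (algebraMap ℚ ℂ).injective] at h1
  obtain ⟨z, hz⟩ := IsIntegrallyClosed.isIntegral_iff.1 h1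
  have hz' : (z : ℚ) = 1 / 3 := by simpa using hz
  have : (3 * z : ℚ) = 1 := by rw [hz']; norm_num
  have : 3 * z = 1 := by exact_mod_cast this
  omega

lemma eq_span {n k : ℕ} (hn : n = 5 * 3 ^ k) {ζ : ℂ} (hζ : IsPrimitiveRoot ζ n)
    (p : Ideal (Oring ζ)) (hp : p.IsMaximal) (h3 : (3 : Oring ζ) ∈ p) :
    p = Ideal.span {3, lamO ζ ^ 2 + lamO ζ - 1} := by
  let _ := Ideal.Quotient.field p
  have h3' : (3 : Oring ζ ⧸ p) = 0 := by
    have := Ideal.Quotient.eq_zero_iff_mem.2 h3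
    rwa [map_ofNat] at this
  have hl := quad_mem hn hζ (Ideal.Quotient.mk p) h3'
  set I : Ideal (Oring ζ) := Ideal.span {3, lamO ζ ^ 2 + lamO ζ - 1} with hI
  have hIp : I ≤ p := by
    rw [hI, Ideal.span_le]
    rintro x (rfl | rfl)
    · exact h3
    · rw [SetLike.mem_coe, ← Ideal.Quotient.eq_zero_iff_mem, map_sub, map_add, map_pow, map_one]
      exact hl
  apply le_antisymm _ hIp
  intro x hx
  have hq : Ideal.Quotient.mk I (lamO ζ) ^ 2 + Ideal.Quotient.mk I (lamO ζ) - 1 = 0 := by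
    rw [← map_pow, ← map_add, ← map_one (Ideal.Quotient.mk I), ← map_sub,
      Ideal.Quotient.eq_zero_iff_mem]
    exact Ideal.subset_span (by simp)
  have h3I : (3 : Oring ζ ⧸ I) = 0 := by
    have := Ideal.Quotient.eq_zero_iff_mem.2 (Ideal.subset_span (by simp) : (3 : Oring ζ) ∈ I)
    rwa [map_ofNat] at this
  obtain ⟨a, b, hab⟩ := gen_hom ζ (Ideal.Quotient.mk I) hq x
  have e : x - (a + b * lamO ζ) ∈ I := by
    rw [← Ideal.Quotient.eq, hab]; simp
  have e2 := Ideal.Quotient.eq.2 (hIp e)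
  rw [Ideal.Quotient.eq_zero_iff_mem.2 hx] at e2
  obtain ⟨⟨a', ha⟩, ⟨b', hb⟩⟩ := indep h3' hl (a := a) (b := b) (by simpa using e2.symm)
  rw [← Ideal.Quotient.eq_zero_iff_mem, hab, ha, hb]
  push_cast
  rw [h3I]; ring

lemma nat_gen {n k : ℕ} (hn : n = 5 * 3 ^ k) {ζ : ℂ} (hζ : IsPrimitiveRoot ζ n)
    {F : Type*} [Field F] (f : Oring ζ →+* F) (hf : Function.Surjective f) (h3 : (3 : F) = 0)
    (x : F) : ∃ a b : ℕ, x = a + b * f (lamO ζ) := by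
  obtain ⟨x, rfl⟩ := hf x
  obtain ⟨a, b, h⟩ := gen_hom ζ f (quad_mem hn hζ f h3) x
  have key : ∀ a : ℤ, ∃ m : ℕ, (a : F) = m := by
    intro a
    refine ⟨(a % 3).toNat, ?_⟩
    have e : a = ((a % 3).toNat : ℤ) + 3 * (a / 3) := by omega
    have := congrArg (Int.cast : ℤ → F) e
    push_cast at this
    rw [this, h3]
    ring
  obtain ⟨m, hm⟩ := key a
  obtain ⟨m', hm'⟩ := key b
  exact ⟨m, m', by rw [h, hm, hm']⟩

lemma card_nine {F : Type*} [Field F] {l : F} (h3 : (3 : F) = 0) (hl : l ^ 2 + l - 1 = 0)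
    (hgen : ∀ x : F, ∃ a b : ℕ, x = a + b * l) : Nat.card F = 9 := by
  have : Function.Bijective (fun x : Fin 9 => cVal l x.1) := by
    constructor
    · intro x y h
      exact Fin.ext (cVal_inj h3 hl x.2 y.2 h)
    · intro x
      obtain ⟨a, b, rfl⟩ := hgen x
      exact ⟨⟨a % 3 + 3 * (b % 3), by omega⟩, cVal_mk h3 l a b⟩
  rw [← Nat.card_eq_of_bijective _ this]
  simp

lemma T_mem (ζ : ℂ) : Tmat ζ ∈ Delta ζ := Subgroup.subset_closure (by simp)

lemma U_mem (ζ : ℂ) : Umat ζ ∈ Delta ζ := Subgroup.subset_closure (by simp)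

lemma cm_T (ζ : ℂ) : cm (Tmat ζ) = !![1, 2 + lamO ζ; 0, 1] := rfl

lemma cm_U (ζ : ℂ) : cm (Umat ζ) = !![-1, 0; 1, -1] := rfl

lemma cm_T_inv (ζ : ℂ) : cm (Tmat ζ)⁻¹ = !![1, -(2 + lamO ζ); 0, 1] := by
  have : cm (Tmat ζ)⁻¹ = (cm (Tmat ζ)).adjugate := rfl
  rw [this, cm_T, Matrix.adjugate_fin_two_of]
  simp

lemma cm_U_inv (ζ : ℂ) : cm (Umat ζ)⁻¹ = !![-1, 0; -1, -1] := by
  have : cm (Umat ζ)⁻¹ = (cm (Umat ζ)).adjugate := rfl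
  rw [this, cm_U, Matrix.adjugate_fin_two_of]
  simp

lemma map_two {A B : Type*} [CommRing A] [CommRing B] (f : A →+* B) (a b c d : A) :
    f.mapMatrix !![a, b; c, d] = !![f a, f b; f c, f d] := by
  ext i j
  fin_cases i <;> fin_cases j <;> rfl

/-- The uniformizer and level one fullness. -/
lemma exists_unif {n k : ℕ} (hn : n = 5 * 3 ^ k) {ζ : ℂ} (hζ : IsPrimitiveRoot ζ n)
    (p : Ideal (Oring ζ)) (hp : p.IsMaximal) (hp3 : (3 : Oring ζ) ∈ p)
    {F : Type*} [Field F] (f : Oring ζ →+* F) (hf : Function.Surjective f)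
    (hker : RingHom.ker f = p) (h3 : (3 : F) = 0) :
    ∃ w : Oring ζ, w ≠ 0 ∧ p = Ideal.span {w} ∧ FullLevel f w (Delta ζ) 1 := by
  have hl := quad_mem hn hζ f h3
  have hgen := nat_gen hn hζ f hf h3
  have hspan := eq_span hn hζ p hp hp3
  have h30 : (3 : Oring ζ) ≠ 0 := by
    intro h
    have := congrArg Subtype.val h
    push_cast at this
    exact three_ne_zero (this : (3 : ℂ) = 0)
  have f2 : f 2 = 2 := map_ofNat f 2
  have fT : f.mapMatrix (cm (Tmat ζ)) = !![1, 2 + f (lamO ζ); 0, 1] := by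
    rw [cm_T, map_two]; simp [f2]
  have fT' : f.mapMatrix (cm (Tmat ζ)⁻¹) = !![1, -(2 + f (lamO ζ)); 0, 1] := by
    rw [cm_T_inv, map_two]; simp [f2]
  have fU : f.mapMatrix (cm (Umat ζ)) = !![-1, 0; 1, -1] := by
    rw [cm_U, map_two]; simp
  have fU' : f.mapMatrix (cm (Umat ζ)⁻¹) = !![-1, 0; -1, -1] := by
    rw [cm_U_inv, map_two]; simp
  rcases k with _ | k
  · have h0 : lamO ζ ^ 2 + lamO ζ - 1 = 0 := eSeq_quad hn hζ
    have ht : 2 + f (lamO ζ) ≠ 0 := by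
      intro h
      have : (1 : F) = 0 := by
        linear_combination hl - (f (lamO ζ) - 1) * h
      exact one_ne_zero this
    refine ⟨3, h30, ?_, ?_⟩
    · rw [hspan, h0, Set.pair_comm, Ideal.span_insert_zero]
    · refine full_one (by rw [map_ofNat, h3]) h3 hgen (T_mem ζ) (U_mem ζ) fT fT' fU fU' ht ?_
      refine ⟨Tmat ζ * (Tmat ζ * Tmat ζ), mul_mem (T_mem ζ) (mul_mem (T_mem ζ) (T_mem ζ)),
        !![0, 2 + lamO ζ; 0, 0], ?_, ?_⟩
      · rw [cm_mul, cm_mul, cm_T]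
        ext1 i j
        fin_cases i <;> fin_cases j <;> simp <;> ring
      · rw [map_two]; simp [f2]
  · have hd := pi_dvd_three hn hζ
    have hl0 : f (lamO ζ) ≠ 0 := by
      intro h
      rw [h] at hl
      simp at hl
    refine ⟨lamO ζ ^ 2 + lamO ζ - 1, fun h => h30 (by rw [h] at hd; exact zero_dvd_iff.1 hd),
      ?_, ?_⟩
    · rw [hspan]
      apply le_antisymm
      · rw [Ideal.span_le]
        rintro x (rfl | rfl)
        · exact Ideal.mem_span_singleton.2 hd
        · exact Ideal.mem_span_singleton_self _
      · exact Ideal.span_mono (by simp)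
    · have hc : f (lamO ζ ^ 2 - lamO ζ - 1) ≠ 0 := by
        have : f (lamO ζ ^ 2 - lamO ζ - 1) = f (lamO ζ) := by
          simp only [map_sub, map_pow, map_one]
          linear_combination hl - f (lamO ζ) * h3
        rwa [this]
      have hR : Umat ζ * Tmat ζ ∈ Delta ζ := mul_mem (U_mem ζ) (T_mem ζ)
      refine full_one_of_lower (by simpa using hl) h3 hl hgen (T_mem ζ) (U_mem ζ) fT fT' fU fU'
        hc (a := f (-(lamO ζ ^ 2 - lamO ζ - 1) - (lamO ζ - 1)))
        (b := f (-(lamO ζ ^ 2 - lamO ζ - 1) * (2 + lamO ζ)))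
        (d := f ((lamO ζ ^ 2 - lamO ζ - 1) * (1 + lamO ζ) - (lamO ζ - 1))) ?_
      refine ⟨_, mul_mem hR (mul_mem hR (mul_mem hR (mul_mem hR hR))), _, ?_, map_two _ _ _ _ _⟩
      have eR : cm (Umat ζ * Tmat ζ) = !![-1, -(2 + lamO ζ); 1, 1 + lamO ζ] := by
        rw [cm_mul, cm_U, cm_T]
        ext1 i j
        fin_cases i <;> fin_cases j <;> simp <;> ring
      generalize Umat ζ * Tmat ζ = R at *
      rw [cm_mul, cm_mul, cm_mul, cm_mul, eR]
      generalize lamO ζ = l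
      simp only [Matrix.mul_fin_two]
      ext1 i j
      fin_cases i <;> fin_cases j <;> simp <;> ring

end NumberPart

theorem image_index_six_when_n_eq_five_three_pow
    (n k : ℕ) (hn : n = 5 * 3 ^ k)
    (ζ : ℂ) (hζ : IsPrimitiveRoot ζ n) :
    (∃! 𝔭 : Ideal (Oring ζ), 𝔭.IsMaximal ∧ (3 : Oring ζ) ∈ 𝔭) ∧
    (∀ 𝔭 : Ideal (Oring ζ), 𝔭.IsMaximal → (3 : Oring ζ) ∈ 𝔭 →
      Nonempty ((Oring ζ ⧸ 𝔭) ≃+* GaloisField 3 2) ∧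
      Nat.card ↥((Delta ζ).map (SLred ζ 𝔭)) = 120 ∧
      ((Delta ζ).map (SLred ζ 𝔭)).index = 6 ∧
      (∀ d : ℕ, 1 ≤ d → ((Delta ζ).map (SLred ζ (𝔭 ^ d))).index = 6)) := by
  have hn0 : 0 < n := by rw [hn]; positivity
  refine ⟨?_, ?_⟩
  · obtain ⟨p, hp, hle⟩ := Ideal.exists_le_maximal (Ideal.span {(3 : Oring ζ)})
      (by rw [Ne, Ideal.span_singleton_eq_top]; exact three_not_unit hn0 hζ)
    have h3 : (3 : Oring ζ) ∈ p := hle (Ideal.mem_span_singleton_self _)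
    refine ⟨p, ⟨hp, h3⟩, ?_⟩
    rintro q ⟨hq, hq3⟩
    rw [eq_span hn hζ p hp h3, eq_span hn hζ q hq hq3]
  · intro p hp hp3
    let _ := Ideal.Quotient.field p
    have h3 : (3 : Oring ζ ⧸ p) = 0 := by
      have := Ideal.Quotient.eq_zero_iff_mem.2 hp3
      rwa [map_ofNat] at this
    have hs : Function.Surjective (Ideal.Quotient.mk p) := Ideal.Quotient.mk_surjective
    have hl := quad_mem hn hζ (Ideal.Quotient.mk p) h3
    have hgen := nat_gen hn hζ (Ideal.Quotient.mk p) hs h3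
    have h9 := card_nine h3 hl hgen
    have hmap : (Delta ζ).map (SLred ζ p) =
        Subgroup.closure {FT (Ideal.Quotient.mk p (lamO ζ)), FU (Oring ζ ⧸ p)} := by
      rw [Delta, MonoidHom.map_closure, Set.image_pair]
      congr 2
      · apply cm_inj
        change (Ideal.Quotient.mk p).mapMatrix (cm (Tmat ζ)) = _
        rw [cm_T, map_two, map_add, map_one, map_zero, map_ofNat]
        rfl
      · congr 1
        apply cm_inj
        change (Ideal.Quotient.mk p).mapMatrix (cm (Umat ζ)) = _
        rw [cm_U, map_two, map_neg, map_one, map_zero]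
        rfl
    have hcard : Nat.card ↥((Delta ζ).map (SLred ζ p)) = 120 := by
      rw [hmap]
      exact card_closure h3 hl
    have hidx : ((Delta ζ).map (SLred ζ p)).index = 6 := by
      have h1 := ((Delta ζ).map (SLred ζ p)).card_mul_index
      rw [hcard] at h1
      have h2 : Nat.card SL(2, Oring ζ ⧸ p) = 720 := card_SL2 h9
      rw [h2] at h1
      omega
    refine ⟨?_, hcard, hidx, ?_⟩
    · have : Finite (Oring ζ ⧸ p) := Nat.finite_of_card_ne_zero (by omega)
      have : Fintype (Oring ζ ⧸ p) := Fintype.ofFinite _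
      have : Fintype (GaloisField 3 2) := Fintype.ofFinite _
      refine ⟨FiniteField.ringEquivOfCardEq ?_⟩
      rw [← Nat.card_eq_fintype_card, ← Nat.card_eq_fintype_card, h9,
        GaloisField.card 3 2 (by norm_num)]
      norm_num
    · intro d hd
      obtain ⟨w, hw0, hpw, hfull⟩ := exists_unif hn hζ p hp hp3 (Ideal.Quotient.mk p) hs
        Ideal.mk_ker h3
      exact (index_lift p (Ideal.Quotient.mk p) Ideal.mk_ker w hpw hw0 h3 (Delta ζ) hfull hd).trans
        hidx

end
end
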